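/- arXiv:2511.05192 — 2 statements merged into one kernel-verified Lean document; each statement's English description precedes it below -/
import Mathlib

section
/- Let K be a finite extension of ℚ_p with absolute Galois group G_K. Then p is the unique prime number ℓ such that the ℤ/ℓ-dimension of (G_K^{ab/tor})/ℓ(G_K^{ab/tor}) is at least 2, where G_K^{ab/tor} denotes the abelianization of G_K modulo its torsion subgroup. -/
noncomputable section

variable (p : ℕ) [Fact p.Prime] (K : Type*) [Field K]
  [Algebra ℚ_[p] K] [FiniteDimensional ℚ_[p] K]

/-- The absolute Galois group of `K`, with the Krull topology. -/
abbrev AbsGal := AlgebraicClosure K ≃ₐ[K] AlgebraicClosure K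

/-- `G_K^{ab/tor}`: the topological abelianization of the absolute Galois group of `K`,
modulo (the closure of) its torsion subgroup. -/
abbrev AbTor :=
  TopologicalAbelianization (AbsGal K) ⧸
    (CommGroup.torsion (TopologicalAbelianization (AbsGal K))).topologicalClosure

section Helpers

open scoped NNReal Pointwise commutatorElement

section Frob

variable {k κ : Type*} [Field k] [Finite k] [Field κ] [Algebra k κ] [Algebra.IsAlgebraic k κ]

theorem exists_eq_frobenius_pow_on_finite (σ : Gal(κ/k)) (S : Set κ) (hS : S.Finite) :
    ∃ i : ℕ, ∀ x ∈ S, σ x = x ^ Nat.card k ^ i := by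
  have := Fintype.ofFinite k
  have := hS.to_subtype
  let E := IntermediateField.adjoin k S
  have : FiniteDimensional k E :=
    IntermediateField.finiteDimensional_adjoin
      fun x _ ↦ (Algebra.IsAlgebraic.isAlgebraic x).isIntegral
  have : Finite E := Module.finite_of_finite k
  obtain ⟨i, hi⟩ := (FiniteField.bijective_frobeniusAlgEquivOfAlgebraic_pow k E).2
    (σ.restrictNormal E)
  refine ⟨i, fun x hx ↦ ?_⟩
  have h := σ.restrictNormal_commutes E ⟨x, IntermediateField.subset_adjoin k S hx⟩
  rw [← hi] at h
  simp only [AlgEquiv.coe_pow, FiniteField.coe_frobeniusAlgEquivOfAlgebraic_iterate] at h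
  rw [Nat.card_eq_fintype_card]
  simpa using h.symm

end Frob

section Lift

variable (G B : Type*) [Group G] [CommRing B] [MulSemiringAction G B]

instance FixedPoints.subring_smulCommClass : SMulCommClass G (FixedPoints.subring B G) B where
  smul_comm g a b := by
    rw [Subring.smul_def, Subring.smul_def, smul_eq_mul, smul_eq_mul, smul_mul', a.2 g]

instance FixedPoints.subring_isInvariant : Algebra.IsInvariant (FixedPoints.subring B G) B G where
  isInvariant b hb := ⟨⟨b, hb⟩, rfl⟩

variable [IsLocalRing B]

theorem IsLocalRing.smul_maximalIdeal_eq (g : G) :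
    g • IsLocalRing.maximalIdeal B = IsLocalRing.maximalIdeal B := by
  ext x
  rw [Ideal.mem_pointwise_smul_iff_inv_smul_mem]
  simp only [IsLocalRing.mem_maximalIdeal, mem_nonunits_iff]
  exact not_congr (isUnit_map_iff (MulSemiringAction.toRingEquiv G B g⁻¹) x)

variable [TopologicalSpace G] [CompactSpace G] [TotallyDisconnectedSpace G] [IsTopologicalGroup G]

/-- The residue field of the subring of invariants. -/
abbrev FixedPoints.residueField := FixedPoints.subring B G ⧸
  (IsLocalRing.maximalIdeal B).under (FixedPoints.subring B G)

variable {G B} in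
theorem exists_smul_residue_eq (hG : ∀ b : B, IsOpen (MulAction.stabilizer G b : Set G))
    (σ : (B ⧸ IsLocalRing.maximalIdeal B) ≃ₐ[FixedPoints.residueField G B]
      (B ⧸ IsLocalRing.maximalIdeal B)) :
    ∃ g : G, ∀ b : B, Ideal.Quotient.mk (IsLocalRing.maximalIdeal B) (g • b) =
      σ (Ideal.Quotient.mk _ b) := by
  let : TopologicalSpace B := ⊥
  have : DiscreteTopology B := ⟨rfl⟩
  have : ContinuousSMul G B := continuousSMul_iff_stabilizer_isOpen.2 hG
  obtain ⟨g, hg⟩ := Ideal.Quotient.stabilizerHom_surjective_of_profinite (G := G)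
    ((IsLocalRing.maximalIdeal B).under (FixedPoints.subring B G)) (IsLocalRing.maximalIdeal B) σ
  exact ⟨g, fun b ↦ by rw [← hg]; rfl⟩

variable {G B} in
theorem isIntegral_residueField (hG : ∀ b : B, IsOpen (MulAction.stabilizer G b : Set G)) :
    Algebra.IsIntegral (FixedPoints.residueField G B) (B ⧸ IsLocalRing.maximalIdeal B) := by
  let : TopologicalSpace B := ⊥
  have : DiscreteTopology B := ⟨rfl⟩
  have : ContinuousSMul G B := continuousSMul_iff_stabilizer_isOpen.2 hG
  have : Algebra.IsIntegral (FixedPoints.subring B G) B :=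
    Algebra.IsInvariant.isIntegral_of_profinite (G := G)
  infer_instance

end Lift

section Val

variable {k C : Type*} [Field k] [Field C] [Algebra k C] (v : Valuation C ℝ≥0)

theorem Valuation.mem_maximalIdeal_integer (x : v.integer) :
    x ∈ IsLocalRing.maximalIdeal v.integer ↔ v x < 1 := by
  rw [IsLocalRing.mem_maximalIdeal, mem_nonunits_iff,
    (Valuation.integer.integers v).isUnit_iff_valuation_eq_one]
  exact ⟨fun h ↦ lt_of_le_of_ne x.2 h, fun h ↦ h.ne⟩

theorem Valuation.residue_eq_iff (x y : v.integer) :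
    Ideal.Quotient.mk (IsLocalRing.maximalIdeal v.integer) x = Ideal.Quotient.mk _ y ↔
      v ((x : C) - y) < 1 := by
  rw [Ideal.Quotient.eq, v.mem_maximalIdeal_integer]
  rfl

/-- The inertia subgroup of a Galois group with respect to an invariant valuation. -/
def valInertia (hv : ∀ (g : Gal(C/k)) (x : C), v (g x) = v x) : Subgroup Gal(C/k) where
  carrier := {g | ∀ x, v x ≤ 1 → v (g x - x) < 1}
  one_mem' x _ := by simp
  mul_mem' {g h} hg hh x hx := by
    have : (g * h) x - x = g (h x - x) + (g x - x) := by simp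
    rw [this]
    exact v.map_add_lt ((hv _ _).trans_lt (hh x hx)) (hg x hx)
  inv_mem' {g} hg x hx := by
    have : g⁻¹ x - x = - g⁻¹ (g x - x) := by
      rw [map_sub, ← AlgEquiv.mul_apply]; simp
    rw [this, Valuation.map_neg, hv]
    exact hg x hx

variable (hv : ∀ (g : Gal(C/k)) (x : C), v (g x) = v x)

theorem mem_valInertia {g : Gal(C/k)} :
    g ∈ valInertia v hv ↔ ∀ x, v x ≤ 1 → v (g x - x) < 1 := Iff.rfl

include hv

theorem isInvariantSubring_integer (V : Subgroup Gal(C/k)) : IsInvariantSubring V v.integer where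
  smul_mem g x hx := by
    have h : v x ≤ 1 := hx
    exact (hv g x).trans_le h

variable [IsGalois k C]

omit hv in
theorem isOpen_stabilizer_integer (V : Subgroup Gal(C/k)) [IsInvariantSubring V v.integer]
    (b : v.integer) : IsOpen (MulAction.stabilizer V b : Set V) := by
  convert (stabilizer_isOpen_of_isIntegral (K := k) (b : C)).preimage
    (continuous_subtype_val (p := (· ∈ V)))
  ext g
  exact Subtype.ext_iff

omit [IsGalois k C] in
theorem exists_ringEquiv_residue (g : Gal(C/k)) :
    ∃ e : (v.integer ⧸ IsLocalRing.maximalIdeal v.integer) ≃+*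
      (v.integer ⧸ IsLocalRing.maximalIdeal v.integer),
      ∀ x (hx : v x ≤ 1), e (Ideal.Quotient.mk _ ⟨x, hx⟩) =
        Ideal.Quotient.mk _ ⟨g x, (hv g x).trans_le hx⟩ := by
  have := isInvariantSubring_integer v hv ⊤
  refine ⟨Ideal.quotientEquiv _ _
    (MulSemiringAction.toRingEquiv (⊤ : Subgroup Gal(C/k)) v.integer ⟨g, trivial⟩) ?_, ?_⟩
  · exact (IsLocalRing.smul_maximalIdeal_eq (⊤ : Subgroup Gal(C/k)) v.integer ⟨g, trivial⟩).symm
  · intro x hx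
    rfl

theorem exists_mem_residue_eq (V : Subgroup Gal(C/k)) (hV : IsClosed (V : Set Gal(C/k)))
    (g : Gal(C/k))
    (hg : ∀ x, v x ≤ 1 → (∀ w ∈ V, w x = x) → v (g x - x) < 1) :
    ∃ w ∈ V, w⁻¹ * g ∈ valInertia v hv := by
  have := isInvariantSubring_integer v hv V
  have : CompactSpace V := isCompact_iff_compactSpace.1 hV.isCompact
  obtain ⟨e, he⟩ := exists_ringEquiv_residue v hv g
  let σ : (v.integer ⧸ IsLocalRing.maximalIdeal v.integer)
      ≃ₐ[FixedPoints.residueField V v.integer]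
      (v.integer ⧸ IsLocalRing.maximalIdeal v.integer) := AlgEquiv.ofRingEquiv (f := e) (by
    rintro ⟨x⟩
    refine (he x.1.1 x.1.2).trans ?_
    exact (v.residue_eq_iff _ _).2 (hg _ x.1.2 fun w hw ↦ congrArg Subtype.val (x.2 ⟨w, hw⟩)))
  obtain ⟨w, hw⟩ := exists_smul_residue_eq (isOpen_stabilizer_integer v V) σ
  refine ⟨w, w.2, fun x hx ↦ ?_⟩
  have h1 := (hw ⟨x, hx⟩).trans (he x hx)
  rw [v.residue_eq_iff] at h1
  rw [← hv w, map_sub, AlgEquiv.mul_apply, ← AlgEquiv.mul_apply, mul_inv_cancel,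
    AlgEquiv.one_apply, Valuation.map_sub_swap]
  exact h1

/-- The residue field of the base is `𝔽_q`, Galois elements act on residues through powers of
the `q`-Frobenius, and the `q`-Frobenius lifts. -/
theorem exists_frobenius (p : ℕ) [Fact p.Prime] (hp : v (p : C) < 1)
    (hfin : ∃ T : Set k, T.Finite ∧ ∀ x : k, v (algebraMap k C x) ≤ 1 →
      ∃ t ∈ T, v (algebraMap k C (x - t)) < 1) :
    ∃ f : ℕ, 0 < f ∧
      (∀ (g : Gal(C/k)) (S : Set C), S.Finite → (∀ x ∈ S, v x ≤ 1) →
        ∃ i : ℕ, ∀ x ∈ S, v (g x - x ^ (p ^ f) ^ i) < 1) ∧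
      ∃ F : Gal(C/k), ∀ x, v x ≤ 1 → v (F x - x ^ p ^ f) < 1 := by
  set V : Subgroup Gal(C/k) := ⊤
  have := isInvariantSubring_integer v hv V
  have : CompactSpace V := isCompact_iff_compactSpace.1 (by simpa [V] using isCompact_univ)
  let κ := v.integer ⧸ IsLocalRing.maximalIdeal v.integer
  let k₀ := FixedPoints.residueField V v.integer
  let : Field κ := Ideal.Quotient.field _
  have hint : Algebra.IsIntegral k₀ κ := isIntegral_residueField (isOpen_stabilizer_integer v V)
  have hk₀ : IsField k₀ := isField_of_isIntegral_of_isField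
    (R := k₀) (S := κ) (FaithfulSMul.algebraMap_injective _ _) (Field.toIsField κ)
  let : Field k₀ := { hk₀.toField with toCommRing := inferInstance }
  have hbase : ∀ x : FixedPoints.subring v.integer V, ∃ y : k, algebraMap k C y = x := by
    intro x
    exact (InfiniteGalois.mem_range_algebraMap_iff_fixed x.1.1).2
      fun g ↦ congrArg Subtype.val (x.2 ⟨g, trivial⟩)
  have : Finite k₀ := by
    obtain ⟨T, hT, hTk⟩ := hfin
    have := hT.to_subtype
    choose r hr using Ideal.Quotient.mk_surjective
      (I := (IsLocalRing.maximalIdeal v.integer).under (FixedPoints.subring v.integer V))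
    choose y hy using hbase
    choose t htT ht using fun a : k₀ ↦ hTk (y (r a)) (by rw [hy]; exact (r a).1.2)
    refine Finite.of_injective (fun a ↦ (⟨t a, htT a⟩ : T)) fun a b hab ↦ ?_
    have hab' : t a = t b := congrArg Subtype.val hab
    rw [← hr a, ← hr b, Ideal.Quotient.eq, Ideal.mem_comap, v.mem_maximalIdeal_integer]
    have h1 := v.map_sub_lt (ht a) (ht b)
    rw [← map_sub, hab', sub_sub_sub_cancel_right, map_sub, hy, hy] at h1
    exact h1
  have hpκ : (p : κ) = 0 := by
    rw [← map_natCast (Ideal.Quotient.mk (IsLocalRing.maximalIdeal v.integer)),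
      Ideal.Quotient.eq_zero_iff_mem, v.mem_maximalIdeal_integer]
    simpa using hp
  have : CharP k₀ p := by
    refine (CharP.charP_iff_prime_eq_zero Fact.out).2 ?_
    apply FaithfulSMul.algebraMap_injective k₀ κ
    rw [map_natCast, map_zero, hpκ]
  have := Fintype.ofFinite k₀
  have : Algebra.IsAlgebraic k₀ κ := hint.isAlgebraic
  obtain ⟨⟨f, hf⟩, -, hcard⟩ := FiniteField.card k₀ p
  refine ⟨f, hf, fun g S hS hSv ↦ ?_, ?_⟩
  · obtain ⟨e, he⟩ := exists_ringEquiv_residue v hv g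
    let σ : κ ≃ₐ[k₀] κ := AlgEquiv.ofRingEquiv (f := e) (by
      rintro ⟨x⟩
      refine (he x.1.1 x.1.2).trans ?_
      exact congrArg _ (x.2 ⟨g, trivial⟩))
    obtain ⟨i, hi⟩ := exists_eq_frobenius_pow_on_finite σ
      {y | ∃ x, ∃ hx : v x ≤ 1, x ∈ S ∧ y = Ideal.Quotient.mk _ ⟨x, hx⟩} (by
        refine ((hS.preimage (f := ((↑) : v.integer → C))
          Subtype.val_injective.injOn).image (Ideal.Quotient.mk _)).subset ?_
        rintro _ ⟨x, hx, hxS, rfl⟩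
        exact ⟨⟨x, hx⟩, hxS, rfl⟩)
    refine ⟨i, fun x hx ↦ ?_⟩
    have h1 := (he x (hSv x hx)).symm.trans (hi _ ⟨x, hSv x hx, hx, rfl⟩)
    rw [Nat.card_eq_fintype_card, hcard, ← map_pow, v.residue_eq_iff] at h1
    exact h1
  · obtain ⟨g, hg⟩ := exists_smul_residue_eq (isOpen_stabilizer_integer v V)
      (FiniteField.frobeniusAlgEquivOfAlgebraic k₀ κ)
    refine ⟨g, fun x hx ↦ ?_⟩
    have h1 := hg ⟨x, hx⟩
    rw [FiniteField.coe_frobeniusAlgEquivOfAlgebraic, hcard] at h1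
    exact (v.residue_eq_iff _ _).1 (h1.trans (map_pow _ _ _).symm)

end Val

section Elem

variable {k C : Type*} [Field k] [Field C] [Algebra k C] (v : Valuation C ℝ≥0)

theorem Valuation.pow_sub_pow_lt_one {x y : C} (hx : v x ≤ 1) (hy : v y ≤ 1) (h : v (x - y) < 1)
    (n : ℕ) : v (x ^ n - y ^ n) < 1 := by
  have h1 := (v.residue_eq_iff ⟨x, hx⟩ ⟨y, hy⟩).2 h
  have h2 := congrArg (· ^ n) h1
  simp only [← map_pow] at h2
  exact (v.residue_eq_iff _ _).1 h2

theorem Valuation.sub_lt_trans {x y z : C} {r : ℝ≥0} (h : v (x - y) < r) (h' : v (y - z) < r) :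
    v (x - z) < r := by
  rw [← sub_add_sub_cancel x y z]
  exact v.map_add_lt h h'

theorem Valuation.intCast_le_one (n : ℤ) : v (n : C) ≤ 1 := intCast_mem v.integer n

theorem Valuation.natCast_eq_one {p n : ℕ} (hp : v (p : C) < 1) (hn : n.Coprime p) :
    v (n : C) = 1 := by
  refine le_antisymm (natCast_mem v.integer n) (le_of_not_gt fun h ↦ ?_)
  obtain ⟨a, b, hab⟩ := Nat.isCoprime_iff_coprime.2 hn
  have h1 : (a : C) * n + b * p = 1 := by exact_mod_cast congrArg (Int.cast (R := C)) hab
  have h2 : v ((a : C) * n + b * p) < 1 := by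
    refine v.map_add_lt ?_ ?_ <;> rw [map_mul]
    · exact mul_lt_one_of_nonneg_of_lt_one_right (v.intCast_le_one a) zero_le h
    · exact mul_lt_one_of_nonneg_of_lt_one_right (v.intCast_le_one b) zero_le hp
  rw [h1, map_one] at h2
  exact lt_irrefl _ h2

theorem Valuation.eq_one_of_pow_eq_one {z : C} {n : ℕ} (hn : n ≠ 0) (hz : z ^ n = 1) :
    v z = 1 := by
  rw [← pow_eq_one_iff_of_nonneg zero_le hn, ← map_pow, hz, map_one]

theorem Valuation.eq_of_pow_eq_one_of_sub_lt {p n : ℕ} (hp : v (p : C) < 1) (hn : n.Coprime p)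
    (hn0 : n ≠ 0) {y z : C} (hy : y ^ n = 1) (hz : z ^ n = 1) (h : v (y - z) < 1) : y = z := by
  have hz0 : z ≠ 0 := by rintro rfl; simp [hn0] at hz
  have hz1 := v.eq_one_of_pow_eq_one hn0 hz
  rw [← div_eq_one_iff_eq hz0]
  set w := y / z
  have hw : w ^ n = 1 := by rw [div_pow, hy, hz, div_one]
  have hw1 := v.eq_one_of_pow_eq_one hn0 hw
  have hlt : v (w - 1) < 1 := by
    rw [div_sub_one hz0, map_div₀, hz1, div_one]; exact h
  by_contra hne
  have hsum : ∑ i ∈ Finset.range n, w ^ i = 0 := by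
    have := geom_sum_mul w n
    rw [hw, sub_self] at this
    exact (mul_eq_zero.1 this).resolve_right (sub_ne_zero.2 hne)
  have h1 : v (∑ i ∈ Finset.range n, (1 ^ i - w ^ i)) < 1 :=
    v.map_sum_lt one_ne_zero fun i _ ↦
      v.pow_sub_pow_lt_one (by simp) hw1.le (by rwa [v.map_sub_swap]) i
  rw [Finset.sum_sub_distrib, hsum] at h1
  simp [v.natCast_eq_one hp hn] at h1

theorem isOpen_setOf_algEquiv_apply [Algebra.IsIntegral k C] (P : C → Prop) (x : C) :
    IsOpen {g : Gal(C/k) | P (g x)} := by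
  let : TopologicalSpace C := ⊥
  have : DiscreteTopology C := ⟨rfl⟩
  have : ContinuousSMul Gal(C/k) C :=
    continuousSMul_iff_stabilizer_isOpen.2 stabilizer_isOpen_of_isIntegral
  exact (isOpen_discrete {y | P y}).preimage
    (continuous_id.smul continuous_const : Continuous fun g : Gal(C/k) ↦ g • x)

theorem isClosed_setOf_algEquiv_apply [Algebra.IsIntegral k C] (P : C → Prop) (x : C) :
    IsClosed {g : Gal(C/k) | P (g x)} := by
  rw [← isOpen_compl_iff]
  exact isOpen_setOf_algEquiv_apply (fun y ↦ ¬ P y) x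

/-- `F` lifts the `q`-power Frobenius of the residue field, which topologically generates the
action of the Galois group on the residue field. -/
structure IsFrobeniusLift (q : ℕ) (F : Gal(C/k)) : Prop where
  sub_lt : ∀ x, v x ≤ 1 → v (F x - x ^ q) < 1
  exists_pow : ∀ (g : Gal(C/k)) (S : Set C), S.Finite → (∀ x ∈ S, v x ≤ 1) →
        ∃ i : ℕ, ∀ x ∈ S, v (g x - x ^ q ^ i) < 1

variable (hv : ∀ (g : Gal(C/k)) (x : C), v (g x) = v x)

instance valInertia_normal : (valInertia v hv).Normal where
  conj_mem g hg h x hx := by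
    have : (h * g * h⁻¹) x - x = h (g (h⁻¹ x) - h⁻¹ x) := by
      rw [map_sub, AlgEquiv.mul_apply, AlgEquiv.mul_apply, ← AlgEquiv.mul_apply h h⁻¹]; simp
    rw [this, hv]
    exact hg _ (by rwa [hv])

theorem isClosed_valInertia [Algebra.IsIntegral k C] :
    IsClosed (valInertia v hv : Set Gal(C/k)) := by
  have : (valInertia v hv : Set Gal(C/k)) =
      ⋂ x : {x : C // v x ≤ 1}, {g | v (g x - x) < 1} := by
    ext g
    simp [mem_valInertia]
  rw [this]
  exact isClosed_iInter fun x ↦ isClosed_setOf_algEquiv_apply (fun y ↦ v (y - x) < 1) x.1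

namespace IsFrobeniusLift

variable {v} {q : ℕ} {F : Gal(C/k)} (hF : IsFrobeniusLift v q F)
include hF

theorem exists_pow_single (g : Gal(C/k)) {x : C} (hx : v x ≤ 1) :
    ∃ i, v (g x - x ^ q ^ i) < 1 := by
  simpa using hF.exists_pow g {x} (Set.finite_singleton x) (by simpa)

include hv

theorem pow_sub_lt (i : ℕ) {x : C} (hx : v x ≤ 1) : v ((F ^ i) x - x ^ q ^ i) < 1 := by
  induction i with
  | zero => simp
  | succ i ih =>
    rw [pow_succ', AlgEquiv.mul_apply]
    have h1 : v (F ((F ^ i) x) - F (x ^ q ^ i)) < 1 := by rwa [← map_sub, hv]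
    have hx' : v (x ^ q ^ i) ≤ 1 := by rw [map_pow]; exact pow_le_one' hx _
    refine v.sub_lt_trans h1 ?_
    rw [pow_succ, pow_mul]
    exact hF.sub_lt _ hx'

theorem commutator_le : commutator Gal(C/k) ≤ valInertia v hv := by
  rw [commutator_def, Subgroup.commutator_le]
  rintro g - h - x hx
  set y := (h * g)⁻¹ x
  have hxy : x = (h * g) y := by rw [← AlgEquiv.mul_apply, mul_inv_cancel, AlgEquiv.one_apply]
  have hy : v y ≤ 1 := by rwa [hv]
  have h1 : ⁅g, h⁆ x = (g * h) y := by
    rw [← AlgEquiv.mul_apply, mul_inv_rev, commutatorElement_def]; simp only [mul_assoc]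
  obtain ⟨a, ha⟩ := hF.exists_pow_single g hy
  obtain ⟨b, hb⟩ := hF.exists_pow_single h hy
  have key : ∀ (g h : Gal(C/k)) (a b : ℕ), v (g y - y ^ q ^ a) < 1 → v (h y - y ^ q ^ b) < 1 →
      v ((g * h) y - y ^ q ^ (a + b)) < 1 := by
    intro g h a b ha hb
    have h1 : v (g (h y) - g (y ^ q ^ b)) < 1 := by rwa [← map_sub, hv]
    refine v.sub_lt_trans h1 ?_
    rw [map_pow, pow_add, pow_mul]
    exact v.pow_sub_pow_lt_one (by rwa [hv]) (by rw [map_pow]; exact pow_le_one' hy _) ha _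
  rw [h1, hxy]
  refine v.sub_lt_trans (key g h a b ha hb) ?_
  rw [v.map_sub_swap, add_comm]
  exact key h g b a hb ha

theorem exists_pow_sub_self {x : C} (hx : v x ≤ 1) : ∃ m, 0 < m ∧ v (x ^ q ^ m - x) < 1 := by
  obtain ⟨i, hi⟩ := hF.exists_pow_single F⁻¹ hx
  refine ⟨i + 1, i.succ_pos, ?_⟩
  have h1 : v (F (F⁻¹ x) - F (x ^ q ^ i)) < 1 := by rwa [← map_sub, hv]
  rw [← AlgEquiv.mul_apply, mul_inv_cancel, AlgEquiv.one_apply] at h1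
  rw [v.map_sub_swap]
  refine v.sub_lt_trans h1 ?_
  rw [pow_succ, pow_mul]
  exact hF.sub_lt _ (by rw [map_pow]; exact pow_le_one' hx _)

theorem eq_top_of_isClosed [IsGalois k C] (H : Subgroup Gal(C/k)) (hH : IsClosed (H : Set Gal(C/k)))
    (hFH : F ∈ H) (hI : valInertia v hv ≤ H) : H = ⊤ := by
  refine eq_top_iff.2 fun g _ ↦ ?_
  obtain ⟨h, hh, hhg⟩ := hH.isCompact.inter_iInter_nonempty
    (fun x : {x : C // v x ≤ 1} ↦ {h : Gal(C/k) | v (h x - g x) < 1})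
    (fun x ↦ isClosed_setOf_algEquiv_apply (fun y ↦ v (y - g x) < 1) x.1) (fun u ↦ by
      obtain ⟨i, hi⟩ := hF.exists_pow g (Subtype.val '' (u : Set {x : C // v x ≤ 1}))
        (u.finite_toSet.image _) (by rintro _ ⟨x, -, rfl⟩; exact x.2)
      refine ⟨F ^ i, H.pow_mem hFH i, Set.mem_iInter₂.2 fun x hx ↦ ?_⟩
      refine v.sub_lt_trans (hF.pow_sub_lt hv i x.2) ?_
      rw [v.map_sub_swap]
      exact hi _ ⟨x, hx, rfl⟩)
  rw [← mul_inv_cancel_left h g]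
  refine H.mul_mem hh (hI fun x hx ↦ ?_)
  have h1 := Set.mem_iInter.1 hhg ⟨x, hx⟩
  rw [Set.mem_ofPred_eq, v.map_sub_swap, ← hv h⁻¹, map_sub, ← AlgEquiv.mul_apply,
    ← AlgEquiv.mul_apply, inv_mul_cancel, AlgEquiv.one_apply] at h1
  exact h1

section Roots

variable {p : ℕ} (hp : v (p : C) < 1) (hpq : p ∣ q) (hq : 1 < q)
include hp hpq hq

omit hF hv hp in
theorem coprime_pow_sub_one {m : ℕ} (hm : 0 < m) : (q ^ m - 1).Coprime p := by
  have h1 : (q ^ m - 1).Coprime (q ^ m) := by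
    rw [Nat.coprime_self_sub_left]
    · exact Nat.coprime_one_left _
    · exact Nat.one_le_pow _ _ (by omega)
  exact h1.coprime_dvd_right (hpq.trans (dvd_pow_self q hm.ne'))

omit hF hv hp hpq in
theorem pow_sub_one_ne_zero {m : ℕ} (hm : 0 < m) : q ^ m - 1 ≠ 0 := by
  have := Nat.one_lt_pow hm.ne' hq
  omega

variable {m : ℕ} (hm : 0 < m) {z : C} (hz : IsPrimitiveRoot z (q ^ m - 1))
include hm hz

omit hF hv hz in
theorem eq_of_sub_lt {x y : C} (hx : x ^ (q ^ m - 1) = 1) (hy : y ^ (q ^ m - 1) = 1)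
    (h : v (x - y) < 1) : x = y :=
  v.eq_of_pow_eq_one_of_sub_lt hp (coprime_pow_sub_one hpq hq hm)
    (pow_sub_one_ne_zero hq hm) hx hy h

omit hv in
theorem exists_apply_primitiveRoot (g : Gal(C/k)) : ∃ i, g z = z ^ q ^ i := by
  obtain ⟨i, hi⟩ := hF.exists_pow_single g
    (v.eq_one_of_pow_eq_one (pow_sub_one_ne_zero hq hm) hz.pow_eq_one).le
  refine ⟨i, eq_of_sub_lt hp hpq hq hm ?_ ?_ hi⟩
  · rw [← map_pow, hz.pow_eq_one, map_one]
  · rw [pow_right_comm, hz.pow_eq_one, one_pow]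

omit hF in
theorem inertia_apply_primitiveRoot {g : Gal(C/k)} (hg : g ∈ valInertia v hv) : g z = z := by
  refine eq_of_sub_lt hp hpq hq hm ?_ hz.pow_eq_one
    (hg z (v.eq_one_of_pow_eq_one (pow_sub_one_ne_zero hq hm) hz.pow_eq_one).le)
  rw [← map_pow, hz.pow_eq_one, map_one]

theorem pow_apply_primitiveRoot (i : ℕ) : (F ^ i) z = z ^ q ^ i := by
  refine eq_of_sub_lt hp hpq hq hm ?_ ?_ (hF.pow_sub_lt hv i
    (v.eq_one_of_pow_eq_one (pow_sub_one_ne_zero hq hm) hz.pow_eq_one).le)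
  · rw [← map_pow, hz.pow_eq_one, map_one]
  · rw [pow_right_comm, hz.pow_eq_one, one_pow]

omit hF hv hp hpq in
theorem dvd_of_primitiveRoot_pow_eq {i : ℕ} (h : z ^ q ^ i = z) : m ∣ i := by
  have hz0 : z ≠ 0 := hz.ne_zero (pow_sub_one_ne_zero hq hm)
  have hi : 1 ≤ q ^ i := Nat.one_le_pow _ _ (by omega)
  have h1 : z ^ (q ^ i - 1) = 1 := by
    apply mul_right_cancel₀ hz0
    rw [← pow_succ, Nat.sub_add_cancel hi, h, one_mul]
  have h2 := hz.dvd_of_pow_eq_one _ h1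
  have h3 := Nat.pow_sub_one_gcd_pow_sub_one q m i
  rw [Nat.gcd_eq_left h2] at h3
  have hle : 1 ≤ q ^ m := Nat.one_le_pow _ _ (by omega)
  have hle' : 1 ≤ q ^ (m.gcd i) := Nat.one_le_pow _ _ (by omega)
  have h4 : q ^ m = q ^ m.gcd i := by omega
  rw [Nat.pow_right_injective hq h4]
  exact Nat.gcd_dvd_right m i

omit hF hv hpq hp hq hm hz in
theorem iterate_apply {g : Gal(C/k)} {z : C} {i : ℕ} (hg : g z = z ^ q ^ i) (N : ℕ) :
    (g ^ N) z = z ^ q ^ (i * N) := by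
  induction N with
  | zero => simp
  | succ N ih => rw [pow_succ', AlgEquiv.mul_apply, ih, map_pow, hg, ← pow_mul, ← pow_add,
      Nat.mul_succ, add_comm]

omit hF hv hp hpq in
theorem exists_teichmuller {x : C} (h : v (x ^ q ^ m - x) < 1) :
    v x < 1 ∨ ∃ j : ℕ, v (x - z ^ j) < 1 := by
  by_contra! hcon
  obtain ⟨h0, h1⟩ := hcon
  have : NeZero (q ^ m - 1) := ⟨pow_sub_one_ne_zero hq hm⟩
  have hle : 1 ≤ q ^ m := Nat.one_le_pow _ _ (by omega)
  have hfac := congrArg (Polynomial.eval x)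
    (Polynomial.X_pow_sub_one_eq_prod (pow_sub_one_ne_zero hq hm).bot_lt hz)
  simp only [Polynomial.eval_sub, Polynomial.eval_pow, Polynomial.eval_X, Polynomial.eval_one,
    Polynomial.eval_prod, Polynomial.eval_C] at hfac
  have h2 : x ^ q ^ m - x = x * ∏ w ∈ Polynomial.nthRootsFinset (q ^ m - 1) (1 : C), (x - w) := by
    rw [← hfac, mul_sub, mul_one, ← pow_succ', Nat.sub_add_cancel hle]
  refine h.not_ge ?_
  rw [h2, map_mul, map_prod]
  refine one_le_mul h0 (Finset.one_le_prod' fun w hw ↦ ?_)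
  rw [Polynomial.mem_nthRootsFinset (pow_sub_one_ne_zero hq hm).bot_lt] at hw
  obtain ⟨j, -, rfl⟩ := hz.eq_pow_of_pow_eq_one hw
  exact h1 j

end Roots

section AlgClosed

variable [IsAlgClosed C] [CharZero C] {p : ℕ} (hp : v (p : C) < 1) (hpq : p ∣ q) (hq : 1 < q)
include hp hpq hq

omit hF hv hp hpq in
theorem exists_primitiveRoot {m : ℕ} (hm : 0 < m) : ∃ z : C, IsPrimitiveRoot z (q ^ m - 1) := by
  have : NeZero (q ^ m - 1) := ⟨pow_sub_one_ne_zero hq hm⟩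
  have : NeZero ((q ^ m - 1 : ℕ) : C) := NeZero.charZero
  exact HasEnoughRootsOfUnity.exists_primitiveRoot C (q ^ m - 1)

theorem mem_valInertia_of_pow_mem {g : Gal(C/k)} {N : ℕ} (hN : 0 < N)
    (hg : g ^ N ∈ valInertia v hv) : g ∈ valInertia v hv := by
  intro x hx
  obtain ⟨m, hm, hxm⟩ := hF.exists_pow_sub_self hv hx
  have hiter : ∀ j, v (x ^ q ^ (m * j) - x) < 1 := by
    intro j
    induction j with
    | zero => simp
    | succ j ih =>
      refine v.sub_lt_trans ?_ hxm
      rw [Nat.mul_succ, pow_add, pow_mul]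
      exact v.pow_sub_pow_lt_one (by rw [map_pow]; exact pow_le_one' hx _) hx ih _
  have hmN : 0 < m * N := Nat.mul_pos hm hN
  obtain ⟨z, hz⟩ := exists_primitiveRoot (C := C) hq hmN
  rcases exists_teichmuller hq hmN hz (hiter N) with h | ⟨j, hj⟩
  · exact v.map_sub_lt (by rwa [hv]) h
  obtain ⟨i, hi⟩ := hF.exists_apply_primitiveRoot hp hpq hq hmN hz g
  have h1 := inertia_apply_primitiveRoot hv hp hpq hq hmN hz hg
  rw [iterate_apply hi] at h1
  obtain ⟨l, rfl⟩ := Nat.dvd_of_mul_dvd_mul_right hN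
    (dvd_of_primitiveRoot_pow_eq hq hmN hz h1)
  have hz1 : v (z ^ j) ≤ 1 := by
    rw [map_pow, v.eq_one_of_pow_eq_one (pow_sub_one_ne_zero hq hmN) hz.pow_eq_one, one_pow]
  have h2 : v (g x - g (z ^ j)) < 1 := by rwa [← map_sub, hv]
  refine v.sub_lt_trans h2 (v.sub_lt_trans ?_ (hiter l))
  rw [map_pow, hi, pow_right_comm]
  exact v.pow_sub_pow_lt_one hz1 hx (by rwa [v.map_sub_swap]) _

theorem dvd_of_inv_pow_mul_mem {e : Gal(C/k)} {M i : ℕ} (hM : 0 < M)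
    (h : (e ^ M)⁻¹ * F ^ i ∈ valInertia v hv) : M ∣ i := by
  obtain ⟨z, hz⟩ := exists_primitiveRoot (C := C) hq hM
  obtain ⟨a, ha⟩ := hF.exists_apply_primitiveRoot hp hpq hq hM hz e
  have h1 := inertia_apply_primitiveRoot hv hp hpq hq hM hz h
  have hle : 1 ≤ q ^ M := Nat.one_le_pow _ _ (by omega)
  have hzM : z ^ q ^ M = z := by
    conv_lhs => rw [← Nat.sub_add_cancel hle, pow_succ, hz.pow_eq_one, one_mul]
  have hzaM : ∀ a : ℕ, z ^ q ^ (a * M) = z := by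
    intro a
    induction a with
    | zero => simp
    | succ a ih => rw [Nat.succ_mul, pow_add, pow_mul, ih, hzM]
  have he : (e ^ M) z = z := by rw [iterate_apply ha, hzaM]
  have h2 := congrArg (e ^ M) h1
  rw [← AlgEquiv.mul_apply, mul_inv_cancel_left, he, hF.pow_apply_primitiveRoot hv hp hpq hq hM hz]
    at h2
  exact dvd_of_primitiveRoot_pow_eq hq hM hz h2

end AlgClosed

end IsFrobeniusLift

end Elem

section Tame

variable {k C : Type*} [Field k] [Field C] [Algebra k C] {v : Valuation C ℝ≥0}
  (hv : ∀ (g : Gal(C/k)) (x : C), v (g x) = v x)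

include hv in
/-- If `g` has finite order prime to the residue characteristic on `x`, and moves `g x - x` by a
small amount, then it fixes `x`. -/
theorem Valuation.apply_eq_of_pow_apply_eq {p m : ℕ} (hp : v (p : C) < 1) (hm : m.Coprime p)
    {g : Gal(C/k)} {x : C} (hx : (g ^ m) x = x) (h1 : g x ≠ x →
      v (g (g x - x) - (g x - x)) < v (g x - x)) : g x = x := by
  by_contra hne
  replace h1 := h1 hne
  set y := g x - x with hy
  have hpow : ∀ i : ℕ, v ((g ^ i) y - y) < v y := by
    intro i
    induction i with
    | zero => simpa using v.pos_iff.2 (sub_ne_zero.2 hne)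
    | succ i ih =>
      rw [pow_succ', AlgEquiv.mul_apply]
      refine v.sub_lt_trans (y := g y) ?_ h1
      rwa [← _root_.map_sub, hv]
  have hsum : ∑ i ∈ Finset.range m, (g ^ i) y = 0 := by
    calc ∑ i ∈ Finset.range m, (g ^ i) y
        = ∑ i ∈ Finset.range m, ((g ^ (i + 1)) x - (g ^ i) x) := by
          simp [hy, pow_succ]
      _ = (g ^ m) x - (g ^ 0) x := Finset.sum_range_sub (fun i ↦ (g ^ i) x) m
      _ = 0 := by rw [hx, pow_zero, AlgEquiv.one_apply, sub_self]
  have h2 : v (∑ i ∈ Finset.range m, ((g ^ i) y - y)) < v y :=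
    v.map_sum_lt (by simpa [v.zero_iff, hy] using sub_ne_zero.2 hne) fun i _ ↦ hpow i
  rw [Finset.sum_sub_distrib, hsum] at h2
  simp [v.natCast_eq_one hp hm] at h2

namespace IsFrobeniusLift

variable {q : ℕ} {F : Gal(C/k)} (hF : IsFrobeniusLift v q F)
include hF

theorem pow_apply_sub_lt (hq : 1 < q) {t : Gal(C/k)} (ht : t ∈ valInertia v hv) {x : C}
    (hx : x ≠ 0) (htF : t (F x) = F (t x)) : v ((t ^ (q - 1)) x - x) < v x := by
  have hx0 : v x ≠ 0 := v.ne_zero_iff.2 hx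
  have hunit : ∀ g : Gal(C/k), v (g x / x) = 1 := fun g ↦ by rw [map_div₀, hv, div_self hx0]
  set w := t x / x with hw
  have htx : t x = x * w := by rw [hw]; field_simp
  have hw1 : v w = 1 := hunit t
  have hw0 : w ≠ 0 := v.ne_zero_iff.1 (by simp [hw1])
  set u := F x / x with hu
  have hFx : F x = x * u := by rw [hu]; field_simp
  have hu1 : v u = 1 := hunit F
  have hu0 : u ≠ 0 := v.ne_zero_iff.1 (by simp [hu1])
  have h1 : w * t u = u * F w := by
    apply mul_left_cancel₀ hx
    rw [hFx, htx, map_mul, map_mul, hFx, htx] at htF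
    linear_combination htF
  have h2 : v (F w - w) < 1 := by
    have : u * (F w - w) = w * (t u - u) := by linear_combination - h1
    have h3 := congrArg v this
    rw [map_mul, map_mul, hu1, hw1, one_mul, one_mul] at h3
    rw [h3]
    exact ht u hu1.le
  have h3 : v (w ^ (q - 1) - 1) < 1 := by
    have h4 : v (w ^ q - w) < 1 := v.sub_lt_trans
      (by rw [v.map_sub_swap]; exact hF.sub_lt w hw1.le) h2
    have : w ^ q - w = w * (w ^ (q - 1) - 1) := by
      rw [mul_sub, ← pow_succ', Nat.sub_add_cancel hq.le, mul_one]
    rwa [this, map_mul, hw1, one_mul] at h4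
  have h4 : ∀ n : ℕ, v ((t ^ n) x / x - w ^ n) < 1 := by
    intro n
    induction n with
    | zero => simp [hx]
    | succ n ih =>
      have : (t ^ (n + 1)) x / x - w ^ (n + 1) = w * (t ((t ^ n) x / x) - w ^ n) := by
        rw [pow_succ', AlgEquiv.mul_apply, map_div₀, htx]
        field_simp
        ring
      rw [this, map_mul, hw1, one_mul]
      exact v.sub_lt_trans (ht _ (hunit _).le) ih
  have h5 := v.sub_lt_trans (h4 (q - 1)) h3
  have : (t ^ (q - 1)) x - x = x * ((t ^ (q - 1)) x / x - 1) := by field_simp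
  rw [this, map_mul]
  exact mul_lt_of_lt_one_right (v.pos_iff.2 hx) h5

theorem pow_mem_of_coprime [IsGalois k C] {p m : ℕ} (hp : v (p : C) < 1) (hm : m.Coprime p)
    (hq : 1 < q) (N : Subgroup Gal(C/k)) (hNc : IsClosed (N : Set Gal(C/k)))
    (hN : commutator Gal(C/k) ≤ N) (hpow : ∀ g, g ^ m ∈ N) {t : Gal(C/k)}
    (ht : t ∈ valInertia v hv) : t ^ (q - 1) ∈ N := by
  have hcomm : ∀ {x : C}, (∀ n ∈ N, n x = x) → ∀ g h : Gal(C/k), g (h x) = h (g x) := by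
    intro x hx g h
    have h1 := hx _ (hN (Subgroup.commutator_mem_commutator (Subgroup.mem_top g⁻¹)
      (Subgroup.mem_top h⁻¹)))
    have h2 := congrArg (fun y ↦ h (g y)) h1
    simp only [commutatorElement_def, ← AlgEquiv.mul_apply] at h2
    simpa [mul_assoc] using h2
  have hfix : ∀ {x : C}, (∀ n ∈ N, n x = x) → ∀ g : Gal(C/k), ∀ n ∈ N, n (g x) = g x := by
    intro x hx g n hn
    rw [hcomm hx, hx n hn]
  let N' : ClosedSubgroup Gal(C/k) := ⟨N, hNc⟩
  have hN' := InfiniteGalois.fixingSubgroup_fixedField N'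
  change _ ∈ N'.1
  rw [← hN', IntermediateField.mem_fixingSubgroup_iff]
  intro x hx
  replace hx : ∀ n ∈ N, n x = x := fun n hn ↦ hx ⟨n, hn⟩
  refine Valuation.apply_eq_of_pow_apply_eq hv hp hm (hx _ (hpow _)) fun hne ↦ ?_
  refine hF.pow_apply_sub_lt hv hq ht (sub_ne_zero.2 hne) (hcomm (fun n hn ↦ ?_) _ _)
  rw [map_sub, hx n hn, hfix hx _ n hn]

end IsFrobeniusLift

/-- Elements fixed by the inertia subgroup have the same valuation as elements of the base. -/
theorem exists_valuation_eq_of_fixed [IsGalois k C] {y : C}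
    (hy : ∀ g ∈ valInertia v hv, g y = y) (hy0 : y ≠ 0) :
    ∃ a : k, v (algebraMap k C a) = v y := by
  let V : Subgroup Gal(C/k) := MulAction.stabilizer Gal(C/k) y
  have hV : ∀ {g}, g ∈ V ↔ g y = y := Iff.rfl
  have hVo : IsOpen (V : Set Gal(C/k)) := isOpen_setOf_algEquiv_apply (· = y) y
  have hVc : IsClosed (V : Set Gal(C/k)) := isClosed_setOf_algEquiv_apply (· = y) y
  have : Finite (Gal(C/k) ⧸ V) := V.quotient_finite_of_isOpen hVo
  have := Fintype.ofFinite (Gal(C/k) ⧸ V)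
  let κ := v.integer ⧸ IsLocalRing.maximalIdeal v.integer
  let O : Submonoid C :=
    { carrier := {u | v u ≤ 1 ∧ ∀ w ∈ V, w u = u}
      one_mem' := by simp
      mul_mem' := fun {a b} ha hb ↦ ⟨by rw [map_mul]; exact mul_le_one' ha.1 hb.1,
        fun w hw ↦ by rw [map_mul, ha.2 w hw, hb.2 w hw]⟩ }
  let ψ (d : Gal(C/k) ⧸ V) : O →* κ :=
    { toFun := fun u ↦ Ideal.Quotient.mk _ ⟨d.out u.1, by
        rw [Valuation.mem_integer_iff, hv]; exact u.2.1⟩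
      map_one' := by
        rw [← map_one (Ideal.Quotient.mk _)]; congr 1; ext; simp
      map_mul' := fun a b ↦ by
        rw [← map_mul (Ideal.Quotient.mk _)]; congr 1; ext; simp }
  have hψ : Function.Injective ψ := by
    intro d d' h
    rw [← d.out_eq', ← d'.out_eq']
    refine (QuotientGroup.eq.2 ?_).symm
    obtain ⟨w, hw, hwI⟩ := exists_mem_residue_eq v hv V hVc (d'.out⁻¹ * d.out) (fun x hx hxV ↦ by
      have h1 := (v.residue_eq_iff _ _).1 (DFunLike.congr_fun h ⟨x, hx, hxV⟩)
      rw [← hv d'.out⁻¹, map_sub, ← AlgEquiv.mul_apply, ← AlgEquiv.mul_apply, inv_mul_cancel,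
        AlgEquiv.one_apply] at h1
      exact h1)
    rw [← mul_inv_cancel_left w (d'.out⁻¹ * d.out)]
    exact V.mul_mem hw (hV.2 (hy _ hwI))
  let c (d : Gal(C/k) ⧸ V) : v.integer := ⟨d.out y / y, by
    rw [Valuation.mem_integer_iff, map_div₀, hv]; exact div_self_le_one _⟩
  have hli := (linearIndependent_monoidHom O κ).comp ψ hψ
  obtain ⟨u, hu⟩ : ∃ u : O, ∑ d, Ideal.Quotient.mk _ (c d) * ψ d u ≠ 0 := by
    by_contra! hcon
    have h1 := Fintype.linearIndependent_iff.1 hli (fun d ↦ Ideal.Quotient.mk _ (c d))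
      (by ext u; simpa using hcon u) (QuotientGroup.mk 1)
    rw [← map_zero (Ideal.Quotient.mk _), v.residue_eq_iff] at h1
    simp [c, hv, hy0] at h1
  set z := u.1 * y with hz
  have hzV : ∀ w ∈ V, w z = z := fun w hw ↦ by rw [hz, map_mul, u.2.2 w hw, hV.1 hw]
  have hcoset : ∀ a b : Gal(C/k), (a : Gal(C/k) ⧸ V) = b → a z = b z := by
    intro a b hab
    rw [← mul_inv_cancel_left a b, AlgEquiv.mul_apply, hzV _ (QuotientGroup.eq.1 hab)]
  obtain ⟨a, ha⟩ := (InfiniteGalois.mem_range_algebraMap_iff_fixed (k := k)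
    (∑ d : Gal(C/k) ⧸ V, d.out z)).2 fun h ↦ by
      rw [map_sum]
      refine Fintype.sum_equiv (MulAction.toPerm h) _ _ fun d ↦ ?_
      rw [← AlgEquiv.mul_apply]
      apply hcoset
      rw [MulAction.toPerm_apply, QuotientGroup.out_eq']
      conv_rhs => rw [← QuotientGroup.out_eq' d]
      rfl
  refine ⟨a, ?_⟩
  let s : v.integer := ∑ d : Gal(C/k) ⧸ V, c d * ⟨d.out u.1, by
    rw [Valuation.mem_integer_iff, hv]; exact u.2.1⟩
  have hs : v (s : C) = 1 := by
    refine le_antisymm s.2 (le_of_not_gt fun hlt ↦ hu ?_)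
    have h1 := (v.residue_eq_iff s 0).2 (by simpa using hlt)
    rw [map_zero, map_sum] at h1
    exact h1
  have hsy : algebraMap k C a = s * y := by
    rw [ha]
    simp only [s, c, hz, map_mul, AddSubmonoidClass.coe_finsetSum, Finset.sum_mul]
    refine Finset.sum_congr rfl fun d _ ↦ ?_
    simp only [MulMemClass.mk_mul_mk]
    field_simp
  rw [hsy, map_mul, hs, one_mul]

end Tame

section PadicUnits

variable {p : ℕ} [Fact p.Prime]

theorem PadicInt.eq_one_of_pow_eq_one {w : ℤ_[p]} (hw : toZModPow 2 w = 1) {m : ℕ} (hm : 0 < m)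
    (h : w ^ m = 1) : w = 1 := by
  induction m using Nat.strong_induction_on generalizing w with
  | _ m ih =>
    rcases eq_or_ne m 1 with rfl | hm1
    · simpa using h
    obtain ⟨l, hl, n, rfl⟩ := Nat.exists_prime_and_dvd hm1
    have hn : 0 < n := pos_of_mul_pos_right hm l.zero_le
    have h1 : w ^ l = 1 := ih n (lt_mul_of_one_lt_left hn hl.one_lt) (by simp [hw]) hn
      (by rw [← pow_mul, h])
    have h2 := geom_sum_mul w l
    rw [h1, sub_self, mul_eq_zero, sub_eq_zero] at h2
    refine h2.resolve_left fun h3 ↦ ?_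
    have h4 := congrArg (toZModPow 2) h3
    simp only [map_sum, map_pow, hw, one_pow, Finset.sum_const, Finset.card_range, nsmul_eq_mul,
      mul_one, map_zero, ZMod.natCast_eq_zero_iff] at h4
    have hp := (Fact.out : p.Prime)
    have h5 : p = l := (Nat.prime_dvd_prime_iff_eq hp hl).1 ((dvd_pow_self p two_ne_zero).trans h4)
    subst h5
    have := Nat.le_of_dvd hp.pos h4
    nlinarith [hp.two_le]

theorem PadicInt.units_pow_totient_eq_one {u : ℤ_[p]ˣ} {m : ℕ} (hm : 0 < m) (h : u ^ m = 1) :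
    u ^ (p ^ 2).totient = 1 := by
  ext1
  refine eq_one_of_pow_eq_one ?_ hm ?_
  · have h1 := congrArg Units.val
      (ZMod.pow_totient (Units.map (toZModPow (p := p) 2).toMonoidHom u))
    rw [Units.val_pow_eq_pow_val] at h1
    rw [Units.val_pow_eq_pow_val, map_pow]
    exact h1
  · rw [← Units.val_pow_eq_pow_val, pow_right_comm, h, one_pow, Units.val_one]

theorem PadicInt.units_eq_one_of_forall_exists_pow {u : ℤ_[p]ˣ}
    (h : ∀ n : ℕ, ∃ a : ℤ_[p]ˣ, u = (a ^ (p ^ 2).totient) ^ p ^ n) : u = 1 := by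
  ext1
  refine ext_of_toZModPow.1 fun n ↦ ?_
  obtain ⟨a, ha⟩ := h n
  have hdvd : (p ^ n).totient ∣ (p ^ 2).totient * p ^ n := by
    have hp := (Fact.out : p.Prime)
    rcases n with _ | n
    · simp
    · rw [Nat.totient_prime_pow_succ hp, Nat.totient_prime_pow_succ hp, pow_succ]
      exact ⟨p ^ 1 * p, by ring⟩
  obtain ⟨c, hc⟩ := hdvd
  have h1 := congrArg Units.val (ZMod.pow_totient (Units.map (toZModPow (p := p) n).toMonoidHom a))
  rw [Units.val_pow_eq_pow_val] at h1
  have h2 : toZModPow n (a : ℤ_[p]) ^ (p ^ n).totient = 1 := h1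
  rw [ha, ← pow_mul, hc, pow_mul, Units.val_pow_eq_pow_val, Units.val_pow_eq_pow_val, map_pow,
    map_pow, h2, one_pow, Units.val_one, map_one]

end PadicUnits

section CycloVal

variable {C : Type*} [Field C] {v : Valuation C ℝ≥0} {p : ℕ} [Fact p.Prime]

theorem Valuation.one_sub_pow_le {x : C} (hx : v x = 1) (a : ℕ) : v (1 - x ^ a) ≤ v (1 - x) := by
  rw [← mul_neg_geom_sum x a, map_mul]
  refine mul_le_of_le_one_right zero_le (v.map_sum_le fun i _ ↦ ?_)
  rw [map_pow, hx, one_pow]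

theorem IsPrimitiveRoot.valuation_one_sub_eq {n : ℕ} (hn : n ≠ 0) {x y : C}
    (hx : IsPrimitiveRoot x n) (hy : IsPrimitiveRoot y n) : v (1 - x) = v (1 - y) := by
  have : NeZero n := ⟨hn⟩
  obtain ⟨a, -, rfl⟩ := hx.eq_pow_of_pow_eq_one hy.pow_eq_one
  obtain ⟨b, -, hb⟩ := hy.eq_pow_of_pow_eq_one hx.pow_eq_one
  refine le_antisymm ?_ (v.one_sub_pow_le (v.eq_one_of_pow_eq_one hn hx.pow_eq_one) a)
  nth_rw 1 [← hb]
  exact v.one_sub_pow_le (v.eq_one_of_pow_eq_one hn hy.pow_eq_one) b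

theorem IsPrimitiveRoot.valuation_one_sub_pow_totient {n : ℕ} {x : C}
    (hx : IsPrimitiveRoot x (p ^ (n + 1))) : v (1 - x) ^ (p ^ (n + 1)).totient = v (p : C) := by
  have h1 := Polynomial.eval_one_cyclotomic_prime_pow (R := C) (p := p) n
  rw [Polynomial.cyclotomic_eq_prod_X_sub_primitiveRoots hx, Polynomial.eval_prod] at h1
  simp only [Polynomial.eval_sub, Polynomial.eval_X, Polynomial.eval_C] at h1
  have hpos : p ^ (n + 1) ≠ 0 := pow_ne_zero _ (Fact.out : p.Prime).ne_zero
  rw [← h1, map_prod, ← hx.card_primitiveRoots, eq_comm]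
  exact Finset.prod_eq_pow_card fun y hy ↦
    ((mem_primitiveRoots hpos.bot_lt).1 hy).valuation_one_sub_eq hpos hx

end CycloVal

section GalCyclo

variable {k C : Type*} [Field k] [Field C] [Algebra k C] (p : ℕ) [Fact p.Prime]

variable (k C) in
/-- The `p`-adic cyclotomic character of a Galois group. -/
def galCyclotomicCharacter : Gal(C/k) →* ℤ_[p]ˣ :=
  (cyclotomicCharacter C p).comp (MulSemiringAction.toRingAut Gal(C/k) C)

theorem galCyclotomicCharacter_spec [∀ i, HasEnoughRootsOfUnity C (p ^ i)] {n : ℕ} (g : Gal(C/k))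
    {x : C} (hx : x ^ p ^ n = 1) :
    g x = x ^ (PadicInt.toZModPow n (galCyclotomicCharacter k C p g : ℤ_[p])).val :=
  cyclotomicCharacter.spec p (MulSemiringAction.toRingAut Gal(C/k) C g) x hx

theorem exists_mem_valInertia_pow_ne_one [IsGalois k C] [IsAlgClosed C] [CharZero C]
    {v : Valuation C ℝ≥0} (hv : ∀ (g : Gal(C/k)) (x : C), v (g x) = v x)
    (hp : v (p : C) < 1)
    (hdisc : ∃ c < 1, ∀ x : k, v (algebraMap k C x) < 1 → v (algebraMap k C x) ≤ c)
    (M : ℕ) [NeZero M] : ∃ t ∈ valInertia v hv, galCyclotomicCharacter k C p t ^ M ≠ 1 := by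
  by_contra! hcon
  have hp' := (Fact.out : p.Prime)
  have : ∀ i, HasEnoughRootsOfUnity C (p ^ i) := fun i ↦ by
    have : NeZero (p ^ i) := ⟨pow_ne_zero _ hp'.ne_zero⟩
    infer_instance
  obtain ⟨c, hc1, hc⟩ := hdisc
  have := Fintype.ofFinite (rootsOfUnity M ℤ_[p])
  set s := Fintype.card (rootsOfUnity M ℤ_[p]) with hs
  have hs0 : s ≠ 0 := Fintype.card_ne_zero
  have hvp0 : v (p : C) ≠ 0 := v.ne_zero_iff.2 (Nat.cast_ne_zero.2 hp'.ne_zero)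
  have key : ∀ n, v (p : C) ^ s ≤ c ^ n := by
    intro n
    obtain ⟨x, hx⟩ := HasEnoughRootsOfUnity.exists_primitiveRoot C (p ^ (n + 1))
    have hpn : p ^ (n + 1) ≠ 0 := pow_ne_zero _ hp'.ne_zero
    have : NeZero (p ^ (n + 1)) := ⟨hpn⟩
    have hφ := hx.valuation_one_sub_pow_totient (v := v)
    have hφ0 : (p ^ (n + 1)).totient ≠ 0 := (Nat.totient_pos.2 hpn.bot_lt).ne'
    have hlt : v (1 - x) < 1 := by
      rw [← pow_lt_one_iff_of_nonneg zero_le hφ0, hφ]; exact hp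
    let e (u : ℤ_[p]ˣ) : ℕ := (PadicInt.toZModPow (n + 1) (u : ℤ_[p])).val
    have hxe : ∀ a b : ℤ_[p]ˣ, (x ^ e a) ^ e b = x ^ e (a * b) := by
      intro a b
      rw [← pow_mul]
      refine pow_eq_pow_of_modEq ?_ hx.pow_eq_one
      rw [← ZMod.natCast_eq_natCast_iff]
      simp [e]
    have hval : ∀ u : ℤ_[p]ˣ, v (1 - x ^ e u) = v (1 - x) := by
      intro u
      refine le_antisymm (v.one_sub_pow_le (v.eq_one_of_pow_eq_one hpn hx.pow_eq_one) _) ?_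
      have h1 : x = (x ^ e u) ^ e u⁻¹ := by
        rw [hxe, mul_inv_cancel]
        have h2 : e 1 % p ^ (n + 1) = 1 % p ^ (n + 1) := by simp [e, ZMod.val_one_eq_one_mod]
        exact ((pow_eq_pow_of_modEq h2 hx.pow_eq_one).trans (pow_one x)).symm
      nth_rw 1 [h1]
      refine v.one_sub_pow_le (v.eq_one_of_pow_eq_one hpn ?_) _
      rw [pow_right_comm, hx.pow_eq_one, one_pow]
    set y := ∏ u : rootsOfUnity M ℤ_[p], (1 - x ^ e u) with hy
    have hvy : v y = v (1 - x) ^ s := by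
      simp_rw [hy, map_prod, hval, Finset.prod_const, Finset.card_univ, hs]
    have hyI : ∀ g ∈ valInertia v hv, g y = y := by
      intro g hg
      rw [hy, map_prod]
      let χ : rootsOfUnity M ℤ_[p] := ⟨galCyclotomicCharacter k C p g, hcon g hg⟩
      refine Fintype.prod_equiv (Equiv.mulLeft χ) _ _ fun u ↦ ?_
      rw [map_sub, map_one, map_pow, galCyclotomicCharacter_spec p g hx.pow_eq_one]
      exact congrArg _ (hxe χ u)
    have hy0 : y ≠ 0 := by
      rw [← v.ne_zero_iff, hvy]
      refine pow_ne_zero _ fun h0 ↦ hvp0 ?_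
      rw [← hφ, h0, zero_pow hφ0]
    obtain ⟨a, ha⟩ := exists_valuation_eq_of_fixed hv hyI hy0
    have h1 := hc a (by rw [ha, hvy]; exact pow_lt_one₀ zero_le hlt hs0)
    rw [ha, hvy] at h1
    have h2 : v (p : C) ^ s ≤ c ^ (p ^ (n + 1)).totient := by
      rw [← hφ, pow_right_comm]
      exact pow_le_pow_left₀ zero_le h1 _
    refine h2.trans (pow_le_pow_of_le_one zero_le hc1.le ?_)
    rw [Nat.totient_prime_pow_succ hp']
    refine (Nat.lt_pow_self hp'.one_lt).le.trans (Nat.le_mul_of_pos_right _ ?_)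
    have := hp'.two_le
    omega
  obtain ⟨n, hn⟩ := exists_pow_lt_of_lt_one (pow_pos hvp0.bot_lt s) hc1
  exact (key n).not_gt hn

end GalCyclo

section AbModTorsion

variable (G : Type*) [Group G] [TopologicalSpace G] [IsTopologicalGroup G]

/-- The topological abelianization modulo the closure of its torsion subgroup. -/
abbrev AbModTorsion :=
  TopologicalAbelianization G ⧸ (CommGroup.torsion (TopologicalAbelianization G)).topologicalClosure

/-- The projection from a topological group to its topological abelianization. -/
def toTopologicalAbelianization : G →* TopologicalAbelianization G := QuotientGroup.mk' _

/-- The projection from a topological group to its abelianization modulo torsion. -/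
def toAbModTorsion : G →* AbModTorsion G :=
  (QuotientGroup.mk' _).comp (toTopologicalAbelianization G)

variable {G}

theorem toTopologicalAbelianization_surjective :
    Function.Surjective (toTopologicalAbelianization G) := QuotientGroup.mk_surjective

theorem toAbModTorsion_surjective : Function.Surjective (toAbModTorsion G) :=
  QuotientGroup.mk_surjective.comp toTopologicalAbelianization_surjective

theorem continuous_toTopologicalAbelianization : Continuous (toTopologicalAbelianization G) :=
  continuous_quotient_mk'

theorem continuous_toAbModTorsion : Continuous (toAbModTorsion G) :=
  Continuous.comp (g := QuotientGroup.mk) continuous_quotient_mk'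
    continuous_toTopologicalAbelianization

omit [TopologicalSpace G] [IsTopologicalGroup G] in
theorem commutator_le_ker {A : Type*} [CommGroup A] (f : G →* A) : commutator G ≤ f.ker := by
  rw [commutator_def, Subgroup.commutator_le]
  intro g _ h _
  rw [MonoidHom.mem_ker, map_commutatorElement, commutatorElement_eq_one_iff_mul_comm, mul_comm]

theorem toAbModTorsion_eq_of_pow_eq {g h : G} {n : ℕ} (hn : 0 < n)
    (hgh : toTopologicalAbelianization G g ^ n = toTopologicalAbelianization G h ^ n) :
    toAbModTorsion G g = toAbModTorsion G h := by
  refine QuotientGroup.eq.2 (Subgroup.le_topologicalClosure _ ?_)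
  refine isOfFinOrder_iff_pow_eq_one.2 ⟨n, hn, ?_⟩
  rw [mul_pow, inv_pow, hgh, inv_mul_cancel]

/-- A closed subgroup containing the commutators and closed under extraction of roots contains the
kernel of the projection to the abelianization modulo torsion. -/
theorem mem_of_toAbModTorsion_eq {N : Subgroup G} (hN : IsClosed (N : Set G))
    (hcomm : commutator G ≤ N) (hroot : ∀ (g : G) (n : ℕ), 0 < n → g ^ n ∈ N → g ∈ N) {g h : G}
    (hgh : toAbModTorsion G g = toAbModTorsion G h) (hg : g ∈ N) : h ∈ N := by
  have hker : (toTopologicalAbelianization G).ker ≤ N := by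
    rw [toTopologicalAbelianization, QuotientGroup.ker_mk']
    exact Subgroup.topologicalClosure_minimal _ hcomm hN
  have hcomap := Subgroup.comap_map_eq_self hker
  set N' := N.map (toTopologicalAbelianization G) with hN'
  have hmem : ∀ x, toTopologicalAbelianization G x ∈ N' ↔ x ∈ N := fun x ↦ by
    rw [← Subgroup.mem_comap, hcomap]
  have hN'c : IsClosed (N' : Set (TopologicalAbelianization G)) := by
    refine (isQuotientMap_quotient_mk' : Topology.IsQuotientMap
      (toTopologicalAbelianization G)).isClosed_preimage.1 ?_
    change IsClosed (N'.comap (toTopologicalAbelianization G) : Set G)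
    rwa [hcomap]
  have hle : (CommGroup.torsion (TopologicalAbelianization G)).topologicalClosure ≤ N' := by
    refine Subgroup.topologicalClosure_minimal _ (fun a ha ↦ ?_) hN'c
    obtain ⟨x, rfl⟩ := toTopologicalAbelianization_surjective a
    obtain ⟨n, hn, hx⟩ := isOfFinOrder_iff_pow_eq_one.1 ha
    rw [hmem]
    refine hroot x n hn (hker ?_)
    rwa [MonoidHom.mem_ker, map_pow]
  have h1 := hle (QuotientGroup.eq.1 hgh)
  rw [← map_inv, ← map_mul, hmem] at h1
  exact (N.mul_mem_cancel_left (N.inv_mem hg)).1 h1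

theorem exists_toAbModTorsion_eq_mul_pow {ℓ : ℕ} (hℓ : 0 < ℓ)
    (hcyc : IsCyclic (AbModTorsion G ⧸ (powMonoidHom ℓ : AbModTorsion G →* AbModTorsion G).range)) :
    ∃ b : G, ∀ (n : ℕ) (g : G), ∃ (i : ℕ) (c : G),
      toAbModTorsion G g = toAbModTorsion G b ^ i * toAbModTorsion G c ^ ℓ ^ n := by
  obtain ⟨b', hb'⟩ := hcyc.exists_generator
  obtain ⟨b₁, rfl⟩ := QuotientGroup.mk_surjective b'
  obtain ⟨b, rfl⟩ := toAbModTorsion_surjective b₁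
  have hfin : IsOfFinOrder (QuotientGroup.mk (toAbModTorsion G b) :
      AbModTorsion G ⧸ (powMonoidHom ℓ : AbModTorsion G →* AbModTorsion G).range) :=
    isOfFinOrder_iff_pow_eq_one.2 ⟨ℓ, hℓ, (QuotientGroup.eq_one_iff _).2 ⟨_, rfl⟩⟩
  refine ⟨b, fun n ↦ ?_⟩
  induction n with
  | zero => exact fun g ↦ ⟨0, g, by simp⟩
  | succ n ih =>
    intro g
    obtain ⟨i, c, hc⟩ := ih g
    obtain ⟨j, hj⟩ := hfin.mem_powers_iff_mem_zpowers.2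
      (hb' (QuotientGroup.mk (toAbModTorsion G c)))
    obtain ⟨d', hd'⟩ := QuotientGroup.eq.1 hj
    obtain ⟨d, rfl⟩ := toAbModTorsion_surjective d'
    refine ⟨i + j * ℓ ^ n, d, ?_⟩
    have h1 : toAbModTorsion G c = toAbModTorsion G b ^ j * toAbModTorsion G d ^ ℓ := by
      rw [← mul_inv_cancel_left (toAbModTorsion G b ^ j) (toAbModTorsion G c)]
      exact congrArg _ hd'.symm
    rw [hc, h1, mul_pow, ← pow_mul, ← pow_mul, pow_add, pow_succ', mul_assoc]

end AbModTorsion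

section Main

variable {k C : Type*} [Field k] [Field C] [Algebra k C] [IsGalois k C] [IsAlgClosed C] [CharZero C]
  {v : Valuation C ℝ≥0}
  (hv : ∀ (g : Gal(C/k)) (x : C), v (g x) = v x) {p : ℕ} [Fact p.Prime] (hp : v (p : C) < 1)
  {q : ℕ} (hpq : p ∣ q) (hq : 1 < q) {F : Gal(C/k)} (hF : IsFrobeniusLift v q F)
include hv hp hpq hq hF

omit hpq [CharZero C] [IsAlgClosed C] in
theorem isCyclic_abModTorsion_quotient_of_ne {ℓ : ℕ} (hℓ : ℓ.Prime) (hne : ℓ ≠ p) :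
    IsCyclic (AbModTorsion Gal(C/k) ⧸
      (powMonoidHom ℓ : AbModTorsion Gal(C/k) →* AbModTorsion Gal(C/k)).range) := by
  set α := toTopologicalAbelianization Gal(C/k) with hα
  set β := toAbModTorsion Gal(C/k) with hβ
  have : IsClosed ((commutator Gal(C/k)).topologicalClosure : Set Gal(C/k)) :=
    Subgroup.isClosed_topologicalClosure _
  have : IsClosed ((CommGroup.torsion (TopologicalAbelianization Gal(C/k))).topologicalClosure :
    Set (TopologicalAbelianization Gal(C/k))) := Subgroup.isClosed_topologicalClosure _
  obtain ⟨a, m, hm, hqm⟩ := Nat.exists_eq_pow_mul_and_not_dvd (n := q - 1) (by omega) ℓ hℓ.ne_one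
  have hB : (valInertia v hv) ≤
      (powMonoidHom ℓ : AbModTorsion Gal(C/k) →* AbModTorsion Gal(C/k)).range.comap β := by
    intro t ht
    have hclosed : IsClosed ((powMonoidHom (ℓ ^ (a + 1)) :
        TopologicalAbelianization Gal(C/k) →* TopologicalAbelianization Gal(C/k)).range :
        Set (TopologicalAbelianization Gal(C/k))) := by
      rw [MonoidHom.coe_range]
      exact (isCompact_range (continuous_pow _)).isClosed
    obtain ⟨w', hw⟩ := hF.pow_mem_of_coprime hv hp (m := ℓ ^ (a + 1))
      (Nat.Coprime.pow_left _ ((Nat.coprime_primes hℓ Fact.out).2 hne)) hq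
      ((powMonoidHom (ℓ ^ (a + 1)) :
        TopologicalAbelianization Gal(C/k) →* TopologicalAbelianization Gal(C/k)).range.comap α)
      (hclosed.preimage continuous_toTopologicalAbelianization)
      ((commutator_le_ker α).trans (MonoidHom.ker_le_comap _ _))
      (fun g ↦ ⟨α g, by simp⟩) ht
    obtain ⟨w, rfl⟩ := toTopologicalAbelianization_surjective w'
    have h1 : β (t ^ m) = β (w ^ ℓ) := by
      refine toAbModTorsion_eq_of_pow_eq (pow_pos hℓ.pos a) ?_
      rw [← map_pow, ← map_pow, ← pow_mul, ← pow_mul, mul_comm m, ← hqm, ← pow_succ', map_pow _ w]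
      exact hw.symm
    rw [map_pow, map_pow] at h1
    have hcop : IsCoprime (m : ℤ) ℓ :=
      Nat.isCoprime_iff_coprime.2 ((Nat.Prime.coprime_iff_not_dvd hℓ).2 hm).symm
    obtain ⟨x, y, hxy⟩ := hcop
    have h2 : β t = (β t ^ m) ^ x * (β t ^ ℓ) ^ y := by
      rw [← zpow_natCast, ← zpow_natCast, ← zpow_mul, ← zpow_mul, ← zpow_add, mul_comm,
        mul_comm _ y,
        hxy, zpow_one]
    rw [Subgroup.mem_comap, h2, h1]
    have hmem : ∀ x : AbModTorsion Gal(C/k), x ^ ℓ ∈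
        (powMonoidHom ℓ : AbModTorsion Gal(C/k) →* AbModTorsion Gal(C/k)).range := fun x ↦ ⟨x, rfl⟩
    exact Subgroup.mul_mem _ (Subgroup.zpow_mem _ (hmem _) _) (Subgroup.zpow_mem _ (hmem _) _)
  have hclosed : IsClosed ((powMonoidHom ℓ : AbModTorsion Gal(C/k) →* AbModTorsion Gal(C/k)).range :
      Set (AbModTorsion Gal(C/k))) := by
    rw [MonoidHom.coe_range]
    exact (isCompact_range (continuous_pow _)).isClosed
  let γ := (QuotientGroup.mk'
    (powMonoidHom ℓ : AbModTorsion Gal(C/k) →* AbModTorsion Gal(C/k)).range).comp β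
  have hγ : Function.Surjective γ := QuotientGroup.mk_surjective.comp toAbModTorsion_surjective
  have hγc : Continuous γ := continuous_quotient_mk'.comp continuous_toAbModTorsion
  have hfin : (Subgroup.zpowers (γ F) : Set (AbModTorsion Gal(C/k) ⧸
      (powMonoidHom ℓ : AbModTorsion Gal(C/k) →* AbModTorsion Gal(C/k)).range)).Finite :=
    finite_zpowers.2 (isOfFinOrder_iff_pow_eq_one.2
      ⟨ℓ, hℓ.pos, (QuotientGroup.eq_one_iff _).2 ⟨β F, rfl⟩⟩)
  have htop := hF.eq_top_of_isClosed hv ((Subgroup.zpowers (γ F)).comap γ)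
    (hfin.isClosed.preimage hγc) (Subgroup.mem_zpowers _) (fun t ht ↦ by
      have : γ t = 1 := (QuotientGroup.eq_one_iff _).2 (hB ht)
      rw [Subgroup.mem_comap, this]
      exact Subgroup.one_mem _)
  refine ⟨γ F, fun x ↦ ?_⟩
  obtain ⟨g, rfl⟩ := hγ x
  have : g ∈ (Subgroup.zpowers (γ F)).comap γ := htop ▸ Subgroup.mem_top g
  exact this

theorem not_isCyclic_abModTorsion_quotient
    (hdisc : ∃ c < 1, ∀ x : k, v (algebraMap k C x) < 1 → v (algebraMap k C x) ≤ c) :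
    ¬ IsCyclic (AbModTorsion Gal(C/k) ⧸
      (powMonoidHom p : AbModTorsion Gal(C/k) →* AbModTorsion Gal(C/k)).range) := by
  intro hcyc
  have hp' := (Fact.out : p.Prime)
  obtain ⟨b, hb⟩ := exists_toAbModTorsion_eq_mul_pow hp'.pos hcyc
  set M := (p ^ 2).totient with hM
  have hM0 : 0 < M := Nat.totient_pos.2 (pow_pos hp'.pos 2)
  have : NeZero M := ⟨hM0.ne'⟩
  obtain ⟨t, ht, hχ⟩ := exists_mem_valInertia_pow_ne_one p hv hp hdisc M
  refine hχ (PadicInt.units_eq_one_of_forall_exists_pow fun n ↦ ?_)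
  have hpn : 0 < p ^ n := pow_pos hp'.pos n
  obtain ⟨i, c, hc⟩ := hb n t
  obtain ⟨j, d, hd⟩ := hb n F
  have hI := mem_of_toAbModTorsion_eq (isClosed_valInertia v hv) (hF.commutator_le hv)
    (fun g n hn ↦ hF.mem_valInertia_of_pow_mem hv hp hpq hq hn)
    (g := t ^ j) (h := ((d ^ i * (c ^ j)⁻¹) ^ p ^ n)⁻¹ * F ^ i) (by
      simp only [map_mul, map_pow, map_inv, hc, hd, mul_pow, mul_inv, inv_pow, inv_inv]
      simp only [← pow_mul]
      rw [mul_comm (_ ^ _)⁻¹ (_ ^ _), mul_assoc, mul_comm i j, mul_comm i (p ^ n)]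
      rw [mul_comm (p ^ n) j, mul_comm (toAbModTorsion _ b ^ _) (toAbModTorsion _ d ^ _),
        inv_mul_cancel_left, mul_comm])
    ((valInertia v hv).pow_mem ht j)
  obtain ⟨i, rfl⟩ := hF.dvd_of_inv_pow_mul_mem hv hp hpq hq hpn hI
  refine ⟨galCyclotomicCharacter k C p (b ^ i * c), ?_⟩
  let χ := galCyclotomicCharacter k C p
  let J : Subgroup Gal(C/k) := ((powMonoidHom M).comp χ).ker
  have hJ : t⁻¹ * (b ^ i * c) ^ p ^ n ∈ J := by
    refine mem_of_toAbModTorsion_eq (N := J) (g := 1) ?_ (commutator_le_ker _) (fun g n hn hg ↦ ?_)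
      ?_ J.one_mem
    · refine isClosed_singleton.preimage (f := ((powMonoidHom M).comp χ)) ?_
      exact (cyclotomicCharacter.continuous p k C).pow M
    · have h1 : (χ (g ^ n)) ^ M = 1 := hg
      rw [map_pow, ← pow_mul] at h1
      exact PadicInt.units_pow_totient_eq_one (Nat.mul_pos hn hM0) h1
    · rw [map_one, map_mul, map_inv, hc, map_pow, map_mul, map_pow, mul_pow, ← pow_mul, mul_comm i,
        inv_mul_cancel]
  have h1 : χ (t⁻¹ * (b ^ i * c) ^ p ^ n) ^ M = 1 := hJ
  rw [map_mul, map_inv, map_pow, mul_pow, inv_pow, inv_mul_eq_one] at h1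
  rw [pow_right_comm]
  exact h1

end Main

section ProperUltrametric

variable (k : Type*) [NormedField k] [ProperSpace k]

theorem exists_finite_norm_sub_lt_one :
    ∃ T : Set k, T.Finite ∧ ∀ x : k, ‖x‖ ≤ 1 → ∃ t ∈ T, ‖x - t‖ < 1 := by
  obtain ⟨T, -, hT, hcover⟩ := (isCompact_closedBall (0 : k) 1).finite_cover_balls one_pos
  refine ⟨T, hT, fun x hx ↦ ?_⟩
  simpa [dist_eq_norm] using hcover (mem_closedBall_zero_iff.2 hx)

theorem exists_lt_one_forall_norm_le [IsUltrametricDist k] :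
    ∃ c : ℝ≥0, c < 1 ∧ ∀ x : k, ‖x‖ < 1 → ‖x‖₊ ≤ c := by
  have hcpt : IsCompact (Metric.ball (0 : k) 1) :=
    (isCompact_closedBall (0 : k) 1).of_isClosed_subset (IsUltrametricDist.isClosed_ball 0 1)
      Metric.ball_subset_closedBall
  obtain ⟨x, hx, hmax⟩ := hcpt.exists_isMaxOn ⟨0, Metric.mem_ball_self one_pos⟩
    continuous_nnnorm.continuousOn
  exact ⟨‖x‖₊, mem_ball_zero_iff.1 hx, fun y hy ↦ hmax (mem_ball_zero_iff.2 hy)⟩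

end ProperUltrametric

section SpectralValuation

variable (p : ℕ) [Fact p.Prime] (L : Type*) [Field L] [Algebra ℚ_[p] L]

/-- The valuation on an algebraic extension of `ℚ_[p]` that extends the `p`-adic one. -/
def spectralValuation [Algebra.IsAlgebraic ℚ_[p] L] : Valuation L ℝ≥0 where
  toFun x := ⟨spectralNorm ℚ_[p] L x, spectralNorm_nonneg x⟩
  map_zero' := NNReal.eq spectralNorm_zero
  map_one' := NNReal.eq spectralNorm_one
  map_mul' x y := NNReal.eq (spectralAlgNorm_mul x y)
  map_add_le_max' x y := isNonarchimedean_spectralNorm x y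

theorem spectralValuation_natCast_lt_one [Algebra.IsAlgebraic ℚ_[p] L] :
    spectralValuation p L p < 1 := by
  have h1 : spectralNorm ℚ_[p] L (algebraMap ℚ_[p] L p) < 1 := by
    rw [spectralNorm_extends]; exact Padic.norm_p_lt_one
  rw [map_natCast] at h1
  exact h1

theorem spectralValuation_algEquiv_apply [Algebra.IsAlgebraic ℚ_[p] L] {k : Type*} [Field k]
    [Algebra ℚ_[p] k] [Algebra k L] [IsScalarTower ℚ_[p] k L] (g : Gal(L/k)) (x : L) :
    spectralValuation p L (g x) = spectralValuation p L x :=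
  NNReal.eq (spectralNorm_eq_of_equiv (g.restrictScalars ℚ_[p]) x).symm

variable [Algebra.IsAlgebraic ℚ_[p] L] (k : Type*) [Field k] [Algebra ℚ_[p] k]
  [FiniteDimensional ℚ_[p] k] [Algebra k L] [IsScalarTower ℚ_[p] k L]

theorem exists_finite_spectralValuation_sub_lt_one :
    ∃ T : Set k, T.Finite ∧ ∀ x : k, spectralValuation p L (algebraMap k L x) ≤ 1 →
      ∃ t ∈ T, spectralValuation p L (algebraMap k L (x - t)) < 1 := by
  let := spectralNorm.normedField ℚ_[p] k
  let := spectralNorm.normedSpace ℚ_[p] k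
  have : ProperSpace k := FiniteDimensional.proper ℚ_[p] k
  have hnorm : ∀ x : k, (spectralValuation p L (algebraMap k L x) : ℝ) = ‖x‖ :=
    fun x ↦ (spectralNorm.eq_of_tower (K := ℚ_[p]) x).symm
  simp only [← NNReal.coe_le_coe, ← NNReal.coe_lt_coe, hnorm, NNReal.coe_one]
  exact exists_finite_norm_sub_lt_one k

theorem exists_lt_one_forall_spectralValuation_le :
    ∃ c < 1, ∀ x : k, spectralValuation p L (algebraMap k L x) < 1 →
      spectralValuation p L (algebraMap k L x) ≤ c := by
  let := spectralNorm.normedField ℚ_[p] k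
  let := spectralNorm.normedSpace ℚ_[p] k
  have : ProperSpace k := FiniteDimensional.proper ℚ_[p] k
  have : IsUltrametricDist k :=
    IsUltrametricDist.isUltrametricDist_of_isNonarchimedean_norm isNonarchimedean_spectralNorm
  have hnorm : ∀ x : k, spectralValuation p L (algebraMap k L x) = ‖x‖₊ :=
    fun x ↦ NNReal.eq (spectralNorm.eq_of_tower (K := ℚ_[p]) x).symm
  simp only [hnorm]
  exact exists_lt_one_forall_norm_le k

end SpectralValuation

end Helpers

/-- Let `K` be a finite extension of `ℚ_p`, and let `B = G_K^{ab/tor}` be the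
abelianization of its absolute Galois group modulo torsion.  Then `p` is the unique
prime `ℓ` such that the `ℤ/ℓ`-dimension of `B/ℓB` is at least `2`; since `B/ℓB` is an
elementary abelian `ℓ`-group, having dimension at least `2` is equivalent to `B/ℓB`
not being cyclic. -/
theorem residue_char_unique_prime_with_large_mod_ell_quotient (ℓ : ℕ) (hℓ : ℓ.Prime) :
    (¬ IsCyclic (AbTor K ⧸ (powMonoidHom ℓ : AbTor K →* AbTor K).range)) ↔ ℓ = p := by
  have : CharZero K := charZero_of_injective_algebraMap (algebraMap ℚ_[p] K).injective
  have : CharZero (AlgebraicClosure K) :=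
    charZero_of_injective_algebraMap (algebraMap K (AlgebraicClosure K)).injective
  have : IsGalois K (AlgebraicClosure K) := ⟨⟩
  have : Algebra.IsAlgebraic ℚ_[p] (AlgebraicClosure K) := Algebra.IsAlgebraic.trans ℚ_[p] K _
  have hv := spectralValuation_algEquiv_apply p (AlgebraicClosure K) (k := K)
  have hp := spectralValuation_natCast_lt_one p (AlgebraicClosure K)
  obtain ⟨f, hf, hpow, F, hF⟩ := exists_frobenius _ hv p hp
    (exists_finite_spectralValuation_sub_lt_one p (AlgebraicClosure K) K)
  have hlift : IsFrobeniusLift _ (p ^ f) F := ⟨hF, hpow⟩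
  have hq : 1 < p ^ f := Nat.one_lt_pow hf.ne' (Fact.out : p.Prime).one_lt
  constructor
  · contrapose!
    exact isCyclic_abModTorsion_quotient_of_ne hv hp hq hlift hℓ
  · rintro rfl
    exact not_isCyclic_abModTorsion_quotient hv hp (dvd_pow_self ℓ hf.ne') hq hlift
      (exists_lt_one_forall_spectralValuation_le ℓ (AlgebraicClosure K) K)

end
end

section
/- Let K be a finite extension of ℚ_p with residue field of cardinality q = p^f. Then the prime-to-p part of the torsion subgroup of G_K^{ab} is cyclic of order q − 1; consequently the inertia degree f can be recovered as f = log_p(1 + |(G_K^{ab})_tor^{(p')}|). -/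
noncomputable section

variable (p : ℕ) [Fact p.Prime] (K : Type*) [Field K]
  [Algebra ℚ_[p] K] [FiniteDimensional ℚ_[p] K]

/-- `G_K^{ab}`: the topological abelianization of the absolute Galois group of `K`. -/
abbrev GabK := TopologicalAbelianization (AbsGal K)

section Tame

/-- A Galois-invariant nonarchimedean absolute value on `Ω` whose residue field is algebraic over
the prime field of characteristic `p`. -/
structure InvariantAbs (p : ℕ) (K Ω : Type*) [Field K] [Field Ω] [Algebra K Ω] where
  /-- The underlying absolute value. -/
  v : AbsoluteValue Ω ℝ
  nonarch : IsNonarchimedean v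
  map_eq : ∀ (σ : Ω ≃ₐ[K] Ω) (x : Ω), v (σ x) = v x
  natCast_lt_one : v (p : Ω) < 1
  exists_pow_sub_one_lt : ∀ y : Ω, v y = 1 → ∃ n : ℕ, 0 < n ∧ v (y ^ n - 1) < 1

namespace InvariantAbs

variable {p : ℕ} {K Ω : Type*} [Field K] [Field Ω] [Algebra K Ω]
  (S : InvariantAbs p K Ω)

lemma add_lt {x y : Ω} {r : ℝ} (hx : S.v x < r) (hy : S.v y < r) : S.v (x + y) < r :=
  (S.nonarch x y).trans_lt (max_lt hx hy)

lemma add_le {x y : Ω} {r : ℝ} (hx : S.v x ≤ r) (hy : S.v y ≤ r) : S.v (x + y) ≤ r :=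
  (S.nonarch x y).trans (max_le hx hy)

lemma sub_lt {x y : Ω} {r : ℝ} (hx : S.v x < r) (hy : S.v y < r) : S.v (x - y) < r := by
  rw [sub_eq_add_neg]
  exact S.add_lt hx (by rwa [S.v.map_neg])

lemma sub_lt_trans {x y z : Ω} {r : ℝ} (hx : S.v (x - y) < r) (hy : S.v (y - z) < r) :
    S.v (x - z) < r := by
  rw [← sub_add_sub_cancel x y z]
  exact S.add_lt hx hy

lemma sum_lt {ι : Type*} (s : Finset ι) (f : ι → Ω) {r : ℝ} (hr : 0 < r)
    (h : ∀ i ∈ s, S.v (f i) < r) : S.v (∑ i ∈ s, f i) < r := by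
  classical
  induction s using Finset.induction_on with
  | empty => simpa using hr
  | insert a s ha ih =>
    rw [Finset.sum_insert ha]
    exact S.add_lt (h _ (Finset.mem_insert_self _ _))
      (ih fun i hi => h i (Finset.mem_insert_of_mem hi))

lemma sum_le {ι : Type*} (s : Finset ι) (f : ι → Ω) {r : ℝ} (hr : 0 ≤ r)
    (h : ∀ i ∈ s, S.v (f i) ≤ r) : S.v (∑ i ∈ s, f i) ≤ r := by
  classical
  induction s using Finset.induction_on with
  | empty => simpa using hr
  | insert a s ha ih =>
    rw [Finset.sum_insert ha]
    exact S.add_le (h _ (Finset.mem_insert_self _ _))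
      (ih fun i hi => h i (Finset.mem_insert_of_mem hi))

lemma eq_of_sub_lt {x y : Ω} (h : S.v (x - y) < S.v y) : S.v x = S.v y := by
  apply le_antisymm
  · have := S.add_le h.le le_rfl
    rwa [sub_add_cancel] at this
  · by_contra! hlt
    have := S.sub_lt hlt h
    rw [sub_sub_cancel] at this
    exact lt_irrefl _ this

lemma natCast_le_one (n : ℕ) : S.v (n : Ω) ≤ 1 :=
  S.nonarch.apply_natCast_le_one

lemma natCast_eq_one {n : ℕ} (h : n.Coprime p) : S.v (n : Ω) = 1 := by
  refine le_antisymm (S.natCast_le_one n) ?_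
  by_contra! hlt
  have hb : (n : Ω) * (n.gcdA p : ℤ) + (p : Ω) * (n.gcdB p : ℤ) = 1 := by
    have := Nat.gcd_eq_gcd_ab n p
    rw [h.gcd_eq_one] at this
    have h2 := congrArg (Int.cast : ℤ → Ω) this.symm
    push_cast at h2 ⊢
    exact h2
  have h_int : ∀ a : ℤ, S.v (a : Ω) ≤ 1 := fun a =>
    S.nonarch.apply_intCast_le_one
  have := S.add_lt (x := (n : Ω) * (n.gcdA p : ℤ)) (y := (p : Ω) * (n.gcdB p : ℤ)) (r := 1)
    (by rw [map_mul]; exact mul_lt_one_of_nonneg_of_lt_one_left (S.v.nonneg _) hlt (h_int _))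
    (by rw [map_mul]
        exact mul_lt_one_of_nonneg_of_lt_one_left (S.v.nonneg _) S.natCast_lt_one (h_int _))
  rw [hb, map_one] at this
  exact lt_irrefl _ this

lemma eq_one_of_pow_eq_one {ζ : Ω} {n : ℕ} (hn : 0 < n) (h : ζ ^ n = 1) : S.v ζ = 1 :=
  (pow_eq_one_iff_of_nonneg (S.v.nonneg _) hn.ne').1 (by rw [← map_pow, h, map_one])

lemma mul_sub_mul_lt {a b c d : Ω} (h₁ : S.v (a - b) < S.v b) (h₂ : S.v (c - d) < S.v d) :
    S.v (a * c - b * d) < S.v (b * d) := by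
  have ha := S.eq_of_sub_lt h₁
  have hb : 0 < S.v b := (S.v.nonneg _).trans_lt h₁
  have hd : 0 < S.v d := (S.v.nonneg _).trans_lt h₂
  have : a * c - b * d = a * (c - d) + (a - b) * d := by ring
  rw [this]
  apply S.add_lt
  · rw [map_mul, map_mul, ha]; exact mul_lt_mul_of_pos_left h₂ hb
  · rw [map_mul, map_mul]; exact mul_lt_mul_of_pos_right h₁ hd

lemma pow_sub_pow_lt {a b : Ω} (h : S.v (a - b) < S.v b) (n : ℕ) :
    S.v (a ^ n - b ^ n) < S.v (b ^ n) := by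
  induction n with
  | zero => simp
  | succ n ih => rw [pow_succ, pow_succ]; exact S.mul_sub_mul_lt ih h

lemma pow_sub_one_lt {a : Ω} (h : S.v (a - 1) < 1) (n : ℕ) : S.v (a ^ n - 1) < 1 := by
  simpa using S.pow_sub_pow_lt (a := a) (b := 1) (by simpa using h) n

lemma div_sub_one_lt_iff {a b : Ω} (hb : b ≠ 0) :
    S.v (a / b - 1) < 1 ↔ S.v (a - b) < S.v b := by
  have : a / b - 1 = (a - b) / b := by field_simp
  rw [this, map_div₀, div_lt_one (S.v.pos hb)]

/-- Roots of unity of order prime to `p` are determined by their residue class. -/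
lemma eq_one_of_sub_one_lt {ζ : Ω} {n : ℕ} (hn : n.Coprime p) (h : ζ ^ n = 1)
    (hζ : S.v (ζ - 1) < 1) : ζ = 1 := by
  by_contra hne
  have hsum : ∑ i ∈ Finset.range n, ζ ^ i = 0 := by
    have := geom_sum_mul ζ n
    rw [h, sub_self] at this
    exact (mul_eq_zero.1 this).resolve_right (sub_ne_zero.2 hne)
  have hlt : S.v (∑ i ∈ Finset.range n, (ζ ^ i - 1)) < 1 :=
    S.sum_lt _ _ one_pos fun i _ => S.pow_sub_one_lt hζ i
  rw [Finset.sum_sub_distrib, hsum] at hlt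
  simp only [Finset.sum_const, Finset.card_range, nsmul_eq_mul, mul_one, zero_sub] at hlt
  rw [S.v.map_neg, S.natCast_eq_one hn] at hlt
  exact lt_irrefl _ hlt

variable [Fact p.Prime]

lemma pos_of_coprime {n : ℕ} (hn : n.Coprime p) : 0 < n := by
  rcases Nat.eq_zero_or_pos n with rfl | h
  · exact absurd ((Nat.coprime_zero_left p).1 hn) (Fact.out : p.Prime).one_lt.ne'
  · exact h

lemma eq_of_sub_lt_one {ζ η : Ω} {n m : ℕ} (hn : n.Coprime p) (hm : m.Coprime p)
    (h : ζ ^ n = 1) (h' : η ^ m = 1) (hlt : S.v (ζ - η) < 1) : ζ = η := by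
  have hη := S.eq_one_of_pow_eq_one (pos_of_coprime hm) h'
  have hη0 : η ≠ 0 := fun h0 => by simp [h0] at hη
  have : ζ / η = 1 := S.eq_one_of_sub_one_lt (n := n * m) (hn.mul_left hm)
    (by rw [div_pow, pow_mul, h, mul_comm, pow_mul, h', one_pow, one_pow, div_one])
    ((S.div_sub_one_lt_iff hη0).2 (by rwa [hη]))
  exact (div_eq_one_iff_eq hη0).1 this

lemma sub_one_lt_of_pow_p {t : Ω} (h : S.v (t ^ p - 1) < 1) : S.v (t - 1) < 1 := by
  have hp : p.Prime := Fact.out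
  have ht : S.v t = 1 := by
    have h1 := S.eq_of_sub_lt (x := t ^ p) (y := 1) (by simpa using h)
    rw [map_one, map_pow] at h1
    exact (pow_eq_one_iff_of_nonneg (S.v.nonneg _) hp.ne_zero).1 h1
  let V : Subring Ω :=
    { carrier := {x | S.v x ≤ 1}
      mul_mem' := fun {a b} ha hb => by
        change S.v (a * b) ≤ 1
        rw [map_mul]
        exact mul_le_one₀ ha (S.v.nonneg _) hb
      one_mem' := by simp
      add_mem' := fun {a b} ha hb => S.add_le ha hb
      zero_mem' := by simp
      neg_mem' := fun {a} ha => by simpa [S.v.map_neg] using ha }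
  let u : V := ⟨t - 1, by
    change S.v (t - 1) ≤ 1
    rw [sub_eq_add_neg]
    exact S.add_le ht.le (by simp [S.v.map_neg])⟩
  obtain ⟨r, hr⟩ := exists_add_pow_prime_eq hp u 1
  have hr' := congrArg (Subtype.val) hr
  push_cast at hr'
  simp only [u, sub_add_cancel, one_pow, mul_one] at hr'
  have : (t - 1) ^ p = (t ^ p - 1) - p * (t - 1) * (r : Ω) := by rw [hr']; ring
  have hlt : S.v ((t - 1) ^ p) < 1 := by
    rw [this]
    refine S.sub_lt h ?_
    rw [mul_assoc, map_mul]
    refine mul_lt_one_of_nonneg_of_lt_one_left (S.v.nonneg _) S.natCast_lt_one ?_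
    exact (u * r).2
  rw [map_pow] at hlt
  exact (pow_lt_one_iff_of_nonneg (S.v.nonneg _) hp.ne_zero).1 hlt

lemma sub_one_lt_of_pow_p_pow {t : Ω} {k : ℕ} (h : S.v (t ^ p ^ k - 1) < 1) :
    S.v (t - 1) < 1 := by
  induction k with
  | zero => simpa using h
  | succ k ih => exact ih (S.sub_one_lt_of_pow_p (by rwa [← pow_mul, ← pow_succ]))

/-- Teichmüller representatives. -/
lemma exists_rootOfUnity_sub_lt [IsAlgClosed Ω] {y : Ω} (hy : S.v y = 1) :
    ∃ (n : ℕ) (ζ : Ω), n.Coprime p ∧ ζ ^ n = 1 ∧ S.v (y - ζ) < 1 := by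
  have hp : p.Prime := Fact.out
  obtain ⟨d, hd, hyd⟩ := S.exists_pow_sub_one_lt y hy
  obtain ⟨a, n, hn, rfl⟩ := Nat.exists_eq_pow_mul_and_not_dvd hd.ne' p hp.ne_one
  have hn' : n.Coprime p := ((Nat.Prime.coprime_iff_not_dvd hp).2 hn).symm
  have hyn : S.v (y ^ n - 1) < 1 :=
    S.sub_one_lt_of_pow_p_pow (k := a) (by rwa [← pow_mul, mul_comm])
  refine ⟨n, ?_⟩
  have hsplit : (Polynomial.X ^ n - Polynomial.C (1 : Ω)).Splits := IsAlgClosed.splits _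
  have hmonic : (Polynomial.X ^ n - Polynomial.C (1 : Ω)).Monic :=
    Polynomial.monic_X_pow_sub_C _ (pos_of_coprime hn').ne'
  have heval : ((Polynomial.nthRoots n (1 : Ω)).map fun ζ => y - ζ).prod = y ^ n - 1 := by
    have := congrArg (Polynomial.eval y) (hsplit.eq_prod_roots_of_monic hmonic)
    rw [Polynomial.eval_multiset_prod] at this
    simpa [Multiset.map_map, Polynomial.nthRoots] using this.symm
  by_contra! hcon
  have hge : ∀ s : Multiset Ω, (∀ ζ ∈ s, 1 ≤ S.v (y - ζ)) →
      1 ≤ S.v ((s.map fun ζ => y - ζ).prod) := by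
    intro s
    induction s using Multiset.induction_on with
    | empty => simp
    | cons a s ih =>
      intro h
      rw [Multiset.map_cons, Multiset.prod_cons, map_mul]
      exact one_le_mul_of_one_le_of_one_le (h a (Multiset.mem_cons_self _ _))
        (ih fun ζ hζ => h ζ (Multiset.mem_cons_of_mem hζ))
  have := hge (Polynomial.nthRoots n (1 : Ω)) fun ζ hζ =>
    hcon ζ hn' ((Polynomial.mem_nthRoots (pos_of_coprime hn')).1 hζ)
  rw [heval] at this
  exact absurd hyn this.not_gt

end InvariantAbs
section KrullTopology

variable {K Ω : Type*} [Field K] [Field Ω] [Algebra K Ω]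

lemma isOpen_setOf_algEquiv_apply_eq [Algebra.IsIntegral K Ω] (x y : Ω) :
    IsOpen {σ : Ω ≃ₐ[K] Ω | σ x = y} := by
  rw [isOpen_iff_mem_nhds]
  rintro σ rfl
  have h := (stabilizer_isOpen_of_isIntegral (K := K) x).mem_nhds
    (one_mem (MulAction.stabilizer (Ω ≃ₐ[K] Ω) x))
  have hc : Filter.Tendsto (fun τ : Ω ≃ₐ[K] Ω => σ⁻¹ * τ) (nhds σ) (nhds 1) := by
    have := (continuous_const_mul σ⁻¹).tendsto σ
    rwa [inv_mul_cancel] at this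
  filter_upwards [hc h] with τ hτ
  have h1 : σ⁻¹ (τ x) = x := hτ
  have h2 := congrArg σ h1
  rwa [← AlgEquiv.mul_apply, mul_inv_cancel, AlgEquiv.one_apply] at h2

lemma isClosed_setOf_algEquiv_apply_eq [Algebra.IsIntegral K Ω] (x y : Ω) :
    IsClosed {σ : Ω ≃ₐ[K] Ω | σ x = y} := by
  rw [← isOpen_compl_iff]
  have : {σ : Ω ≃ₐ[K] Ω | σ x = y}ᶜ = ⋃ z ∈ {z : Ω | z ≠ y}, {σ | σ x = z} := by
    ext σ
    simp
  rw [this]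
  exact isOpen_biUnion fun z _ => isOpen_setOf_algEquiv_apply_eq x z

lemma isClosed_setOf_algEquiv_apply_eq_apply [Algebra.IsIntegral K Ω] (x y : Ω) (m : ℕ) :
    IsClosed {σ : Ω ≃ₐ[K] Ω | (σ ^ m) x = y} :=
  (isClosed_setOf_algEquiv_apply_eq x y).preimage (continuous_pow m)

lemma tendsto_nhds_one_of_forall_eventually {ι : Type*} {l : Filter ι} {u : ι → Ω ≃ₐ[K] Ω}
    (h : ∀ x, ∀ᶠ i in l, u i x = x) : Filter.Tendsto u l (nhds 1) := by
  refine Filter.tendsto_def.2 fun s hs => ?_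
  obtain ⟨E, hE, hEs⟩ := (krullTopology_mem_nhds_one_iff K Ω s).1 hs
  let b := Module.finBasis K E
  have hb : ∀ᶠ i in l, ∀ j, u i (b j) = b j := Filter.eventually_all.2 fun j => h _
  filter_upwards [hb] with i hi
  refine hEs ?_
  have hlin : ((u i).toLinearMap.comp E.val.toLinearMap) = E.val.toLinearMap :=
    b.ext fun j => hi j
  exact fun x => LinearMap.congr_fun hlin x

lemma exists_forall_mem_of_antitone_dvd [IsGalois K Ω] {p : ℕ} (T : ℕ → Set (Ω ≃ₐ[K] Ω))
    (hclosed : ∀ n, IsClosed (T n)) (hanti : ∀ n m, n ∣ m → T m ⊆ T n)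
    (hne : ∀ n, n.Coprime p → (T n).Nonempty) : ∃ σ, ∀ n, n.Coprime p → σ ∈ T n := by
  have : Nonempty {n : ℕ // n.Coprime p} := ⟨⟨1, Nat.coprime_one_left p⟩⟩
  obtain ⟨σ, hσ⟩ := IsCompact.nonempty_iInter_of_directed_nonempty_isCompact_isClosed
    (fun n : {n : ℕ // n.Coprime p} => T n)
    (fun n m => ⟨⟨n * m, n.2.mul_left m.2⟩, hanti _ _ (dvd_mul_right _ _),
      hanti _ _ (dvd_mul_left _ _)⟩)
    (fun n => hne n n.2) (fun n => (hclosed n).isCompact) (fun n => hclosed n)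
  exact ⟨σ, fun n hn => Set.mem_iInter.1 hσ ⟨n, hn⟩⟩

/-- The subgroup fixing all roots of unity of order prime to `p`. -/
def primeToPInertia (p : ℕ) (K Ω : Type*) [Field K] [Field Ω] [Algebra K Ω] :
    Subgroup (Ω ≃ₐ[K] Ω) where
  carrier := {σ | ∀ (n : ℕ) (ζ : Ω), n.Coprime p → ζ ^ n = 1 → σ ζ = ζ}
  mul_mem' := fun {a b} ha hb n ζ hn hζ => by
    rw [AlgEquiv.mul_apply, hb n ζ hn hζ, ha n ζ hn hζ]
  one_mem' := fun _ _ _ _ => rfl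
  inv_mem' := fun {a} ha n ζ hn hζ => by
    conv_lhs => rw [← ha n ζ hn hζ]
    exact a.symm_apply_apply ζ

lemma isClosed_primeToPInertia [Algebra.IsIntegral K Ω] (p : ℕ) :
    IsClosed (primeToPInertia p K Ω : Set (Ω ≃ₐ[K] Ω)) := by
  have : (primeToPInertia p K Ω : Set (Ω ≃ₐ[K] Ω)) =
      ⋂ (n : ℕ) (ζ : Ω) (_ : n.Coprime p) (_ : ζ ^ n = 1), {σ | σ ζ = ζ} := by
    ext σ
    simp only [Set.mem_iInter, Set.mem_ofPred_eq]
    rfl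
  rw [this]
  exact isClosed_iInter fun _ => isClosed_iInter fun ζ => isClosed_iInter fun _ =>
    isClosed_iInter fun _ => isClosed_setOf_algEquiv_apply_eq ζ ζ

end KrullTopology

namespace InvariantAbs

variable {p : ℕ} {K Ω : Type*} [Field K] [Field Ω] [Algebra K Ω] (S : InvariantAbs p K Ω)

/-- Automorphisms acting trivially on `Ωˣ` modulo principal units. -/
def IsWild (w : Ω ≃ₐ[K] Ω) : Prop := ∀ x : Ω, x ≠ 0 → S.v (w x - x) < S.v x

variable {S}

lemma IsWild.pow {w : Ω ≃ₐ[K] Ω} (hw : S.IsWild w) (i : ℕ) : S.IsWild (w ^ i) := by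
  intro x hx
  induction i with
  | zero => simpa using S.v.pos hx
  | succ i ih =>
    refine S.sub_lt_trans (y := w x) ?_ (hw x hx)
    rw [pow_succ', AlgEquiv.mul_apply, ← map_sub, S.map_eq]
    exact ih

lemma exists_pow_apply_eq_self [Algebra.IsIntegral K Ω] (w : Ω ≃ₐ[K] Ω) (x : Ω) :
    ∃ N : ℕ, 0 < N ∧ (w ^ N) x = x := by
  have hx : IsIntegral K x := Algebra.IsIntegral.isIntegral x
  have hroot : ∀ i : ℕ, (w ^ i) x ∈ (minpoly K x).rootSet Ω := fun i => by
    rw [Polynomial.mem_rootSet]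
    refine ⟨minpoly.ne_zero hx, ?_⟩
    rw [Polynomial.aeval_algHom_apply, minpoly.aeval, map_zero]
  have hni : ¬ Function.Injective
      (fun i : ℕ => (⟨(w ^ i) x, hroot i⟩ : (minpoly K x).rootSet Ω)) :=
    not_injective_infinite_finite _
  simp only [Function.Injective, not_forall] at hni
  obtain ⟨i, j, hij, hne⟩ := hni
  have key : ∀ i j : ℕ, i < j → (w ^ i) x = (w ^ j) x → ∃ N : ℕ, 0 < N ∧ (w ^ N) x = x := by
    intro i j hlt h
    refine ⟨j - i, Nat.sub_pos_of_lt hlt, ?_⟩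
    apply (w ^ i).injective
    rw [← AlgEquiv.mul_apply, ← pow_add, Nat.add_sub_cancel' hlt.le, h]
  have hij' : (w ^ i) x = (w ^ j) x := congrArg Subtype.val hij
  rcases lt_or_gt_of_ne hne with hlt | hlt
  · exact key i j hlt hij'
  · exact key j i hlt hij'.symm

lemma pow_apply_eq_of_pow_apply_eq {w : Ω ≃ₐ[K] Ω} {x : Ω} {N : ℕ} (h : (w ^ N) x = x) (j : ℕ) :
    (w ^ (N * j)) x = x := by
  induction j with
  | zero => simp
  | succ j ih => rw [Nat.mul_succ, pow_add, AlgEquiv.mul_apply, h, ih]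

/-- A wild automorphism whose order at `x` is prime to `p` fixes `x`. -/
lemma IsWild.apply_eq_of_pow_apply_eq {w : Ω ≃ₐ[K] Ω} (hw : S.IsWild w) {x : Ω} {m : ℕ}
    (hm : m.Coprime p) (h : (w ^ m) x = x) : w x = x := by
  set t := ∑ i ∈ Finset.range m, (w ^ i) x with ht
  have hwt : w t = t := by
    rw [ht, map_sum]
    have h1 : ∀ i ∈ Finset.range m, w ((w ^ i) x) = (w ^ (i + 1)) x := fun i _ => by
      rw [pow_succ', AlgEquiv.mul_apply]
    rw [Finset.sum_congr rfl h1]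
    have h2 := Finset.sum_range_succ' (fun i => (w ^ i) x) m
    rw [Finset.sum_range_succ, h] at h2
    simpa using h2.symm
  have hm1 := S.natCast_eq_one hm
  have hm0 : (m : Ω) ≠ 0 := fun h0 => by simp [h0] at hm1
  set z := (m : Ω) * x - t with hz
  have hwit : ∀ i : ℕ, (w ^ i) t = t := fun i => by
    simpa using pow_apply_eq_of_pow_apply_eq (w := w) (N := 1) (by simpa using hwt) i
  have hsum : ∑ i ∈ Finset.range m, (w ^ i) z = 0 := by
    simp only [hz, map_sub, map_mul, map_natCast, hwit, Finset.sum_sub_distrib, ← Finset.mul_sum]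
    simp [ht]
  have hz0 : z = 0 := by
    by_contra hne
    have hlt : S.v (∑ i ∈ Finset.range m, ((w ^ i) z - z)) < S.v z :=
      S.sum_lt _ _ (S.v.pos hne) fun i _ => hw.pow i z hne
    rw [Finset.sum_sub_distrib, hsum] at hlt
    simp only [Finset.sum_const, Finset.card_range, nsmul_eq_mul, zero_sub] at hlt
    rw [S.v.map_neg, map_mul, hm1, one_mul] at hlt
    exact lt_irrefl _ hlt
  have hx : x = (m : Ω)⁻¹ * t := by
    rw [eq_inv_mul_iff_mul_eq₀ hm0]
    exact sub_eq_zero.1 hz0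
  rw [hx, map_mul, map_inv₀, map_natCast, hwt]

variable [Fact p.Prime]

lemma IsWild.tendsto_pow [Algebra.IsIntegral K Ω] {w : Ω ≃ₐ[K] Ω} (hw : S.IsWild w) :
    Filter.Tendsto (fun k : ℕ => w ^ p ^ k) Filter.atTop (nhds 1) := by
  have hp : p.Prime := Fact.out
  refine tendsto_nhds_one_of_forall_eventually fun x => ?_
  obtain ⟨N, hN, hNx⟩ := exists_pow_apply_eq_self w x
  obtain ⟨a, m, hm, rfl⟩ := Nat.exists_eq_pow_mul_and_not_dvd hN.ne' p hp.ne_one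
  have hm' : m.Coprime p := ((Nat.Prime.coprime_iff_not_dvd hp).2 hm).symm
  have ha : (w ^ p ^ a) x = x :=
    (hw.pow (p ^ a)).apply_eq_of_pow_apply_eq hm' (by rwa [← pow_mul])
  filter_upwards [Filter.eventually_ge_atTop a] with k hk
  obtain ⟨c, rfl⟩ := Nat.exists_eq_add_of_le hk
  rw [pow_add]
  exact pow_apply_eq_of_pow_apply_eq ha _

variable [IsAlgClosed Ω] (S)

lemma apply_sub_lt_one_of_mem_inertia {u : Ω ≃ₐ[K] Ω} (hu : u ∈ primeToPInertia p K Ω) {y : Ω}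
    (hy : S.v y = 1) : S.v (u y - y) < 1 := by
  obtain ⟨n, ζ, hn, hζ, hlt⟩ := S.exists_rootOfUnity_sub_lt hy
  refine S.sub_lt_trans (y := ζ) ?_ (by rwa [S.v.map_sub])
  have h := hu n ζ hn hζ
  nth_rewrite 1 [← h]
  rwa [← map_sub, S.map_eq]

/-- Conjugation by a Frobenius raises tame inertia to the `q`-th power. -/
lemma isWild_frobenius_conj {q : ℕ} {φ h : Ω ≃ₐ[K] Ω} (hh : h ∈ primeToPInertia p K Ω)
    (hφ : ∀ (n : ℕ) (ζ : Ω), n.Coprime p → ζ ^ n = 1 → φ ζ = ζ ^ q) :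
    S.IsWild (φ * h * φ⁻¹ * (h ^ q)⁻¹) := by
  intro x hx
  set y := (h ^ q)⁻¹ x with hy
  have hxy : x = (h ^ q) y := by rw [hy, ← AlgEquiv.mul_apply, mul_inv_cancel, AlgEquiv.one_apply]
  have hvxy : S.v x = S.v y := by rw [hxy, S.map_eq]
  have hy0 : y ≠ 0 := fun h0 => hx (by rw [hxy, h0, map_zero])
  set z := φ⁻¹ y with hz
  have hyz : y = φ z := by rw [hz, ← AlgEquiv.mul_apply, mul_inv_cancel, AlgEquiv.one_apply]
  have hz0 : z ≠ 0 := fun h0 => hy0 (by rw [hyz, h0, map_zero])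
  have hvyz : S.v y = S.v z := by rw [hyz, S.map_eq]
  have hvz : 0 < S.v z := S.v.pos hz0
  obtain ⟨n, ζ, hn, hζ, hlt⟩ := S.exists_rootOfUnity_sub_lt (y := h z / z)
    (by rw [map_div₀, S.map_eq, div_self hvz.ne'])
  have hvζ : S.v ζ = 1 := S.eq_one_of_pow_eq_one (pos_of_coprime hn) hζ
  have h1 : S.v (h z - ζ * z) < S.v z := by
    have : h z - ζ * z = (h z / z - ζ) * z := by field_simp
    rw [this, map_mul]
    exact mul_lt_of_lt_one_left hvz hlt
  have h2 : S.v (φ (h z) - ζ ^ q * y) < S.v y := by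
    have : φ (h z) - ζ ^ q * y = φ (h z - ζ * z) := by
      rw [map_sub, map_mul, hφ n ζ hn hζ, ← hyz]
    rw [this, S.map_eq, hvyz]
    exact h1
  have h3 : S.v (h y - ζ * y) < S.v y := by
    have hu : S.v (y / z) = 1 := by rw [map_div₀, hvyz, div_self hvz.ne']
    have := S.mul_sub_mul_lt (a := h (y / z)) (b := y / z) (c := h z) (d := ζ * z)
      (by rw [hu]; exact S.apply_sub_lt_one_of_mem_inertia hh hu)
      (by rw [map_mul, hvζ, one_mul]; exact h1)
    rw [← map_mul, div_mul_cancel₀ _ hz0,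
      show y / z * (ζ * z) = ζ * y by field_simp, map_mul S.v, hvζ, one_mul] at this
    exact this
  have h4 : ∀ i : ℕ, S.v ((h ^ i) y - ζ ^ i * y) < S.v y := by
    intro i
    induction i with
    | zero => simpa using S.v.pos hy0
    | succ i ih =>
      have : (h ^ (i + 1)) y - ζ ^ (i + 1) * y =
          h ((h ^ i) y - ζ ^ i * y) + ζ ^ i * (h y - ζ * y) := by
        rw [map_sub, map_mul, map_pow, hh n ζ hn hζ, pow_succ', AlgEquiv.mul_apply]
        ring
      rw [this]
      refine S.add_lt (by rwa [S.map_eq]) ?_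
      rw [map_mul, map_pow, hvζ, one_pow, one_mul]
      exact h3
  have h5 : (φ * h * φ⁻¹ * (h ^ q)⁻¹) x = φ (h z) := by
    simp only [AlgEquiv.mul_apply, ← hy, ← hz]
  rw [h5, hvxy]
  refine S.sub_lt_trans (y := ζ ^ q * y) h2 ?_
  rw [hxy, S.v.map_sub]
  exact h4 q

end InvariantAbs

/-- An automorphism of a field of characteristic `p` acts on each root of unity as a power of
Frobenius. -/
lemma RingEquiv.exists_apply_eq_pow_char_pow {F : Type*} [Field F] {p : ℕ} [Fact p.Prime]
    [CharP F p] (σ : F ≃+* F) {β : F} {N : ℕ} (hN : 0 < N) (hβ : β ^ N = 1) :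
    ∃ a : ℕ, σ β = β ^ p ^ a := by
  let _ : Algebra (ZMod p) F := ZMod.algebra F p
  have h_int : IsIntegral (ZMod p) β :=
    ⟨Polynomial.X ^ N - 1, Polynomial.monic_X_pow_sub_C 1 hN.ne', by simp [hβ]⟩
  let σ' : F ≃ₐ[ZMod p] F := AlgEquiv.ofRingEquiv (f := σ) fun x =>
    RingHom.congr_fun (Subsingleton.elim ((σ : F →+* F).comp (algebraMap (ZMod p) F)) _) x
  let E := IntermediateField.adjoin (ZMod p) {β}
  have : FiniteDimensional (ZMod p) E := IntermediateField.adjoin.finiteDimensional h_int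
  have : Finite E := Module.finite_of_finite (ZMod p)
  let b : E := IntermediateField.AdjoinSimple.gen (ZMod p) β
  obtain ⟨a, ha⟩ := (FiniteField.bijective_frobeniusAlgEquivOfAlgebraic_pow (ZMod p) E).2
    (σ'.restrictNormal E)
  refine ⟨a, ?_⟩
  have h1 := σ'.restrictNormal_commutes E b
  have h2 : (σ'.restrictNormal E) b = b ^ p ^ (a : ℕ) := by
    rw [← ha]
    simp only [AlgEquiv.coe_pow, FiniteField.coe_frobeniusAlgEquivOfAlgebraic_iterate, ZMod.card]
  rw [h2, map_pow] at h1
  exact h1.symm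

namespace InvariantAbs

variable {p : ℕ} {K Ω : Type*} [Field K] [Field Ω] [Algebra K Ω] (S : InvariantAbs p K Ω)

/-- The valuation ring of an invariant absolute value. -/
def valuationSubring : ValuationSubring Ω where
  carrier := {x | S.v x ≤ 1}
  mul_mem' := fun {a b} ha hb => by
    change S.v (a * b) ≤ 1
    rw [map_mul]
    exact mul_le_one₀ ha (S.v.nonneg _) hb
  one_mem' := by simp
  add_mem' := fun {a b} ha hb => S.add_le ha hb
  zero_mem' := by simp
  neg_mem' := fun {a} ha => by simpa [S.v.map_neg] using ha
  mem_or_inv_mem' := fun x => by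
    change S.v x ≤ 1 ∨ S.v x⁻¹ ≤ 1
    rw [map_inv₀]
    rcases le_total (S.v x) 1 with h | h
    · exact Or.inl h
    · exact Or.inr (inv_le_one_of_one_le₀ h)

lemma mem_valuationSubring {x : Ω} : x ∈ S.valuationSubring ↔ S.v x ≤ 1 := Iff.rfl

lemma residue_eq_zero_iff (x : S.valuationSubring) :
    IsLocalRing.residue S.valuationSubring x = 0 ↔ S.v (x : Ω) < 1 := by
  rw [IsLocalRing.residue_eq_zero_iff, IsLocalRing.mem_maximalIdeal, mem_nonunits_iff,
    lt_iff_not_ge, not_iff_not]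
  constructor
  · rintro ⟨u, rfl⟩
    have h : S.v ((u : S.valuationSubring) : Ω) * S.v ((u⁻¹ : S.valuationSubringˣ) : Ω) = 1 := by
      rw [← map_mul]
      have := congrArg (Subtype.val) u.mul_inv
      push_cast at this
      rw [this, map_one]
    have h2 : S.v ((u⁻¹ : S.valuationSubringˣ) : Ω) ≤ 1 := (u⁻¹ : S.valuationSubringˣ).1.2
    by_contra! hlt
    exact (mul_lt_one_of_nonneg_of_lt_one_left (S.v.nonneg _) hlt h2).ne h
  · intro h
    have h0 : (x : Ω) ≠ 0 := fun h0 => by simp [h0] at h; linarith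
    refine IsUnit.of_mul_eq_one (⟨(x : Ω)⁻¹, ?_⟩ : S.valuationSubring) ?_
    · rw [mem_valuationSubring, map_inv₀]
      exact inv_le_one_of_one_le₀ h
    · exact Subtype.ext (mul_inv_cancel₀ h0)

lemma residue_eq_iff (x y : S.valuationSubring) :
    IsLocalRing.residue S.valuationSubring x = IsLocalRing.residue S.valuationSubring y ↔
      S.v ((x : Ω) - y) < 1 := by
  rw [← sub_eq_zero, ← map_sub, residue_eq_zero_iff]
  rfl

lemma charP_residueField [Fact p.Prime] :
    CharP (IsLocalRing.ResidueField S.valuationSubring) p := by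
  refine (CharP.charP_iff_prime_eq_zero Fact.out).2 ?_
  have := (S.residue_eq_zero_iff (p : S.valuationSubring)).2 (by simpa using S.natCast_lt_one)
  simpa using this

/-- The automorphism of the residue field induced by an automorphism. -/
def residueAut (σ : Ω ≃ₐ[K] Ω) :
    IsLocalRing.ResidueField S.valuationSubring ≃+* IsLocalRing.ResidueField S.valuationSubring :=
  IsLocalRing.ResidueField.mapEquiv
    { toFun := fun x => ⟨σ x, by rw [mem_valuationSubring, S.map_eq]; exact x.2⟩
      invFun := fun x => ⟨σ.symm x, by rw [mem_valuationSubring, S.map_eq]; exact x.2⟩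
      left_inv := fun x => Subtype.ext (σ.symm_apply_apply x)
      right_inv := fun x => Subtype.ext (σ.apply_symm_apply x)
      map_mul' := fun x y => Subtype.ext (map_mul σ _ _)
      map_add' := fun x y => Subtype.ext (map_add σ _ _) }

lemma residueAut_residue (σ : Ω ≃ₐ[K] Ω) (x : S.valuationSubring) :
    S.residueAut σ (IsLocalRing.residue _ x) =
      IsLocalRing.residue _ ⟨σ x, by rw [mem_valuationSubring, S.map_eq]; exact x.2⟩ := rfl

lemma natCast_ne_zero_of_coprime (S : InvariantAbs p K Ω) {n : ℕ} (hn : n.Coprime p) :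
    (n : Ω) ≠ 0 := fun h => by
  have := S.natCast_eq_one hn
  simp [h] at this

lemma exists_primitiveRoot (S : InvariantAbs p K Ω) [Fact p.Prime] [IsAlgClosed Ω]
    {n : ℕ} (hn : n.Coprime p) : ∃ ζ : Ω, IsPrimitiveRoot ζ n := by
  have : NeZero (n : Ω) := ⟨S.natCast_ne_zero_of_coprime hn⟩
  exact HasEnoughRootsOfUnity.exists_primitiveRoot Ω n

lemma exists_apply_eq_pow_char_pow (S : InvariantAbs p K Ω) [Fact p.Prime]
    (σ : Ω ≃ₐ[K] Ω) {ζ : Ω} {n : ℕ} (hn : n.Coprime p) (hζ : ζ ^ n = 1) :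
    ∃ a : ℕ, σ ζ = ζ ^ p ^ a := by
  have := S.charP_residueField
  have hpos := pos_of_coprime hn
  have hv := S.eq_one_of_pow_eq_one hpos hζ
  let z : S.valuationSubring := ⟨ζ, hv.le⟩
  obtain ⟨a, ha⟩ := (S.residueAut σ).exists_apply_eq_pow_char_pow (p := p)
    (β := IsLocalRing.residue _ z) hpos (by
      rw [← map_pow, ← map_one (IsLocalRing.residue _)]
      congr 1
      exact Subtype.ext hζ)
  refine ⟨a, ?_⟩
  rw [S.residueAut_residue, ← map_pow, S.residue_eq_iff] at ha
  refine S.eq_of_sub_lt_one hn hn (by rw [← map_pow, hζ, map_one]) ?_ ha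
  rw [← pow_mul, mul_comm, pow_mul, hζ, one_pow]

/-- The image of Galois in the automorphisms of the prime-to-`p` roots of unity is torsion free. -/
lemma mem_inertia_of_pow_mem (S : InvariantAbs p K Ω) [Fact p.Prime] [IsAlgClosed Ω]
    {g : Ω ≃ₐ[K] Ω} {n : ℕ} (hn : 0 < n) (h : g ^ n ∈ primeToPInertia p K Ω) :
    g ∈ primeToPInertia p K Ω := by
  intro m ζ hm hζ
  have hp : p.Prime := Fact.out
  have hcop : ∀ M, 0 < M → (p ^ M - 1).Coprime p := fun M hM =>
    Nat.Coprime.coprime_dvd_right (dvd_pow_self p hM.ne')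
      ((Nat.coprime_self_sub_left (Nat.one_le_pow _ _ hp.pos)).2 (Nat.coprime_one_left _))
  set s := m.totient with hs
  have hspos : 0 < s := Nat.totient_pos.2 (pos_of_coprime hm)
  have hms : m ∣ p ^ s - 1 :=
    (Nat.modEq_iff_dvd' (Nat.one_le_pow _ _ hp.pos)).1 (Nat.ModEq.pow_totient hm.symm).symm
  have hM : 0 < s * n := Nat.mul_pos hspos hn
  have : NeZero (p ^ (s * n) - 1) := ⟨(pos_of_coprime (hcop _ hM)).ne'⟩
  obtain ⟨ζ₀, hζ₀⟩ := S.exists_primitiveRoot (hcop _ hM)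
  obtain ⟨a, ha⟩ := S.exists_apply_eq_pow_char_pow g (hcop _ hM) hζ₀.pow_eq_one
  have hpow : ∀ i : ℕ, (g ^ i) ζ₀ = ζ₀ ^ p ^ (a * i) := by
    intro i
    induction i with
    | zero => simp
    | succ i ih =>
      rw [pow_succ, AlgEquiv.mul_apply, ha, map_pow, ih, ← pow_mul, ← pow_add, Nat.mul_succ]
  have hfix := h _ ζ₀ (hcop _ hM) hζ₀.pow_eq_one
  rw [hpow n] at hfix
  have hdvd : p ^ (s * n) - 1 ∣ p ^ (a * n) - 1 := by
    refine hζ₀.dvd_of_pow_eq_one _ ?_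
    have h0 : ζ₀ ≠ 0 := hζ₀.ne_zero (NeZero.ne _)
    have h1 : ζ₀ ^ (p ^ (a * n) - 1) * ζ₀ = 1 * ζ₀ := by
      rw [← pow_succ, Nat.sub_add_cancel (Nat.one_le_pow _ _ hp.pos), hfix, one_mul]
    exact mul_right_cancel₀ h0 h1
  have hgcd := Nat.gcd_eq_left hdvd
  rw [Nat.pow_sub_one_gcd_pow_sub_one] at hgcd
  have hsn : s * n ∣ a * n := by
    have h1 := Nat.one_le_pow (Nat.gcd (s * n) (a * n)) p hp.pos
    have h2 := Nat.one_le_pow (s * n) p hp.pos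
    have := Nat.pow_right_injective hp.two_le
      (show p ^ Nat.gcd (s * n) (a * n) = p ^ (s * n) by omega)
    exact Nat.gcd_eq_left_iff_dvd.1 this
  have hsa : s ∣ a := Nat.dvd_of_mul_dvd_mul_right hn hsn
  have hma : m ∣ p ^ a - 1 := hms.trans (Nat.pow_sub_one_dvd_pow_sub_one p hsa)
  obtain ⟨i, -, rfl⟩ := hζ₀.eq_pow_of_pow_eq_one (ξ := ζ) (by
    obtain ⟨c, hc⟩ := hms.trans (Nat.pow_sub_one_dvd_pow_sub_one p (dvd_mul_right s n))
    rw [hc, pow_mul, hζ, one_pow])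
  rw [map_pow, ha, ← pow_mul, mul_comm, pow_mul]
  obtain ⟨c, hc⟩ := hma
  rw [← Nat.sub_add_cancel (Nat.one_le_pow a p hp.pos), hc, pow_succ, pow_mul, hζ, one_pow, one_mul]

lemma commutator_le_inertia (S : InvariantAbs p K Ω) [Fact p.Prime] [IsAlgClosed Ω] :
    commutator (Ω ≃ₐ[K] Ω) ≤ primeToPInertia p K Ω := by
  rw [commutator_def, Subgroup.commutator_le]
  intro σ _ τ _ n ζ hn hζ
  have hroot : ∀ (τ : Ω ≃ₐ[K] Ω) {ξ : Ω}, ξ ^ n = 1 → (τ ξ) ^ n = 1 := fun τ ξ h => by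
    rw [← map_pow, h, map_one]
  have hcomm : ∀ ξ : Ω, ξ ^ n = 1 → σ (τ ξ) = τ (σ ξ) := fun ξ hξ => by
    obtain ⟨a, ha⟩ := S.exists_apply_eq_pow_char_pow σ hn hξ
    obtain ⟨b, hb⟩ := S.exists_apply_eq_pow_char_pow τ hn hξ
    rw [ha, hb, map_pow, map_pow, ha, hb, ← pow_mul, ← pow_mul, mul_comm]
  rw [commutatorElement_def, AlgEquiv.mul_apply, AlgEquiv.mul_apply, AlgEquiv.mul_apply,
    hcomm _ (hroot _ (hroot _ hζ))]
  rw [← AlgEquiv.mul_apply σ, mul_inv_cancel, AlgEquiv.one_apply, ← AlgEquiv.mul_apply,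
    mul_inv_cancel, AlgEquiv.one_apply]

lemma closure_commutator_le_inertia (S : InvariantAbs p K Ω) [Fact p.Prime] [IsAlgClosed Ω]
    [Algebra.IsIntegral K Ω] :
    (commutator (Ω ≃ₐ[K] Ω)).topologicalClosure ≤ primeToPInertia p K Ω :=
  Subgroup.topologicalClosure_minimal _ S.commutator_le_inertia (isClosed_primeToPInertia p)

end InvariantAbs

namespace InvariantAbs

variable {p : ℕ} {K Ω : Type*} [Field K] [Field Ω] [Algebra K Ω] (S : InvariantAbs p K Ω)

lemma v_apply_eq_of_algHom [IsGalois K Ω] {F : IntermediateField K Ω} (τ : F →ₐ[K] Ω) (x : F) :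
    S.v (τ x) = S.v (x : Ω) := by
  have h : IsConjRoot K (x : Ω) (τ x) := by
    rw [IsConjRoot, minpoly.algHom_eq τ τ.injective]
    exact minpoly.algHom_eq F.val F.val.injective x
  obtain ⟨σ, hσ⟩ := h.exists_algEquiv
  rw [← hσ, S.map_eq]

/-- A lift of Frobenius on roots of unity of fixed order. -/
lemma exists_apply_eq_pow [Fact p.Prime] [IsAlgClosed Ω] [IsGalois K Ω] {f : ℕ}
    (hres : ∀ a : K, S.v (algebraMap K Ω a) ≤ 1 →
      S.v (algebraMap K Ω a ^ p ^ f - algebraMap K Ω a) < 1) {n : ℕ} (hn : n.Coprime p) :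
    ∃ φ : Ω ≃ₐ[K] Ω, ∀ ζ : Ω, ζ ^ n = 1 → φ ζ = ζ ^ p ^ f := by
  have := S.charP_residueField
  have hpos := pos_of_coprime hn
  have : NeZero n := ⟨hpos.ne'⟩
  obtain ⟨ζ, hζ⟩ := S.exists_primitiveRoot hn
  have hvζ := S.eq_one_of_pow_eq_one hpos hζ.pow_eq_one
  have h_int : IsIntegral K ζ := Algebra.IsIntegral.isIntegral ζ
  set P := (minpoly K ζ).map (algebraMap K Ω) with hP
  have hPprod := (IsAlgClosed.splits P).eq_prod_roots_of_monic ((minpoly.monic h_int).map _)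
  have hconj : ∀ r ∈ P.roots, ∃ σ : Ω ≃ₐ[K] Ω, r = σ ζ := by
    intro r hr
    have h1 : Polynomial.aeval r (minpoly K ζ) = 0 := by
      have := Polynomial.isRoot_of_mem_roots hr
      rwa [hP, Polynomial.IsRoot, Polynomial.eval_map_algebraMap] at this
    obtain ⟨σ, hσ⟩ := ((isConjRoot_iff_aeval_eq_zero h_int).2 h1).symm.exists_algEquiv
    exact ⟨_, hσ.symm⟩
  obtain ⟨s, hs⟩ : ∃ s : Multiset S.valuationSubring, s.map Subtype.val = P.roots := by
    have := Multiset.canLift (Subtype.val : S.valuationSubring → Ω) (· ∈ S.valuationSubring)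
    exact CanLift.prf P.roots fun r hr => by
      obtain ⟨σ, rfl⟩ := hconj r hr
      rw [mem_valuationSubring, S.map_eq, hvζ]
  set Q : Polynomial S.valuationSubring :=
    (s.map fun r => Polynomial.X - Polynomial.C r).prod with hQ
  have hQP : Q.map S.valuationSubring.subtype = P := by
    rw [hPprod, hQ, Polynomial.map_multiset_prod, ← hs, Multiset.map_map, Multiset.map_map]
    simp
  let res := IsLocalRing.residue S.valuationSubring
  have hfix : (Q.map res).map (iterateFrobenius _ p f) = Q.map res := by
    ext i
    simp only [Polynomial.coeff_map, iterateFrobenius_def]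
    rw [← map_pow, S.residue_eq_iff]
    have hc : ((Q.coeff i : S.valuationSubring) : Ω) =
        algebraMap K Ω ((minpoly K ζ).coeff i) := by
      have := congrArg (fun R => R.coeff i) hQP
      simpa [hP] using this
    have hle : S.v (algebraMap K Ω ((minpoly K ζ).coeff i)) ≤ 1 := by
      rw [← hc]
      exact (Q.coeff i).2
    push_cast
    rw [hc]
    exact hres _ hle
  let z : S.valuationSubring := ⟨ζ, hvζ.le⟩
  have hev : (Q.map res).eval (res z) = 0 := by
    rw [Polynomial.eval_map_apply]
    have : Q.eval z = 0 := by
      apply Subtype.val_injective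
      have h1 := Polynomial.eval_map_apply (p := Q) (f := S.valuationSubring.subtype) z
      rw [hQP] at h1
      have h2 : P.eval ζ = 0 := by
        rw [hP, Polynomial.eval_map_algebraMap, minpoly.aeval]
      exact h1.symm.trans h2
    rw [this, map_zero]
  have hev2 : (Q.map res).eval (res (z ^ p ^ f)) = 0 := by
    have h1 := Polynomial.eval_map_apply (p := Q.map res) (f := iterateFrobenius _ p f) (res z)
    rw [hfix, hev, map_zero, iterateFrobenius_def, ← map_pow] at h1
    exact h1
  rw [hQ, Polynomial.map_multiset_prod, Polynomial.eval_multiset_prod, Multiset.prod_eq_zero_iff,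
    Multiset.map_map, Multiset.map_map, Multiset.mem_map] at hev2
  obtain ⟨r, hr, hr0⟩ := hev2
  simp only [Function.comp_apply, Polynomial.map_sub, Polynomial.map_X, Polynomial.map_C,
    Polynomial.eval_sub, Polynomial.eval_X, Polynomial.eval_C, sub_eq_zero] at hr0
  rw [S.residue_eq_iff] at hr0
  obtain ⟨σ, hσ⟩ := hconj r (hs ▸ Multiset.mem_map_of_mem _ hr)
  have hσζ : σ ζ = ζ ^ p ^ f := by
    rw [← hσ]
    refine (S.eq_of_sub_lt_one hn hn ?_ ?_ hr0).symm
    · change (ζ ^ p ^ f) ^ n = 1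
      rw [← pow_mul, mul_comm, pow_mul, hζ.pow_eq_one, one_pow]
    · rw [hσ, ← map_pow, hζ.pow_eq_one, map_one]
  refine ⟨σ, fun ξ hξ => ?_⟩
  obtain ⟨i, -, rfl⟩ := hζ.eq_pow_of_pow_eq_one hξ
  rw [map_pow, hσζ, ← pow_mul, ← pow_mul, mul_comm]

lemma exists_frobenius [Fact p.Prime] [IsAlgClosed Ω] [IsGalois K Ω] {f : ℕ}
    (hres : ∀ a : K, S.v (algebraMap K Ω a) ≤ 1 →
      S.v (algebraMap K Ω a ^ p ^ f - algebraMap K Ω a) < 1) :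
    ∃ φ : Ω ≃ₐ[K] Ω, ∀ (n : ℕ) (ζ : Ω), n.Coprime p → ζ ^ n = 1 → φ ζ = ζ ^ p ^ f := by
  obtain ⟨φ, hφ⟩ := exists_forall_mem_of_antitone_dvd (p := p)
    (fun n => ⋂ (ζ : Ω) (_ : ζ ^ n = 1), {φ : Ω ≃ₐ[K] Ω | φ ζ = ζ ^ p ^ f})
    (fun n => isClosed_iInter fun ζ => isClosed_iInter fun _ =>
      isClosed_setOf_algEquiv_apply_eq _ _)
    (fun n m hnm σ hσ => by
      simp only [Set.mem_iInter] at hσ ⊢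
      obtain ⟨c, rfl⟩ := hnm
      exact fun ζ hζ => hσ ζ (by rw [pow_mul, hζ, one_pow]))
    (fun n hn => by
      obtain ⟨φ, hφ⟩ := S.exists_apply_eq_pow hres hn
      exact ⟨φ, by simpa using hφ⟩)
  refine ⟨φ, fun n ζ hn hζ => ?_⟩
  have := hφ n hn
  simp only [Set.mem_iInter] at this
  exact this ζ hζ

/-- Adjoining roots of unity of order prime to `p` does not enlarge the value group. -/
lemma exists_v_algebraMap_eq [Fact p.Prime] [IsAlgClosed Ω] [IsGalois K Ω] {n : ℕ}
    (hn : n.Coprime p) {ζ : Ω} (hζ : ζ ^ n = 1) {F : IntermediateField K Ω}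
    (hF : F = IntermediateField.adjoin K {ζ}) (x : F) (hx : x ≠ 0) :
    ∃ a : K, S.v (algebraMap K Ω a) = S.v (x : Ω) := by
  classical
  have h_int : IsIntegral K ζ := Algebra.IsIntegral.isIntegral ζ
  have : FiniteDimensional K F := hF ▸ IntermediateField.adjoin.finiteDimensional h_int
  have hpos := pos_of_coprime hn
  have hvζ := S.eq_one_of_pow_eq_one hpos hζ
  let z : F := ⟨ζ, hF.ge (IntermediateField.mem_adjoin_simple_self K ζ)⟩
  have hz : (z : Ω) = ζ := rfl
  have hvx : 0 < S.v (x : Ω) := S.v.pos (by simpa using hx)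
  have hvτ : ∀ τ : F →ₐ[K] Ω, S.v (τ z) = 1 := fun τ => by rw [S.v_apply_eq_of_algHom, hz, hvζ]
  let zV : (F →ₐ[K] Ω) → S.valuationSubring := fun τ => ⟨τ z, (hvτ τ).le⟩
  let G : Polynomial S.valuationSubring :=
    ∏ τ ∈ Finset.univ.erase F.val, (Polynomial.X - Polynomial.C (zV τ))
  let g := G.map S.valuationSubring.subtype
  have hg : g = ∏ τ ∈ Finset.univ.erase F.val, (Polynomial.X - Polynomial.C (τ z)) := by
    simp [g, G, Polynomial.map_prod, zV]
  have hgcoeff : ∀ i, S.v (g.coeff i) ≤ 1 := fun i => by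
    rw [Polynomial.coeff_map]
    exact (G.coeff i).2
  have hroot : ∀ τ : F →ₐ[K] Ω, τ ≠ F.val → g.eval (τ z) = 0 := fun τ hτ => by
    rw [hg, Polynomial.eval_prod]
    exact Finset.prod_eq_zero (Finset.mem_erase.2 ⟨hτ, Finset.mem_univ _⟩) (by simp)
  have hgζ : S.v (g.eval ζ) = 1 := by
    rw [hg, Polynomial.eval_prod, map_prod]
    refine Finset.prod_eq_one fun τ hτ => ?_
    simp only [Polynomial.eval_sub, Polynomial.eval_X, Polynomial.eval_C]
    refine le_antisymm ?_ ?_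
    · rw [sub_eq_add_neg]
      exact S.add_le hvζ.le (by rw [S.v.map_neg, hvτ])
    · by_contra! hlt
      have hτz : ζ = τ z := S.eq_of_sub_lt_one hn hn hζ
        (by rw [← map_pow, ← map_one τ]; congr 1; exact Subtype.ext hζ) hlt
      refine (Finset.mem_erase.1 hτ).1 ?_
      refine IntermediateField.algHom_ext_of_eq_adjoin K hF ?_
      rintro y hy
      obtain rfl := Set.mem_singleton_iff.1 hy
      exact hτz.symm
  have hsum : ∑ i ∈ Finset.range (g.natDegree + 1),
      g.coeff i * algebraMap K Ω (Algebra.trace K F (z ^ i * x)) = g.eval ζ * x := by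
    calc _ = ∑ i ∈ Finset.range (g.natDegree + 1), ∑ τ : F →ₐ[K] Ω,
          g.coeff i * (τ z) ^ i * τ x := by
          refine Finset.sum_congr rfl fun i _ => ?_
          rw [trace_eq_sum_embeddings Ω, Finset.mul_sum]
          refine Finset.sum_congr rfl fun τ _ => ?_
          rw [map_mul, map_pow, mul_assoc]
      _ = ∑ τ : F →ₐ[K] Ω, g.eval (τ z) * τ x := by
          rw [Finset.sum_comm]
          refine Finset.sum_congr rfl fun τ _ => ?_
          rw [Polynomial.eval_eq_sum_range, Finset.sum_mul]
      _ = g.eval ζ * x := by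
          rw [Finset.sum_eq_single F.val]
          · rfl
          · intro τ _ hτ
            rw [hroot τ hτ, zero_mul]
          · simp
  have hle : ∀ i : ℕ, S.v (algebraMap K Ω (Algebra.trace K F (z ^ i * x))) ≤ S.v (x : Ω) := by
    intro i
    rw [trace_eq_sum_embeddings Ω]
    refine S.sum_le _ _ hvx.le fun τ _ => ?_
    rw [map_mul, map_pow, map_mul, map_pow, hvτ, one_pow, one_mul, S.v_apply_eq_of_algHom]
  by_contra! hne
  have hlt := S.sum_lt (Finset.range (g.natDegree + 1))
    (fun i => g.coeff i * algebraMap K Ω (Algebra.trace K F (z ^ i * x))) hvx fun i _ => by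
      rw [map_mul]
      exact (mul_le_of_le_one_left (S.v.nonneg _) (hgcoeff i)).trans_lt
        (lt_of_le_of_ne (hle i) (hne _))
  rw [hsum, map_mul, hgζ, one_mul] at hlt
  exact lt_irrefl _ hlt

end InvariantAbs


namespace InvariantAbs

variable {p : ℕ} {K Ω : Type*} [Field K] [Field Ω] [Algebra K Ω] (S : InvariantAbs p K Ω)

/-- `π` generates the value group of `K`. -/
structure IsUniformizer (π : K) : Prop where
  pos : 0 < S.v (algebraMap K Ω π)
  lt_one : S.v (algebraMap K Ω π) < 1
  exists_zpow : ∀ a : K, a ≠ 0 → ∃ j : ℤ, S.v (algebraMap K Ω a) = S.v (algebraMap K Ω π) ^ j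

variable {S}

lemma IsUniformizer.minpoly_eq [Fact p.Prime] [IsAlgClosed Ω] [IsGalois K Ω] {π : K}
    (hπ : S.IsUniformizer π) {n M : ℕ} (hn : n.Coprime p) (hM : 0 < M) {ζ ρ : Ω} (hζ : ζ ^ n = 1)
    (hρ : ρ ^ M = algebraMap K Ω π) {F : IntermediateField K Ω}
    (hF : F = IntermediateField.adjoin K {ζ}) :
    minpoly F ρ = Polynomial.X ^ M - Polynomial.C (algebraMap K F π) := by
  have h_int : IsIntegral F ρ := Algebra.IsIntegral.isIntegral ρ
  have hpi : algebraMap F Ω (algebraMap K F π) = algebraMap K Ω π :=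
    (IsScalarTower.algebraMap_apply K F Ω π).symm
  have hdvd : minpoly F ρ ∣ Polynomial.X ^ M - Polynomial.C (algebraMap K F π) := by
    refine minpoly.dvd _ _ ?_
    simp only [map_sub, map_pow, Polynomial.aeval_X, Polynomial.aeval_C, hpi, hρ, sub_self]
  have hmonic : (Polynomial.X ^ M - Polynomial.C (algebraMap K F π)).Monic :=
    Polynomial.monic_X_pow_sub_C _ hM.ne'
  set P := (minpoly F ρ).map (algebraMap F Ω) with hP
  set d := (minpoly F ρ).natDegree with hd
  have hPd : P.natDegree = d := Polynomial.natDegree_map _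
  have hvroot : ∀ r ∈ P.roots, S.v r = S.v ρ := fun r hr => by
    have h1 : P.eval r = 0 := Polynomial.isRoot_of_mem_roots hr
    have h2 : r ^ M = algebraMap K Ω π := by
      have h3 := Polynomial.eval_dvd (x := r) (Polynomial.map_dvd (algebraMap F Ω) hdvd)
      rw [← hP, h1, zero_dvd_iff] at h3
      simpa [sub_eq_zero, hpi] using h3
    refine (pow_left_inj₀ (S.v.nonneg _) (S.v.nonneg _) hM.ne').1 ?_
    rw [← map_pow, ← map_pow, h2, hρ]
  have hcard : P.roots.card = d := by
    rw [← hPd]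
    exact (IsAlgClosed.splits P).natDegree_eq_card_roots.symm
  have hc0 : S.v (algebraMap F Ω ((minpoly F ρ).coeff 0)) = S.v ρ ^ d := by
    rw [← Polynomial.coeff_map, ← hP,
      (IsAlgClosed.splits P).coeff_zero_eq_prod_roots_of_monic ((minpoly.monic h_int).map _)]
    rw [map_mul, map_pow, S.v.map_neg, map_one, one_pow, one_mul, map_multiset_prod,
      Multiset.map_congr rfl hvroot, Multiset.map_const', Multiset.prod_replicate, hcard]
  have hvρM : S.v ρ ^ M = S.v (algebraMap K Ω π) := by rw [← map_pow, hρ]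
  have hρ0 : ρ ≠ 0 := by
    rintro rfl
    have := hπ.pos
    rw [← hvρM, map_zero, zero_pow hM.ne'] at this
    exact lt_irrefl _ this
  have hcne : (minpoly F ρ).coeff 0 ≠ 0 := minpoly.coeff_zero_ne_zero h_int hρ0
  obtain ⟨a, ha⟩ := S.exists_v_algebraMap_eq hn hζ hF _ hcne
  have ha0 : a ≠ 0 := by
    rintro rfl
    rw [map_zero, map_zero] at ha
    exact hcne (by simpa using ha.symm)
  obtain ⟨j, hj⟩ := hπ.exists_zpow a ha0
  have hdj : S.v (algebraMap K Ω π) ^ (d : ℤ) = S.v (algebraMap K Ω π) ^ (j * M) := by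
    rw [zpow_mul, ← hj, ha, zpow_natCast, zpow_natCast, ← hvρM, ← pow_mul, mul_comm, pow_mul]
    exact congrArg (· ^ M) hc0.symm
  have hdj' : (d : ℤ) = j * M := zpow_right_injective₀ hπ.pos hπ.lt_one.ne hdj
  have hMd : M ∣ d := Int.natCast_dvd_natCast.1 ⟨j, by rw [hdj', mul_comm]⟩
  refine (Polynomial.eq_of_monic_of_dvd_of_natDegree_le (minpoly.monic h_int) hmonic hdvd ?_).symm
  rw [Polynomial.natDegree_X_pow_sub_C]
  exact Nat.le_of_dvd (minpoly.natDegree_pos h_int) hMd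

lemma IsUniformizer.exists_apply_eq_mul [Fact p.Prime] [IsAlgClosed Ω] [IsGalois K Ω] {π : K}
    (hπ : S.IsUniformizer π) {n M : ℕ} (hn : n.Coprime p) (hM : 0 < M) {ε ρ : Ω} (hε : ε ^ M = 1)
    (hρ : ρ ^ M = algebraMap K Ω π) :
    ∃ h : Ω ≃ₐ[K] Ω, (∀ ζ : Ω, ζ ^ n = 1 → h ζ = ζ) ∧ h ρ = ε * ρ := by
  have hpos := pos_of_coprime hn
  have : NeZero n := ⟨hpos.ne'⟩
  obtain ⟨ζ, hζ⟩ := S.exists_primitiveRoot hn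
  obtain ⟨F, hF⟩ : ∃ F, F = IntermediateField.adjoin K {ζ} := ⟨_, rfl⟩
  have hmin := hπ.minpoly_eq hn hM hζ.pow_eq_one hρ hF
  have hconj : IsConjRoot F (ε * ρ) ρ := by
    refine ((isConjRoot_iff_aeval_eq_zero (Algebra.IsIntegral.isIntegral ρ)).2 ?_).symm
    rw [hmin]
    simp only [map_sub, map_pow, Polynomial.aeval_X, Polynomial.aeval_C, mul_pow, hε, one_mul,
      ← IsScalarTower.algebraMap_apply K F Ω π, hρ, sub_self]
  obtain ⟨σ, hσ⟩ := hconj.exists_algEquiv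
  refine ⟨σ.restrictScalars K, fun ξ hξ => ?_, hσ⟩
  obtain ⟨i, -, rfl⟩ := hζ.eq_pow_of_pow_eq_one hξ
  have : σ ζ = ζ := σ.commutes ⟨ζ, hF.ge (IntermediateField.mem_adjoin_simple_self K ζ)⟩
  rw [map_pow]
  exact congrArg (· ^ i) this

/-- Inertia acts transitively on the roots of a uniformizer. -/
lemma IsUniformizer.exists_mem_inertia_apply_eq_mul [Fact p.Prime] [IsAlgClosed Ω] [IsGalois K Ω]
    {π : K} (hπ : S.IsUniformizer π) {M : ℕ} (hM : 0 < M) {ε ρ : Ω} (hε : ε ^ M = 1)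
    (hρ : ρ ^ M = algebraMap K Ω π) :
    ∃ h ∈ primeToPInertia p K Ω, h ρ = ε * ρ := by
  obtain ⟨h, hh⟩ := exists_forall_mem_of_antitone_dvd (p := p)
    (fun n => {h : Ω ≃ₐ[K] Ω | h ρ = ε * ρ} ∩
      ⋂ (ζ : Ω) (_ : ζ ^ n = 1), {h : Ω ≃ₐ[K] Ω | h ζ = ζ})
    (fun n => (isClosed_setOf_algEquiv_apply_eq _ _).inter <| isClosed_iInter fun ζ =>
      isClosed_iInter fun _ => isClosed_setOf_algEquiv_apply_eq _ _)
    (fun n m hnm σ hσ => by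
      simp only [Set.mem_inter_iff, Set.mem_iInter] at hσ ⊢
      obtain ⟨c, rfl⟩ := hnm
      exact ⟨hσ.1, fun ζ hζ => hσ.2 ζ (by rw [pow_mul, hζ, one_pow])⟩)
    (fun n hn => by
      obtain ⟨h, hh, hhρ⟩ := hπ.exists_apply_eq_mul hn hM hε hρ
      exact ⟨h, hhρ, by simpa using hh⟩)
  refine ⟨h, fun n ζ hn hζ => ?_, (hh 1 (Nat.coprime_one_left p)).1⟩
  have := (hh n hn).2
  simp only [Set.mem_iInter] at this
  exact this ζ hζ

end InvariantAbs


namespace InvariantAbs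

variable {p : ℕ} {K Ω : Type*} [Field K] [Field Ω] [Algebra K Ω] (S : InvariantAbs p K Ω)

lemma v_coeff_zero_minpoly [IsAlgClosed Ω] [IsGalois K Ω] (x : Ω) :
    S.v (algebraMap K Ω ((minpoly K x).coeff 0)) = S.v x ^ (minpoly K x).natDegree := by
  have h_int : IsIntegral K x := Algebra.IsIntegral.isIntegral x
  set P := (minpoly K x).map (algebraMap K Ω) with hP
  have hvroot : ∀ r ∈ P.roots, S.v r = S.v x := fun r hr => by
    have h1 : Polynomial.aeval r (minpoly K x) = 0 := by
      have := Polynomial.isRoot_of_mem_roots hr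
      rwa [hP, Polynomial.IsRoot, Polynomial.eval_map_algebraMap] at this
    obtain ⟨σ, hσ⟩ := ((isConjRoot_iff_aeval_eq_zero h_int).2 h1).exists_algEquiv
    rw [← hσ, S.map_eq]
  have hcard : P.roots.card = (minpoly K x).natDegree := by
    rw [← (IsAlgClosed.splits P).natDegree_eq_card_roots, hP, Polynomial.natDegree_map]
  rw [← Polynomial.coeff_map, ← hP,
    (IsAlgClosed.splits P).coeff_zero_eq_prod_roots_of_monic ((minpoly.monic h_int).map _),
    map_mul, map_pow, S.v.map_neg, map_one, one_pow, one_mul, map_multiset_prod,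
    Multiset.map_congr rfl hvroot, Multiset.map_const', Multiset.prod_replicate, hcard]

variable {S}

lemma IsUniformizer.exists_pow_eq_zpow [IsAlgClosed Ω] [IsGalois K Ω] {π : K}
    (hπ : S.IsUniformizer π) {x : Ω} (hx : x ≠ 0) :
    ∃ (m : ℕ) (j : ℤ), 0 < m ∧ S.v x ^ m = S.v (algebraMap K Ω π) ^ j := by
  have h_int : IsIntegral K x := Algebra.IsIntegral.isIntegral x
  obtain ⟨j, hj⟩ := hπ.exists_zpow _ (minpoly.coeff_zero_ne_zero h_int hx)
  exact ⟨_, j, minpoly.natDegree_pos h_int, by rw [← hj, S.v_coeff_zero_minpoly]⟩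

lemma pow_apply_eq_pow_mul {h : Ω ≃ₐ[K] Ω} {ε ρ : Ω} (hε : h ε = ε) (hρ : h ρ = ε * ρ) (i : ℕ) :
    (h ^ i) ρ = ε ^ i * ρ := by
  induction i with
  | zero => simp
  | succ i ih => rw [pow_succ', AlgEquiv.mul_apply, ih, map_mul, map_pow, hε, hρ]; ring

variable [Fact p.Prime] [IsAlgClosed Ω] [IsGalois K Ω] {π : K} {N : ℕ} {ϖ : Ω}

lemma IsUniformizer.isWild_of_forall_apply_eq (hπ : S.IsUniformizer π)
    (hϖ : ϖ ^ N = algebraMap K Ω π) {u : Ω ≃ₐ[K] Ω} (hu : u ∈ primeToPInertia p K Ω)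
    (h : ∀ (n : ℕ) (ρ : Ω), n.Coprime p → ρ ^ n = ϖ → u ρ = ρ) : S.IsWild u := by
  intro x hx
  have hp : p.Prime := Fact.out
  obtain ⟨M, j, hM, hj⟩ := hπ.exists_pow_eq_zpow hx
  obtain ⟨a, m, hm, rfl⟩ := Nat.exists_eq_pow_mul_and_not_dvd hM.ne' p hp.ne_one
  have hm' : m.Coprime p := ((Nat.Prime.coprime_iff_not_dvd hp).2 hm).symm
  have hmpos := pos_of_coprime hm'
  obtain ⟨ρ, hρ⟩ := IsAlgClosed.exists_pow_nat_eq ϖ hmpos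
  have hπρ : algebraMap K Ω π = (ρ ^ N) ^ m := by rw [← hϖ, ← hρ, ← pow_mul, ← pow_mul, mul_comm]
  have hρN : ρ ^ N ≠ 0 := fun h0 => by
    have := hπ.pos
    rw [hπρ, h0, zero_pow hmpos.ne', map_zero] at this
    exact lt_irrefl _ this
  have hd : (ρ ^ N) ^ j ≠ 0 := zpow_ne_zero j hρN
  set y := x ^ p ^ a / (ρ ^ N) ^ j with hy
  have hvy : S.v y = 1 := by
    refine (pow_eq_one_iff_of_nonneg (S.v.nonneg _) hmpos.ne').1 ?_
    rw [hy, map_div₀, div_pow, map_pow, ← pow_mul, hj, hπρ, map_zpow₀, map_pow S.v (ρ ^ N) m,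
      ← zpow_natCast (S.v (ρ ^ N)) m, ← zpow_natCast (_ ^ j) m, ← zpow_mul, ← zpow_mul, mul_comm,
      div_self (zpow_ne_zero _ (S.v.ne_zero hρN))]
  have hy0 : y ≠ 0 := fun h0 => by simp [h0] at hvy
  have hlt := S.apply_sub_lt_one_of_mem_inertia hu hvy
  rw [← hvy, ← S.div_sub_one_lt_iff hy0] at hlt
  have huy : u y / y = (u x / x) ^ p ^ a := by
    have : u y = (u x) ^ p ^ a / (ρ ^ N) ^ j := by
      rw [hy, map_div₀, map_pow, map_zpow₀, map_pow, h m ρ hm' hρ]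
    rw [this, hy, div_pow, div_div_div_cancel_right₀ hd]
  rw [huy] at hlt
  exact (S.div_sub_one_lt_iff hx).1 (S.sub_one_lt_of_pow_p_pow hlt)

lemma IsUniformizer.exists_pow_apply_eq (hπ : S.IsUniformizer π) (hN : N.Coprime p)
    (hϖ : ϖ ^ N = algebraMap K Ω π) {g : Ω ≃ₐ[K] Ω} (hg : g ∈ primeToPInertia p K Ω)
    (hgϖ : g ϖ = ϖ) {n : ℕ} (hn : n.Coprime p) :
    ∃ h ∈ primeToPInertia p K Ω, ∀ (k : ℕ) (ρ : Ω), k.Coprime p → k ∣ n → ρ ^ k = ϖ →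
      (h ^ N) ρ = g ρ := by
  have hnpos := pos_of_coprime hn
  have hNpos := pos_of_coprime hN
  obtain ⟨r, hr⟩ := IsAlgClosed.exists_pow_nat_eq ϖ hnpos
  have hϖ0 : ϖ ≠ 0 := fun h0 => by
    have := hπ.pos
    rw [← hϖ, h0, zero_pow hNpos.ne', map_zero] at this
    exact lt_irrefl _ this
  have hr0 : r ≠ 0 := fun h0 => by
    rw [h0, zero_pow hnpos.ne'] at hr
    exact hϖ0 hr.symm
  have hδ : (g r / r) ^ n = 1 := by rw [div_pow, ← map_pow, hr, hgϖ, div_self hϖ0]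
  obtain ⟨ε, hε⟩ := IsAlgClosed.exists_pow_nat_eq (g r / r) hNpos
  have hεN : ε ^ (N * n) = 1 := by rw [pow_mul, hε, hδ]
  have hrN : r ^ (N * n) = algebraMap K Ω π := by rw [mul_comm, pow_mul, hr, hϖ]
  obtain ⟨h, hh, hhr⟩ := hπ.exists_mem_inertia_apply_eq_mul (Nat.mul_pos hNpos hnpos) hεN hrN
  have hhN : (h ^ N) r = g r := by
    rw [pow_apply_eq_pow_mul (hh _ ε (hN.mul_left hn) hεN) hhr, hε, div_mul_cancel₀ _ hr0]
  refine ⟨h, hh, ?_⟩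
  rintro k ρ hk ⟨c, rfl⟩ hρ
  have hη : (ρ / r ^ c) ^ k = 1 := by
    rw [div_pow, hρ, ← pow_mul, mul_comm c, hr, div_self hϖ0]
  have hρ' : ρ = ρ / r ^ c * r ^ c := (div_mul_cancel₀ _ (pow_ne_zero _ hr0)).symm
  rw [hρ', map_mul, map_mul, map_pow, map_pow, hhN, hg k _ hk hη,
    (pow_mem hh N : h ^ N ∈ primeToPInertia p K Ω) k _ hk hη]

/-- An element of inertia fixing `ϖ` is an `N`-th power of inertia up to wild inertia. -/
lemma IsUniformizer.exists_isWild_inv_mul_pow (hπ : S.IsUniformizer π) (hN : N.Coprime p)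
    (hϖ : ϖ ^ N = algebraMap K Ω π) {g : Ω ≃ₐ[K] Ω} (hg : g ∈ primeToPInertia p K Ω)
    (hgϖ : g ϖ = ϖ) : ∃ h ∈ primeToPInertia p K Ω, S.IsWild (g⁻¹ * h ^ N) := by
  obtain ⟨h, hh⟩ := exists_forall_mem_of_antitone_dvd (p := p)
    (fun n => (primeToPInertia p K Ω : Set (Ω ≃ₐ[K] Ω)) ∩
      ⋂ (k : ℕ) (ρ : Ω) (_ : k.Coprime p) (_ : k ∣ n) (_ : ρ ^ k = ϖ),
        {h : Ω ≃ₐ[K] Ω | (h ^ N) ρ = g ρ})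
    (fun n => (isClosed_primeToPInertia p).inter <| isClosed_iInter fun k =>
      isClosed_iInter fun ρ => isClosed_iInter fun _ => isClosed_iInter fun _ =>
        isClosed_iInter fun _ => isClosed_setOf_algEquiv_apply_eq_apply _ _ _)
    (fun n m hnm σ hσ => by
      simp only [Set.mem_inter_iff, Set.mem_iInter] at hσ ⊢
      exact ⟨hσ.1, fun k ρ hk hkn => hσ.2 k ρ hk (hkn.trans hnm)⟩)
    (fun n hn => by
      obtain ⟨h, hh, hhρ⟩ := hπ.exists_pow_apply_eq hN hϖ hg hgϖ hn
      refine ⟨h, hh, ?_⟩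
      simp only [Set.mem_iInter]
      exact hhρ)
  have hI : h ∈ primeToPInertia p K Ω := (hh 1 (Nat.coprime_one_left p)).1
  refine ⟨h, hI, hπ.isWild_of_forall_apply_eq hϖ (mul_mem (inv_mem hg) (pow_mem hI N)) ?_⟩
  intro n ρ hn hρ
  have := (hh n hn).2
  simp only [Set.mem_iInter] at this
  rw [AlgEquiv.mul_apply, this n ρ hn dvd_rfl hρ, ← AlgEquiv.mul_apply, inv_mul_cancel,
    AlgEquiv.one_apply]

end InvariantAbs


namespace InvariantAbs

variable {p : ℕ} {K Ω : Type*} [Field K] [Field Ω] [Algebra K Ω] {S : InvariantAbs p K Ω}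

lemma IsWild.mul {w w' : Ω ≃ₐ[K] Ω} (hw : S.IsWild w) (hw' : S.IsWild w') :
    S.IsWild (w * w') := fun x hx => by
  refine S.sub_lt_trans (y := w x) ?_ (hw x hx)
  rw [AlgEquiv.mul_apply, ← map_sub, S.map_eq]
  exact hw' x hx

/-- The Kummer character `σ ↦ σ ϖ / ϖ`. -/
def kummerCharacter {N : ℕ} [NeZero N] {ϖ : Ω} {π : K} (hϖ : ϖ ^ N = algebraMap K Ω π)
    (hϖ0 : ϖ ≠ 0) (hfix : ∀ ζ : Ω, ζ ^ N = 1 → ∀ σ : Ω ≃ₐ[K] Ω, σ ζ = ζ) :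
    (Ω ≃ₐ[K] Ω) →* rootsOfUnity N Ω :=
  have h : ∀ σ : Ω ≃ₐ[K] Ω, (σ ϖ / ϖ) ^ N = 1 := fun σ => by
    rw [div_pow, ← map_pow, hϖ, AlgEquiv.commutes, ← hϖ, div_self (pow_ne_zero _ hϖ0)]
  { toFun := fun σ => rootsOfUnity.mkOfPowEq (σ ϖ / ϖ) (h σ)
    map_one' := by
      refine Subtype.ext (Units.ext ?_)
      rw [rootsOfUnity.coe_mkOfPowEq]
      exact div_self hϖ0
    map_mul' := fun σ τ => by
      refine Subtype.ext (Units.ext ?_)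
      change (σ * τ) ϖ / ϖ = σ ϖ / ϖ * (τ ϖ / ϖ)
      nth_rewrite 1 [← hfix _ (h τ) σ]
      rw [map_div₀, AlgEquiv.mul_apply, mul_comm, div_mul_div_cancel₀]
      exact (map_ne_zero σ).2 hϖ0 }

lemma kummerCharacter_coe {N : ℕ} [NeZero N] {ϖ : Ω} {π : K} (hϖ : ϖ ^ N = algebraMap K Ω π)
    (hϖ0 : ϖ ≠ 0) (hfix : ∀ ζ : Ω, ζ ^ N = 1 → ∀ σ : Ω ≃ₐ[K] Ω, σ ζ = ζ) (σ : Ω ≃ₐ[K] Ω) :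
    ((kummerCharacter hϖ hϖ0 hfix σ : Ωˣ) : Ω) = σ ϖ / ϖ := rfl

lemma kummerCharacter_eq_one_iff {N : ℕ} [NeZero N] {ϖ : Ω} {π : K}
    (hϖ : ϖ ^ N = algebraMap K Ω π) (hϖ0 : ϖ ≠ 0)
    (hfix : ∀ ζ : Ω, ζ ^ N = 1 → ∀ σ : Ω ≃ₐ[K] Ω, σ ζ = ζ) (σ : Ω ≃ₐ[K] Ω) :
    kummerCharacter hϖ hϖ0 hfix σ = 1 ↔ σ ϖ = ϖ := by
  rw [← div_eq_one_iff_eq hϖ0, ← kummerCharacter_coe hϖ hϖ0 hfix, Subtype.ext_iff, Units.ext_iff]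
  rfl

variable [Fact p.Prime]

lemma IsWild.mk_eq_one_of_pow_eq_one [Algebra.IsIntegral K Ω] {w : Ω ≃ₐ[K] Ω} (hw : S.IsWild w)
    {n : ℕ} (hn : n.Coprime p)
    (h : (QuotientGroup.mk w : TopologicalAbelianization (Ω ≃ₐ[K] Ω)) ^ n = 1) :
    (QuotientGroup.mk w : TopologicalAbelianization (Ω ≃ₐ[K] Ω)) = 1 := by
  have hcl : IsClosed ((commutator (Ω ≃ₐ[K] Ω)).topologicalClosure : Set (Ω ≃ₐ[K] Ω)) :=
    Subgroup.isClosed_topologicalClosure _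
  have hφ : Filter.Tendsto (fun k : ℕ => n.totient * k) Filter.atTop Filter.atTop :=
    Filter.tendsto_id.const_mul_atTop' (Nat.totient_pos.2 (pos_of_coprime hn))
  have hlim : Filter.Tendsto (fun k : ℕ =>
      (QuotientGroup.mk (w ^ p ^ (n.totient * k)) : TopologicalAbelianization (Ω ≃ₐ[K] Ω)))
      Filter.atTop (nhds 1) :=
    (QuotientGroup.continuous_mk.tendsto _).comp (hw.tendsto_pow.comp hφ)
  refine tendsto_nhds_unique (Filter.Tendsto.congr (fun k => ?_) hlim) tendsto_const_nhds |>.symm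
  rw [QuotientGroup.mk_pow]
  have hmod : p ^ (n.totient * k) ≡ 1 [MOD n] := by
    have := (Nat.ModEq.pow_totient hn.symm).pow k
    rwa [one_pow, ← pow_mul] at this
  rw [← pow_one (QuotientGroup.mk w : TopologicalAbelianization (Ω ≃ₐ[K] Ω)), ← pow_mul, one_mul]
  exact pow_eq_pow_iff_modEq.2 (hmod.of_dvd (orderOf_dvd_of_pow_eq_one h))

section Frobenius

variable [IsAlgClosed Ω] [IsGalois K Ω] {f : ℕ}

lemma exists_isWild_mk_pow_eq
    (hres : ∀ a : K, S.v (algebraMap K Ω a) ≤ 1 →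
      S.v (algebraMap K Ω a ^ p ^ f - algebraMap K Ω a) < 1)
    {h : Ω ≃ₐ[K] Ω} (hh : h ∈ primeToPInertia p K Ω) :
    ∃ w : Ω ≃ₐ[K] Ω, S.IsWild w ∧
      (QuotientGroup.mk h : TopologicalAbelianization (Ω ≃ₐ[K] Ω)) ^ (p ^ f - 1) =
        (QuotientGroup.mk w)⁻¹ := by
  obtain ⟨φ, hφ⟩ := S.exists_frobenius hres
  refine ⟨_, S.isWild_frobenius_conj hh hφ, ?_⟩
  have hq : p ^ f = p ^ f - 1 + 1 :=
    (Nat.sub_add_cancel (Nat.one_le_pow _ _ (Fact.out : p.Prime).pos)).symm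
  simp only [QuotientGroup.mk_mul, QuotientGroup.mk_inv, QuotientGroup.mk_pow]
  generalize (QuotientGroup.mk h : TopologicalAbelianization (Ω ≃ₐ[K] Ω)) = x
  generalize (QuotientGroup.mk φ : TopologicalAbelianization (Ω ≃ₐ[K] Ω)) = y
  rw [mul_inv, inv_inv, mul_comm y x, mul_inv_cancel_right]
  nth_rewrite 2 [hq]
  rw [pow_succ', inv_mul_cancel_left]

variable {π : K} {ϖ : Ω}

lemma coprime_pow_sub_one (hf : f ≠ 0) : (p ^ f - 1).Coprime p :=
  Nat.Coprime.coprime_dvd_right (dvd_pow_self p hf) ((Nat.coprime_self_sub_left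
    (Nat.one_le_pow _ _ (Fact.out : p.Prime).pos)).2 (Nat.coprime_one_left _))

lemma mk_eq_one_of_apply_eq
    (hres : ∀ a : K, S.v (algebraMap K Ω a) ≤ 1 →
      S.v (algebraMap K Ω a ^ p ^ f - algebraMap K Ω a) < 1)
    (hπ : S.IsUniformizer π) (hϖ : ϖ ^ (p ^ f - 1) = algebraMap K Ω π)
    (hf : f ≠ 0) {g : Ω ≃ₐ[K] Ω} (hg : g ϖ = ϖ) {n : ℕ}
    (hn : n.Coprime p)
    (h : (QuotientGroup.mk g : TopologicalAbelianization (Ω ≃ₐ[K] Ω)) ^ n = 1) :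
    (QuotientGroup.mk g : TopologicalAbelianization (Ω ≃ₐ[K] Ω)) = 1 := by
  have hgI : g ∈ primeToPInertia p K Ω := by
    refine S.mem_inertia_of_pow_mem (pos_of_coprime hn) (S.closure_commutator_le_inertia ?_)
    rwa [← QuotientGroup.mk_pow, QuotientGroup.eq_one_iff] at h
  obtain ⟨σ, hσ, hw⟩ := hπ.exists_isWild_inv_mul_pow (coprime_pow_sub_one hf) hϖ hgI hg
  obtain ⟨w, hw', hσw⟩ := exists_isWild_mk_pow_eq hres hσ
  have hgw : (QuotientGroup.mk g : TopologicalAbelianization (Ω ≃ₐ[K] Ω)) =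
      (QuotientGroup.mk (g⁻¹ * σ ^ (p ^ f - 1) * w))⁻¹ := by
    simp only [QuotientGroup.mk_mul, QuotientGroup.mk_inv, QuotientGroup.mk_pow, hσw]
    rw [inv_mul_cancel_right, inv_inv]
  rw [hgw, inv_pow, inv_eq_one] at h
  rw [hgw, inv_eq_one]
  exact (hw.mul hw').mk_eq_one_of_pow_eq_one hn h

lemma exists_mk_pow_eq_one
    (hres : ∀ a : K, S.v (algebraMap K Ω a) ≤ 1 →
      S.v (algebraMap K Ω a ^ p ^ f - algebraMap K Ω a) < 1)
    (hπ : S.IsUniformizer π) (hϖ : ϖ ^ (p ^ f - 1) = algebraMap K Ω π)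
    (hf : f ≠ 0) {ζ : Ω} (hζ : ζ ^ (p ^ f - 1) = 1) :
    ∃ b : Ω ≃ₐ[K] Ω, b ϖ = ζ * ϖ ∧
      (QuotientGroup.mk b : TopologicalAbelianization (Ω ≃ₐ[K] Ω)) ^ (p ^ f - 1) = 1 := by
  have hcl : IsClosed ((commutator (Ω ≃ₐ[K] Ω)).topologicalClosure : Set (Ω ≃ₐ[K] Ω)) :=
    Subgroup.isClosed_topologicalClosure _
  have hN := coprime_pow_sub_one (p := p) hf
  obtain ⟨h, hh, hhϖ⟩ := hπ.exists_mem_inertia_apply_eq_mul (pos_of_coprime hN) hζ hϖ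
  obtain ⟨w, hw, hhw⟩ := exists_isWild_mk_pow_eq hres hh
  let U : Ultrafilter (Ω ≃ₐ[K] Ω) := (Filter.hyperfilter ℕ).map fun k => h ^ p ^ (f * k)
  have hU : Filter.Tendsto (fun k : ℕ => h ^ p ^ (f * k)) (Filter.hyperfilter ℕ) (nhds U.lim) :=
    U.le_nhds_lim
  refine ⟨U.lim, ?_, ?_⟩
  · refine (isClosed_setOf_algEquiv_apply_eq ϖ (ζ * ϖ)).mem_of_tendsto hU
      (Filter.Eventually.of_forall fun k => ?_)
    have hmod : p ^ (f * k) ≡ 1 [MOD (p ^ f - 1)] := by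
      have : p ^ f ≡ 1 [MOD (p ^ f - 1)] :=
        ((Nat.modEq_iff_dvd' (Nat.one_le_pow _ _ (Fact.out : p.Prime).pos)).2 dvd_rfl).symm
      simpa [pow_mul] using this.pow k
    have hζk : ζ ^ p ^ (f * k) = ζ := by
      rw [pow_eq_pow_mod _ hζ, hmod, ← pow_eq_pow_mod 1 hζ, pow_one]
    change (h ^ p ^ (f * k)) ϖ = ζ * ϖ
    rw [pow_apply_eq_pow_mul (hh _ ζ hN hζ) hhϖ, hζk]
  · have hlim₁ : Filter.Tendsto (fun k : ℕ =>
        (QuotientGroup.mk (h ^ p ^ (f * k)) : TopologicalAbelianization (Ω ≃ₐ[K] Ω)) ^ (p ^ f - 1))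
        (Filter.hyperfilter ℕ) (nhds (QuotientGroup.mk U.lim ^ (p ^ f - 1))) :=
      ((QuotientGroup.continuous_mk.tendsto _).comp hU).pow _
    have hφ : Filter.Tendsto (fun k : ℕ => f * k) Filter.atTop Filter.atTop :=
      Filter.tendsto_id.const_mul_atTop' (Nat.pos_of_ne_zero hf)
    have hlim₂ : Filter.Tendsto (fun k : ℕ =>
        (QuotientGroup.mk (w ^ p ^ (f * k)) : TopologicalAbelianization (Ω ≃ₐ[K] Ω))⁻¹)
        (Filter.hyperfilter ℕ) (nhds 1⁻¹) :=
      (((QuotientGroup.continuous_mk.tendsto _).comp (hw.tendsto_pow.comp hφ)).inv).mono_left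
        Nat.hyperfilter_le_atTop
    rw [← inv_one]
    refine tendsto_nhds_unique hlim₁ (hlim₂.congr fun k => ?_)
    rw [QuotientGroup.mk_pow, QuotientGroup.mk_pow, ← inv_pow, ← hhw, ← pow_mul, ← pow_mul,
      mul_comm]

end Frobenius

lemma mem_iff_of_forall_mem_iff {A : Type*} [CommGroup A] {C : Subgroup A}
    (hC : ∀ x, x ∈ C ↔ ∃ n : ℕ, n.Coprime p ∧ x ^ n = 1) (x : A) :
    x ∈ C ↔ IsOfFinOrder x ∧ ¬ p ∣ orderOf x := by
  have hp : p.Prime := Fact.out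
  rw [hC]
  constructor
  · rintro ⟨n, hn, hx⟩
    refine ⟨isOfFinOrder_iff_pow_eq_one.2 ⟨n, pos_of_coprime hn, hx⟩, fun hdvd => ?_⟩
    exact (hp.coprime_iff_not_dvd.1 hn.symm) (hdvd.trans (orderOf_dvd_of_pow_eq_one hx))
  · rintro ⟨-, hx⟩
    exact ⟨orderOf x, (hp.coprime_iff_not_dvd.2 hx).symm, pow_orderOf_eq_one x⟩

/-- The prime-to-`p` torsion of the topological abelianization of a Galois group. -/
theorem exists_subgroup_isCyclic [IsAlgClosed Ω] [IsGalois K Ω] {f : ℕ} (hf : f ≠ 0)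
    (hres : ∀ a : K, S.v (algebraMap K Ω a) ≤ 1 →
      S.v (algebraMap K Ω a ^ p ^ f - algebraMap K Ω a) < 1)
    (hfix : ∀ ζ : Ω, ζ ^ (p ^ f - 1) = 1 → ∀ σ : Ω ≃ₐ[K] Ω, σ ζ = ζ)
    {π : K} (hπ : S.IsUniformizer π) :
    ∃ C : Subgroup (TopologicalAbelianization (Ω ≃ₐ[K] Ω)), IsCyclic C ∧
      Nat.card C = p ^ f - 1 ∧ ∀ x, x ∈ C ↔ IsOfFinOrder x ∧ ¬ p ∣ orderOf x := by
  have hN := coprime_pow_sub_one (p := p) hf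
  have hpos := pos_of_coprime hN
  have : NeZero (p ^ f - 1) := ⟨hpos.ne'⟩
  have : NeZero ((p ^ f - 1 : ℕ) : Ω) := ⟨S.natCast_ne_zero_of_coprime hN⟩
  obtain ⟨ϖ, hϖ⟩ := IsAlgClosed.exists_pow_nat_eq (algebraMap K Ω π) hpos
  have hϖ0 : ϖ ≠ 0 := fun h0 => by
    have := hπ.pos
    rw [← hϖ, h0, zero_pow hpos.ne', map_zero] at this
    exact lt_irrefl _ this
  let χ := kummerCharacter hϖ hϖ0 hfix
  have hχ : (commutator (Ω ≃ₐ[K] Ω)).topologicalClosure ≤ χ.ker := by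
    refine Subgroup.topologicalClosure_minimal _ (Abelianization.commutator_subset_ker χ) ?_
    have : (χ.ker : Set (Ω ≃ₐ[K] Ω)) = {σ | σ ϖ = ϖ} :=
      Set.ext fun σ => kummerCharacter_eq_one_iff hϖ hϖ0 hfix σ
    rw [this]
    exact isClosed_setOf_algEquiv_apply_eq ϖ ϖ
  let θ : TopologicalAbelianization (Ω ≃ₐ[K] Ω) →* rootsOfUnity (p ^ f - 1) Ω :=
    QuotientGroup.lift _ χ hχ
  let C : Subgroup (TopologicalAbelianization (Ω ≃ₐ[K] Ω)) :=
    { carrier := {x | ∃ n : ℕ, n.Coprime p ∧ x ^ n = 1}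
      mul_mem' := by
        rintro x y ⟨n, hn, hx⟩ ⟨m, hm, hy⟩
        refine ⟨n * m, hn.mul_left hm, ?_⟩
        rw [mul_pow, pow_mul, hx, mul_comm n m, pow_mul, hy, one_pow, one_pow, one_mul]
      one_mem' := ⟨1, Nat.coprime_one_left p, one_pow 1⟩
      inv_mem' := by
        rintro x ⟨n, hn, hx⟩
        exact ⟨n, hn, by rw [inv_pow, hx, inv_one]⟩ }
  have hinj : Function.Injective (θ.comp C.subtype) := by
    rw [injective_iff_map_eq_one]
    rintro ⟨x, n, hn, hx⟩ hθ
    obtain ⟨g, rfl⟩ := QuotientGroup.mk_surjective x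
    exact Subtype.ext (mk_eq_one_of_apply_eq hres hπ hϖ hf
      ((kummerCharacter_eq_one_iff hϖ hϖ0 hfix g).1 hθ) hn hx)
  have hsurj : Function.Surjective (θ.comp C.subtype) := by
    intro ζ
    have hζ : ((ζ : Ωˣ) : Ω) ^ (p ^ f - 1) = 1 := by
      rw [← Units.val_pow_eq_pow_val, (mem_rootsOfUnity _ _).1 ζ.2, Units.val_one]
    obtain ⟨b, hb, hb1⟩ := exists_mk_pow_eq_one hres hπ hϖ hf hζ
    refine ⟨⟨QuotientGroup.mk b, _, hN, hb1⟩, Subtype.ext (Units.ext ?_)⟩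
    change b ϖ / ϖ = _
    rw [hb, mul_div_cancel_right₀ _ hϖ0]
  let e : C ≃* rootsOfUnity (p ^ f - 1) Ω := MulEquiv.ofBijective _ ⟨hinj, hsurj⟩
  refine ⟨C, isCyclic_of_injective e.toMonoidHom e.injective, ?_,
    mem_iff_of_forall_mem_iff fun _ => Iff.rfl⟩
  rw [Nat.card_congr e.toEquiv, HasEnoughRootsOfUnity.natCard_rootsOfUnity]

end InvariantAbs

open Polynomial

namespace InvariantAbs

section Padic

variable (p : ℕ) [Fact p.Prime]

lemma hasFiniteQuotients_padicInt : Ring.HasFiniteQuotients ℤ_[p] where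
  finiteQuotient hI :=
    IsLocalRing.isOpen_iff_finite_quotient.1 (IsDiscreteValuationRing.isOpen_iff.2 hI)

variable {p} {L : Type*} [Field L]

lemma exists_isIntegral_pow_sub_pow [CharZero L] [Algebra ℤ_[p] L] {y : L}
    (hy : IsIntegral ℤ_[p] y) :
    ∃ i j : ℕ, i < j ∧ ∃ z : L, IsIntegral ℤ_[p] z ∧ y ^ j - y ^ i = p * z := by
  let A := Algebra.adjoin ℤ_[p] {y}
  have : Module.Finite ℤ_[p] A := Module.Finite.iff_fg.2 hy.fg_adjoin_singleton
  have := hasFiniteQuotients_padicInt p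
  have := Ring.HasFiniteQuotients.of_module_finite ℤ_[p] A
  have hp0 : Ideal.span {(p : A)} ≠ ⊥ := by
    rw [Ne, Ideal.span_singleton_eq_bot]
    intro h
    exact (Fact.out : p.Prime).ne_zero
      (Nat.cast_injective (R := L) (by simpa using congrArg (algebraMap A L) h))
  have := Ring.HasFiniteQuotients.finiteQuotient hp0
  let a : A := ⟨y, Algebra.self_mem_adjoin_singleton _ _⟩
  obtain ⟨i, j, hij, h⟩ := Finite.exists_ne_map_eq_of_infinite
    fun n : ℕ => Ideal.Quotient.mk (Ideal.span {(p : A)}) (a ^ n)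
  wlog hlt : i < j generalizing i j
  · exact this j i hij.symm h.symm (by omega)
  obtain ⟨z, hz⟩ := Ideal.mem_span_singleton.1 (Ideal.Quotient.eq.1 h.symm)
  exact ⟨i, j, hlt, z, (Algebra.IsIntegral.isIntegral (R := ℤ_[p]) z).map A.val,
    by simpa using congrArg (algebraMap A L) hz⟩

variable [Algebra ℚ_[p] L]

lemma spectralNorm_natCast_lt_one : spectralNorm ℚ_[p] L (p : L) < 1 := by
  rw [← map_natCast (algebraMap ℚ_[p] L) p, spectralNorm_extends]
  exact Padic.norm_p_lt_one

lemma spectralNorm_le_one_iff [Algebra ℤ_[p] L] [IsScalarTower ℤ_[p] ℚ_[p] L]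
    [Algebra.IsAlgebraic ℚ_[p] L] {y : L} : spectralNorm ℚ_[p] L y ≤ 1 ↔ IsIntegral ℤ_[p] y := by
  have hy : IsIntegral ℚ_[p] y := (Algebra.IsAlgebraic.isAlgebraic y).isIntegral
  rw [spectralNorm, spectralValue_le_one_iff (minpoly.monic hy)]
  constructor
  · intro h
    have hl : minpoly ℚ_[p] y ∈ Polynomial.lifts (algebraMap ℤ_[p] ℚ_[p]) :=
      (Polynomial.lifts_iff_coeff_lifts _).2 fun n => ⟨⟨_, h n⟩, rfl⟩
    obtain ⟨q, hq, -, hm⟩ := Polynomial.lifts_and_natDegree_eq_and_monic hl (minpoly.monic hy)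
    refine ⟨q, hm, ?_⟩
    have := minpoly.aeval ℚ_[p] y
    rwa [← hq, aeval_map_algebraMap] at this
  · intro h n
    rw [minpoly.isIntegrallyClosed_eq_field_fractions' ℚ_[p] h, coeff_map]
    exact PadicInt.norm_le_one _

variable (p) (K Ω : Type*) [Field K] [Field Ω] [Algebra ℚ_[p] K] [Algebra K Ω] [Algebra ℚ_[p] Ω]
  [IsScalarTower ℚ_[p] K Ω] [Algebra ℤ_[p] Ω] [IsScalarTower ℤ_[p] ℚ_[p] Ω]
  [Algebra.IsAlgebraic ℚ_[p] Ω]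

/-- The unique extension of the `p`-adic absolute value to an algebraic extension of `ℚ_p`. -/
def ofSpectralNorm : InvariantAbs p K Ω where
  v :=
    { toFun := spectralNorm ℚ_[p] Ω
      map_mul' := map_mul (spectralMulAlgNorm ℚ_[p] Ω)
      nonneg' := spectralNorm_nonneg
      eq_zero' := fun x => map_eq_zero_iff_eq_zero (spectralMulAlgNorm ℚ_[p] Ω)
      add_le' := map_add_le_add (spectralMulAlgNorm ℚ_[p] Ω) }
  nonarch := isNonarchimedean_spectralNorm
  map_eq σ x := (spectralNorm_eq_of_equiv (σ.restrictScalars ℚ_[p]) x).symm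
  natCast_lt_one := spectralNorm_natCast_lt_one
  exists_pow_sub_one_lt y hy := by
    have : CharZero Ω := charZero_of_injective_algebraMap (algebraMap ℚ_[p] Ω).injective
    obtain ⟨i, j, hij, z, hz, h⟩ := exists_isIntegral_pow_sub_pow (spectralNorm_le_one_iff.1 hy.le)
    let N := spectralMulAlgNorm ℚ_[p] Ω
    change N y = 1 at hy
    refine ⟨j - i, by omega, ?_⟩
    change N _ < 1
    have h1 : N (y ^ i * (y ^ (j - i) - 1)) = N (p * z) := by
      rw [← h, mul_sub, ← pow_add, mul_one, Nat.add_sub_cancel' hij.le]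
    rw [map_mul, map_pow, hy, one_pow, one_mul, map_mul] at h1
    rw [h1]
    have h2 : N p < 1 := spectralNorm_natCast_lt_one
    have h3 : N z ≤ 1 := spectralNorm_le_one_iff.2 hz
    exact (mul_le_of_le_one_right (apply_nonneg N _) h3).trans_lt h2

end Padic

end InvariantAbs

namespace InvariantAbs

section Uniformizer

variable (p : ℕ) [Fact p.Prime] (K Ω : Type*) [Field K] [Field Ω] [Algebra ℚ_[p] K]
  [FiniteDimensional ℚ_[p] K] [Algebra K Ω] [Algebra ℚ_[p] Ω]
  [IsScalarTower ℚ_[p] K Ω] [Algebra ℤ_[p] Ω] [IsScalarTower ℤ_[p] ℚ_[p] Ω]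
  [Algebra.IsAlgebraic ℚ_[p] Ω]

lemma exists_ofSpectralNorm_pow_finrank_eq {a : K} (ha : a ≠ 0) :
    ∃ j : ℤ, (ofSpectralNorm p K Ω).v (algebraMap K Ω a) ^ Module.finrank ℚ_[p] K
      = (p : ℝ) ^ j := by
  have hai : IsIntegral ℚ_[p] a := (Algebra.IsAlgebraic.isAlgebraic a).isIntegral
  obtain ⟨e, he⟩ := minpoly.degree_dvd hai
  have hn := minpoly.natDegree_pos hai
  have hc : (minpoly ℚ_[p] a).coeff 0 ≠ 0 := minpoly.coeff_zero_ne_zero hai ha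
  have hv : (ofSpectralNorm p K Ω).v (algebraMap K Ω a) ^ (minpoly ℚ_[p] a).natDegree
      = ‖(minpoly ℚ_[p] a).coeff 0‖ := by
    change spectralNorm ℚ_[p] Ω (algebraMap K Ω a) ^ _ = _
    rw [spectralNorm.spectralNorm_eq_norm_coeff_zero_rpow,
      minpoly.algebraMap_eq (algebraMap K Ω).injective, one_div,
      Real.rpow_inv_natCast_pow (norm_nonneg _) hn.ne']
  exact ⟨-((minpoly ℚ_[p] a).coeff 0).valuation * e, by
    rw [he, pow_mul, hv, Padic.norm_eq_zpow_neg_valuation hc, zpow_mul, zpow_natCast]⟩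

lemma exists_isUniformizer : ∃ π : K, (ofSpectralNorm p K Ω).IsUniformizer π := by
  set S := ofSpectralNorm p K Ω
  have hp : p.Prime := Fact.out
  have hp1 : (1 : ℝ) < p := by exact_mod_cast hp.one_lt
  have hd : Module.finrank ℚ_[p] K ≠ 0 := Module.finrank_pos.ne'
  set d := Module.finrank ℚ_[p] K
  let H : AddSubgroup ℤ :=
    { carrier := {j | ∃ a : K, a ≠ 0 ∧ S.v (algebraMap K Ω a) ^ d = (p : ℝ) ^ j}
      zero_mem' := ⟨1, one_ne_zero, by simp⟩
      add_mem' := by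
        rintro i j ⟨a, ha, hai⟩ ⟨b, hb, hbj⟩
        exact ⟨a * b, mul_ne_zero ha hb, by
          rw [map_mul, map_mul, mul_pow, hai, hbj, zpow_add₀ (by positivity)]⟩
      neg_mem' := by
        rintro i ⟨a, ha, hai⟩
        exact ⟨a⁻¹, inv_ne_zero ha, by rw [map_inv₀, map_inv₀, inv_pow, hai, zpow_neg]⟩ }
  obtain ⟨g, hg⟩ := Int.subgroup_cyclic H
  have hmem : ∀ j, j ∈ H ↔ ∃ n : ℤ, n * g = j := fun j => by
    rw [hg, AddSubgroup.mem_closure_singleton]; rfl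
  have hpK : (p : K) ≠ 0 := by
    have : CharZero K := charZero_of_injective_algebraMap (algebraMap ℚ_[p] K).injective
    exact_mod_cast hp.ne_zero
  obtain ⟨i, hi⟩ := exists_ofSpectralNorm_pow_finrank_eq p K Ω hpK
  have hi0 : i < 0 := by
    have h : S.v (algebraMap K Ω p) ^ d < 1 := by
      rw [map_natCast]
      exact pow_lt_one₀ (S.v.nonneg _) S.natCast_lt_one hd
    rw [hi] at h
    by_contra! h0
    exact h.not_ge (one_le_zpow₀ hp1.le h0)
  have hg0 : g ≠ 0 := by
    rintro rfl
    obtain ⟨n, hn⟩ := (hmem i).1 ⟨p, hpK, hi⟩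
    omega
  have hgH : -|g| ∈ H := by
    rcases abs_choice g with h | h <;> rw [h]
    · exact (hmem _).2 ⟨-1, by ring⟩
    · exact (hmem _).2 ⟨1, by ring⟩
  obtain ⟨π, hπ0, hπ⟩ := hgH
  refine ⟨π, S.v.pos (by simpa using hπ0), ?_, fun a ha => ?_⟩
  · refine lt_of_pow_lt_pow_left₀ d zero_le_one ?_
    rw [hπ, one_pow]
    exact zpow_lt_one_of_neg₀ hp1 (by simpa using hg0)
  · obtain ⟨j, hj⟩ := exists_ofSpectralNorm_pow_finrank_eq p K Ω ha
    obtain ⟨n, hn⟩ := (hmem j).1 ⟨a, ha, hj⟩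
    obtain ⟨m, hm⟩ : ∃ m : ℤ, -|g| * m = j := by
      rcases abs_choice g with h | h <;> rw [h]
      · exact ⟨-n, by rw [← hn]; ring⟩
      · exact ⟨n, by rw [← hn]; ring⟩
    refine ⟨m, (pow_left_inj₀ (S.v.nonneg _) (zpow_nonneg (S.v.nonneg _) _) hd).1 ?_⟩
    rw [← zpow_natCast, ← zpow_natCast, ← zpow_mul, mul_comm m, zpow_mul, zpow_natCast,
      zpow_natCast, hj, hπ, ← zpow_mul, hm]

end Uniformizer

end InvariantAbs

namespace InvariantAbs

section ResidueField

open IsLocalRing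

variable (p : ℕ) [Fact p.Prime] (K Ω : Type*) [Field K] [Field Ω] [Algebra ℚ_[p] K]
  [Algebra K Ω] [Algebra ℚ_[p] Ω] [IsScalarTower ℚ_[p] K Ω] [Algebra ℤ_[p] K]
  [Algebra ℤ_[p] Ω] [IsScalarTower ℤ_[p] K Ω]
  [IsScalarTower ℤ_[p] ℚ_[p] Ω] [Algebra.IsAlgebraic ℚ_[p] Ω]

variable {K} in
lemma ofSpectralNorm_algebraMap_le_one_iff {a : K} :
    (ofSpectralNorm p K Ω).v (algebraMap K Ω a) ≤ 1 ↔ IsIntegral ℤ_[p] a :=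
  spectralNorm_le_one_iff.trans (isIntegral_algebraMap_iff (algebraMap K Ω).injective)

variable {p K} in
lemma isUnit_iff_ofSpectralNorm_eq_one {b : integralClosure ℤ_[p] K} :
    IsUnit b ↔ (ofSpectralNorm p K Ω).v (algebraMap K Ω b) = 1 := by
  have hle (c : integralClosure ℤ_[p] K) : (ofSpectralNorm p K Ω).v (algebraMap K Ω c) ≤ 1 :=
    (ofSpectralNorm_algebraMap_le_one_iff p Ω).2 c.2
  constructor
  · intro hb
    obtain ⟨c, hc⟩ := isUnit_iff_exists_inv.1 hb
    refine (hle b).antisymm ?_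
    have h := congrArg (fun x : integralClosure ℤ_[p] K =>
      (ofSpectralNorm p K Ω).v (algebraMap K Ω x)) hc
    simp only [MulMemClass.coe_mul, map_mul, OneMemClass.coe_one, map_one] at h
    rw [← h]
    exact mul_le_of_le_one_right ((ofSpectralNorm p K Ω).v.nonneg _) (hle c)
  · intro hb
    have hb0 : (b : K) ≠ 0 := fun h0 => by simp [h0] at hb
    have hi : IsIntegral ℤ_[p] (b : K)⁻¹ := by
      rw [← ofSpectralNorm_algebraMap_le_one_iff p Ω, map_inv₀, map_inv₀, hb, inv_one]
    exact isUnit_iff_exists_inv.2 ⟨⟨_, hi⟩, Subtype.ext (mul_inv_cancel₀ hb0)⟩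

variable [IsLocalRing (integralClosure ℤ_[p] K)]

variable {p K} in
lemma residue_integralClosure_eq_iff {b c : integralClosure ℤ_[p] K} :
    residue _ b = residue _ c ↔
      (ofSpectralNorm p K Ω).v (algebraMap K Ω b - algebraMap K Ω c) < 1 := by
  rw [← sub_eq_zero, ← map_sub, IsLocalRing.residue_eq_zero_iff, mem_maximalIdeal, mem_nonunits_iff,
    isUnit_iff_ofSpectralNorm_eq_one Ω, AddSubgroupClass.coe_sub, map_sub]
  have : (ofSpectralNorm p K Ω).v (algebraMap K Ω b - algebraMap K Ω c) ≤ 1 := by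
    rw [← map_sub]
    exact (ofSpectralNorm_algebraMap_le_one_iff p Ω).2 (b - c).2
  exact this.lt_iff_ne.symm

lemma charP_residueField_integralClosure [IsScalarTower ℤ_[p] ℚ_[p] K]
    [Algebra.IsAlgebraic ℚ_[p] K] : CharP (ResidueField (integralClosure ℤ_[p] K)) p := by
  refine (CharP.charP_iff_prime_eq_zero (Fact.out : p.Prime)).2 ?_
  have h : residue (integralClosure ℤ_[p] K) p = residue _ 0 :=
    (residue_integralClosure_eq_iff K).2
      (by simpa using (ofSpectralNorm p K K).natCast_lt_one)
  simpa using h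

lemma finite_residueField_integralClosure [IsScalarTower ℤ_[p] ℚ_[p] K]
    [FiniteDimensional ℚ_[p] K] :
    Finite (ResidueField (integralClosure ℤ_[p] K)) := by
  have : Module.Finite ℤ_[p] (integralClosure ℤ_[p] K) :=
    IsIntegralClosure.finite ℤ_[p] ℚ_[p] K _
  have := hasFiniteQuotients_padicInt p
  have := Ring.HasFiniteQuotients.of_module_finite ℤ_[p] (integralClosure ℤ_[p] K)
  refine Ring.HasFiniteQuotients.finiteQuotient (I := maximalIdeal _) fun h => ?_
  have := charP_residueField_integralClosure p K
  have hp : residue (integralClosure ℤ_[p] K) p = 0 := by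
    rw [map_natCast, CharP.cast_eq_zero]
  rw [IsLocalRing.residue_eq_zero_iff, h, Ideal.mem_bot] at hp
  have : CharZero K := charZero_of_injective_algebraMap (algebraMap ℚ_[p] K).injective
  exact (Fact.out : p.Prime).ne_zero (Nat.cast_injective (R := K)
    (by simpa using congrArg (algebraMap (integralClosure ℤ_[p] K) K) hp))

variable {p K}

lemma ofSpectralNorm_pow_card_sub_lt_one [Finite (ResidueField (integralClosure ℤ_[p] K))] (a : K)
    (ha : (ofSpectralNorm p K Ω).v (algebraMap K Ω a) ≤ 1) :
    (ofSpectralNorm p K Ω).v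
      (algebraMap K Ω a ^ Nat.card (ResidueField (integralClosure ℤ_[p] K)) - algebraMap K Ω a)
      < 1 := by
  let b : integralClosure ℤ_[p] K := ⟨a, (ofSpectralNorm_algebraMap_le_one_iff p Ω).1 ha⟩
  have h : residue _ (b ^ Nat.card (ResidueField (integralClosure ℤ_[p] K))) = residue _ b := by
    have := Fintype.ofFinite (ResidueField (integralClosure ℤ_[p] K))
    rw [map_pow, Nat.card_eq_fintype_card, FiniteField.pow_card]
  simpa using (residue_integralClosure_eq_iff Ω).1 h

lemma apply_eq_self_of_pow_card_sub_one_eq_one [IsAlgClosed Ω]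
    [Finite (ResidueField (integralClosure ℤ_[p] K))]
    (hq : (Nat.card (ResidueField (integralClosure ℤ_[p] K)) - 1).Coprime p) {ζ : Ω}
    (hζ : ζ ^ (Nat.card (ResidueField (integralClosure ℤ_[p] K)) - 1) = 1) (σ : Ω ≃ₐ[K] Ω) :
    σ ζ = ζ := by
  set S := ofSpectralNorm p K Ω
  obtain ⟨u, hu⟩ := IsCyclic.exists_monoid_generator
    (α := (ResidueField (integralClosure ℤ_[p] K))ˣ)
  have hord : orderOf u = Nat.card (ResidueField (integralClosure ℤ_[p] K)) - 1 := by
    rw [orderOf_eq_card_of_forall_mem_powers hu, Nat.card_units]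
  set q := Nat.card (ResidueField (integralClosure ℤ_[p] K))
  have hpos := pos_of_coprime hq
  obtain ⟨b, hb⟩ := residue_surjective (R := integralClosure ℤ_[p] K) u
  have hbu : IsUnit b := by
    rw [← residue_ne_zero_iff_isUnit, hb]
    exact u.ne_zero
  have hvb : S.v (algebraMap K Ω b) = 1 := (isUnit_iff_ofSpectralNorm_eq_one Ω).1 hbu
  obtain ⟨n, ξ, hn, hξ, hlt⟩ := S.exists_rootOfUnity_sub_lt hvb
  have hvξ : S.v ξ = 1 := S.eq_one_of_pow_eq_one (pos_of_coprime hn) hξ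
  have hpow (i : ℕ) : ξ ^ i = 1 ↔ u ^ i = 1 := by
    have hi : S.v (algebraMap K Ω b ^ i - ξ ^ i) < 1 := by
      have := S.pow_sub_pow_lt (hlt.trans_eq hvξ.symm) i
      rwa [map_pow S.v ξ, hvξ, one_pow] at this
    have hu : u ^ i = 1 ↔ S.v (algebraMap K Ω b ^ i - 1) < 1 := by
      have := residue_integralClosure_eq_iff Ω (b := b ^ i) (c := 1)
      rw [map_pow, hb, map_one] at this
      rw [← Units.val_inj, Units.val_pow_eq_pow_val, Units.val_one, this]
      simp [S]
    rw [hu]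
    constructor
    · intro h
      rwa [h] at hi
    · intro h
      refine S.eq_one_of_sub_one_lt hn (by rw [pow_right_comm, hξ, one_pow]) ?_
      rw [S.v.map_sub] at hi
      exact S.sub_lt_trans hi h
  have hprim : IsPrimitiveRoot ξ (q - 1) := by
    rw [← hord]
    exact ⟨(hpow _).2 (pow_orderOf_eq_one u), fun i hi => orderOf_dvd_of_pow_eq_one ((hpow i).1 hi)⟩
  have hσξ : σ ξ = ξ := by
    refine S.eq_of_sub_lt_one hn hn (by rw [← map_pow, hξ, map_one]) hξ ?_
    have h : S.v (σ ξ - algebraMap K Ω b) < 1 := by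
      rwa [S.v.map_sub, ← AlgEquiv.commutes σ, ← map_sub, S.map_eq]
    exact S.sub_lt_trans h hlt
  have : NeZero (q - 1) := ⟨hpos.ne'⟩
  obtain ⟨i, -, rfl⟩ := hprim.eq_pow_of_pow_eq_one hζ
  rw [map_pow, hσξ]

end ResidueField

end InvariantAbs

end Tame

/-- Let `K` be a finite extension of `ℚ_p` with ring of integers `O_K` (the integral
closure of `ℤ_p` in `K`, a local ring) and residue field of cardinality `q = p^f`.
Then the prime-to-`p` part of the torsion subgroup of `G_K^{ab}` — the subgroup `C`
consisting exactly of the elements of finite order prime to `p` — is cyclic of order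
`q - 1`; consequently the inertia degree `f` is recovered as `f = log_p (1 + |C|)`. -/
theorem prime_to_p_torsion_of_abelianized_galois_cyclic
    [Algebra ℤ_[p] K] [IsScalarTower ℤ_[p] ℚ_[p] K]
    [IsLocalRing (integralClosure ℤ_[p] K)] :
    ∃ C : Subgroup (GabK K), IsCyclic ↥C ∧
      Nat.card ↥C
        = Nat.card (IsLocalRing.ResidueField (integralClosure ℤ_[p] K)) - 1 ∧
      (∀ x : GabK K, x ∈ C ↔ (IsOfFinOrder x ∧ ¬ p ∣ orderOf x)) ∧
      (∀ f : ℕ, Nat.card (IsLocalRing.ResidueField (integralClosure ℤ_[p] K)) = p ^ f →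
        Nat.log p (1 + Nat.card ↥C) = f) := by
  have hp : p.Prime := Fact.out
  have : CharZero K := charZero_of_injective_algebraMap (algebraMap ℚ_[p] K).injective
  have : Algebra.IsAlgebraic ℚ_[p] (AlgebraicClosure K) := Algebra.IsAlgebraic.trans ℚ_[p] K _
  have := InvariantAbs.charP_residueField_integralClosure p K
  have := InvariantAbs.finite_residueField_integralClosure p K
  have := Fintype.ofFinite (IsLocalRing.ResidueField (integralClosure ℤ_[p] K))
  obtain ⟨f, -, hf⟩ := FiniteField.card (IsLocalRing.ResidueField (integralClosure ℤ_[p] K)) p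
  rw [← Nat.card_eq_fintype_card] at hf
  obtain ⟨π, hπ⟩ := InvariantAbs.exists_isUniformizer p K (AlgebraicClosure K)
  obtain ⟨C, hC, hcard, hmem⟩ := InvariantAbs.exists_subgroup_isCyclic f.ne_zero
    (fun a ha => hf ▸ InvariantAbs.ofSpectralNorm_pow_card_sub_lt_one _ a ha)
    (fun ζ hζ σ => InvariantAbs.apply_eq_self_of_pow_card_sub_one_eq_one _
      (by rw [hf]; exact InvariantAbs.coprime_pow_sub_one f.ne_zero) (by rwa [hf]) σ) hπ
  refine ⟨C, hC, by rw [hcard, hf], hmem, fun g hg => ?_⟩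
  rw [hcard, ← hf, hg, add_comm, Nat.sub_add_cancel (Nat.one_le_pow _ _ hp.pos),
    Nat.log_pow hp.one_lt]

end
end
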